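/- Let $K = \mathbb{Q}(\zeta_{180})$ be the $180$-th cyclotomic field. Then the ideal class group of $K$ is isomorphic to $\mathbb{Z}/3\mathbb{Z} \times \mathbb{Z}/5\mathbb{Z} \times \mathbb{Z}/5\mathbb{Z}$; in particular, the class number of $K$ is $75$. -/

import Mathlib

open NumberField

section
open NumberField Polynomial
open scoped Pointwise

namespace C180

section basics
variable {K : Type*} [Field K] [NumberField K]

theorem coe_gsmul (g : Gal(K/ℚ)) (x : 𝓞 K) : ((g • x : 𝓞 K) : K) = g (x : K) := rfl

variable [hK : IsCyclotomicExtension {180} ℚ K]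

variable (K) in
/-- the standard primitive 180-th root of unity. -/
noncomputable def z : 𝓞 K := (IsCyclotomicExtension.zeta_spec 180 ℚ K).toInteger

theorem z_prim : IsPrimitiveRoot (z K) 180 :=
  (IsCyclotomicExtension.zeta_spec 180 ℚ K).toInteger_isPrimitiveRoot

theorem z_pow : (z K) ^ 180 = 1 := z_prim.pow_eq_one

theorem z_pow_mod (e : ℕ) : (z K) ^ (e % 180) = (z K) ^ e :=
  (pow_mod_orderOf (z K) e ▸ by rw [← z_prim.eq_orderOf])

theorem z_pow_inj {a b : ℕ} (h : (z K) ^ a = (z K) ^ b) : a % 180 = b % 180 := by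
  rw [← z_pow_mod a, ← z_pow_mod b] at h
  exact z_prim.pow_inj (Nat.mod_lt _ (by norm_num)) (Nat.mod_lt _ (by norm_num)) h

variable (K) in
/-- the automorphism with `ζ ↦ ζ^k`. -/
noncomputable def s (k : ℕ) : Gal(K/ℚ) :=
  if h : k.Coprime 180 then
    (IsCyclotomicExtension.Rat.galEquivZMod 180 K).symm (ZMod.unitOfCoprime k h) else 1

theorem s_z {k : ℕ} (h : k.Coprime 180) : s K k • z K = (z K) ^ k := by
  rw [IsCyclotomicExtension.Rat.galEquivZMod_smul_of_pow_eq 180 K _ z_pow, s, dif_pos h,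
    MulEquiv.apply_symm_apply, ZMod.coe_unitOfCoprime, ZMod.val_natCast, z_pow_mod]

theorem gal_ext {g h : Gal(K/ℚ)} (e : g • z K = h • z K) : g = h := by
  apply (IsCyclotomicExtension.Rat.galEquivZMod 180 K).injective
  rw [IsCyclotomicExtension.Rat.galEquivZMod_smul_of_pow_eq 180 K _ z_pow,
    IsCyclotomicExtension.Rat.galEquivZMod_smul_of_pow_eq 180 K _ z_pow] at e
  have := z_pow_inj e
  rw [Nat.mod_eq_of_lt (ZMod.val_lt _), Nat.mod_eq_of_lt (ZMod.val_lt _)] at this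
  exact Units.ext (ZMod.val_injective _ this)

theorem gal_eq_s (g : Gal(K/ℚ)) : ∃ k, k < 180 ∧ k.Coprime 180 ∧ g = s K k := by
  refine ⟨(IsCyclotomicExtension.Rat.galEquivZMod 180 K g).val.val, ZMod.val_lt _,
    ZMod.val_coe_unit_coprime _, ?_⟩
  apply gal_ext
  rw [s_z (ZMod.val_coe_unit_coprime _)]
  exact IsCyclotomicExtension.Rat.galEquivZMod_smul_of_pow_eq 180 K _ z_pow

theorem s_mul {a b : ℕ} (ha : a.Coprime 180) (hb : b.Coprime 180) :
    s K a * s K b = s K (a * b) := by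
  apply gal_ext
  rw [s_z (Nat.Coprime.mul_left ha hb), mul_smul, s_z hb, smul_pow', s_z ha, ← pow_mul]

theorem cop_mod {a : ℕ} (ha : a.Coprime 180) : (a % 180).Coprime 180 := by
  unfold Nat.Coprime at *
  rw [← Nat.gcd_rec, Nat.gcd_comm]; exact ha

theorem cop_of_mod {a b : ℕ} (ha : a.Coprime 180) (h : a % 180 = b % 180) : b.Coprime 180 := by
  have := cop_mod ha
  rw [h] at this
  unfold Nat.Coprime at *
  rwa [← Nat.gcd_rec, Nat.gcd_comm] at this

theorem s_congr {a b : ℕ} (ha : a.Coprime 180) (h : a % 180 = b % 180) : s K a = s K b := by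
  apply gal_ext
  rw [s_z ha, s_z (cop_of_mod ha h), ← z_pow_mod a, h, z_pow_mod]

theorem s_inj {a b : ℕ} (ha : a.Coprime 180) (hb : b.Coprime 180) (h : s K a = s K b) :
    a % 180 = b % 180 := by
  apply z_pow_inj (K := K)
  rw [← s_z ha, ← s_z hb, h]

theorem s_one : s K 1 = 1 := by
  apply gal_ext
  rw [s_z (by norm_num)]; simp

theorem card_gal : Fintype.card Gal(K/ℚ) = 48 := by
  rw [Fintype.card_congr (IsCyclotomicExtension.Rat.galEquivZMod 180 K).toEquiv,
    ZMod.card_units_eq_totient]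
  decide

/-- The 48 residues prime to 180. -/
def L48 : List ℕ := (List.range 180).filter (fun k => Nat.gcd k 180 = 1)

theorem prod_gal {M : Type*} [CommMonoid M] (f : Gal(K/ℚ) → M) :
    ∏ g, f g = (L48.map (fun k => f (s K k))).prod := by
  have hnd : (L48.map (fun k => s K k)).Nodup := by
    refine List.Nodup.map_on ?_ (List.Nodup.filter _ List.nodup_range)
    intro a ha b hb hab
    simp only [L48, List.mem_filter, List.mem_range, decide_eq_true_eq] at ha hb
    have := s_inj ha.2 hb.2 hab
    rwa [Nat.mod_eq_of_lt ha.1, Nat.mod_eq_of_lt hb.1] at this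
  have : (Finset.univ : Finset Gal(K/ℚ)) =
      ⟨((L48.map (fun k => s K k) : List Gal(K/ℚ)) : Multiset Gal(K/ℚ)), hnd⟩ := by
    symm
    rw [← Finset.card_eq_iff_eq_univ, card_gal]
    change (L48.map (fun k => s K k)).length = 48
    rw [List.length_map]; decide
  rw [this]
  simp [Finset.prod, Function.comp_def]

theorem phi_z : (z K)^48 + (z K)^42 - (z K)^30 - (z K)^24 - (z K)^18 + (z K)^6 + 1 = 0 := by
  obtain ⟨y, hy⟩ : ∃ y, y = (z K)^6 := ⟨_, rfl⟩
  have hy' : IsPrimitiveRoot y 30 := hy ▸ z_prim.pow (by norm_num) (by norm_num)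
  have h15 : y ^ 15 = -1 := by
    have h1 : (y^15 - 1) * (y^15 + 1) = 0 := by
      have := hy'.pow_eq_one; linear_combination this
    rcases mul_eq_zero.mp h1 with h | h
    · exfalso
      exact hy'.pow_ne_one_of_pos_of_lt (l := 15) (by norm_num) (by norm_num)
        (by linear_combination h)
    · linear_combination h
  have a1 : y + 1 ≠ 0 := fun h =>
    hy'.pow_ne_one_of_pos_of_lt (l := 2) (by norm_num) (by norm_num)
      (by linear_combination (y - 1) * h)
  have a2 : y ^ 2 - y + 1 ≠ 0 := fun h =>
    hy'.pow_ne_one_of_pos_of_lt (l := 6) (by norm_num) (by norm_num)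
      (by linear_combination (y + 1) * (y^3 - 1) * h)
  have a3 : y ^ 4 - y ^ 3 + y ^ 2 - y + 1 ≠ 0 := fun h =>
    hy'.pow_ne_one_of_pos_of_lt (l := 10) (by norm_num) (by norm_num)
      (by linear_combination (y + 1) * (y^5 - 1) * h)
  have key : ((y + 1) * ((y ^ 2 - y + 1) * (y ^ 4 - y ^ 3 + y ^ 2 - y + 1))) *
      (y^8 + y^7 - y^5 - y^4 - y^3 + y + 1) = 0 := by
    linear_combination h15
  have := (mul_eq_zero.mp key).resolve_left (mul_ne_zero a1 (mul_ne_zero a2 a3))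
  rw [hy] at this
  linear_combination this

/-- explicit cyclotomic polynomial, evaluated. -/
def Phi {R : Type*} [CommRing R] (r : R) : R :=
  r^48 + r^42 - r^30 - r^24 - r^18 + r^6 + 1

theorem minpoly_z : minpoly ℤ (z K) =
    (X^48 + X^42 - X^30 - X^24 - X^18 + X^6 + 1 : ℤ[X]) := by
  have hm : (X^48 + X^42 - X^30 - X^24 - X^18 + X^6 + 1 : ℤ[X]).Monic := by monicity!
  have hdeg : (X^48 + X^42 - X^30 - X^24 - X^18 + X^6 + 1 : ℤ[X]).natDegree = 48 := by
    compute_degree!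
  have hmin : minpoly ℤ (z K) = cyclotomic 180 ℤ := by
    rw [Polynomial.cyclotomic_eq_minpoly (z_prim.map_of_injective
      (f := algebraMap (𝓞 K) K) RingOfIntegers.coe_injective) (by norm_num)]
    exact (minpoly.algebraMap_eq RingOfIntegers.coe_injective _).symm
  have hd : minpoly ℤ (z K) ∣ (X^48 + X^42 - X^30 - X^24 - X^18 + X^6 + 1 : ℤ[X]) := by
    apply minpoly.isIntegrallyClosed_dvd (Algebra.IsIntegral.isIntegral _)
    simpa using phi_z
  have hmm := minpoly.monic (Algebra.IsIntegral.isIntegral (R := ℤ) (z K))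
  refine Polynomial.eq_of_dvd_of_natDegree_le_of_leadingCoeff hd ?_ ?_
  · rw [hdeg, hmin, natDegree_cyclotomic]; decide
  · rw [hm.leadingCoeff, hmm.leadingCoeff]

/-- evaluation hom `ζ ↦ r`. -/
noncomputable def ev (K : Type*) [Field K] [NumberField K] [IsCyclotomicExtension {180} ℚ K]
    {R : Type*} [CommRing R] (r : R) (h : Phi r = 0) : 𝓞 K →+* R :=
  ((IsCyclotomicExtension.zeta_spec 180 ℚ K).integralPowerBasis.lift r (by
    rw [IsPrimitiveRoot.integralPowerBasis_gen]
    change aeval r (minpoly ℤ (z K)) = 0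
    rw [minpoly_z]
    simpa [Phi] using h)).toRingHom

theorem ev_z {R : Type*} [CommRing R] (r : R) (h : Phi r = 0) : ev K r h (z K) = r := by
  have e : z K = (IsCyclotomicExtension.zeta_spec 180 ℚ K).integralPowerBasis.gen :=
    ((IsCyclotomicExtension.zeta_spec 180 ℚ K).integralPowerBasis_gen).symm
  rw [e]
  exact (IsCyclotomicExtension.zeta_spec 180 ℚ K).integralPowerBasis.lift_gen r _

end basics
end C180
end

section
open NumberField Polynomial
open scoped Pointwise

namespace C180

section elts
variable {K : Type*} [Field K] [NumberField K] [hK : IsCyclotomicExtension {180} ℚ K]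

variable (K) in
/-- the element `∑ c ζ^e`. -/
noncomputable def el (l : List (ℤ × ℕ)) : 𝓞 K := (l.map fun p => (p.1 : 𝓞 K) * z K ^ p.2).sum

/-- twisting of exponents. -/
def tw (k : ℕ) (l : List (ℤ × ℕ)) : List (ℤ × ℕ) := l.map fun p => (p.1, p.2 * k)

/-- evaluation at a point. -/
def evl {R : Type*} [CommRing R] (r : R) (l : List (ℤ × ℕ)) : R :=
  (l.map fun p => (p.1 : R) * r ^ p.2).sum

/-- weight. -/
def wt (l : List (ℤ × ℕ)) : ℕ := (l.map fun p => p.1.natAbs).sum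

theorem s_el {k : ℕ} (hk : k.Coprime 180) (l : List (ℤ × ℕ)) :
    s K k • el K l = el K (tw k l) := by
  induction l with
  | nil => simp [el, tw]
  | cons p l ih =>
    simp only [el, tw, List.map_cons, List.sum_cons, smul_add] at *
    rw [ih, smul_mul', smul_pow', s_z hk, ← pow_mul, mul_comm k]
    congr 2
    exact map_intCast (MulSemiringAction.toRingHom _ _ (s K k)) p.1

theorem ev_el {R : Type*} [CommRing R] (r : R) (h : Phi r = 0) (l : List (ℤ × ℕ)) :
    ev K r h (el K l) = evl r l := by
  induction l with
  | nil => simp [el, evl]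
  | cons p l ih =>
    simp only [el, evl, List.map_cons, List.sum_cons, map_add] at *
    rw [ih, map_mul, map_pow, ev_z, map_intCast]

theorem norm_z (φ : K →+* ℂ) : ‖φ (z K : 𝓞 K)‖ = 1 := by
  have h : (φ (z K : 𝓞 K)) ^ 180 = 1 := by
    rw [← map_pow, ← map_pow, z_pow, map_one, map_one]
  exact Complex.norm_eq_one_of_pow_eq_one h (by norm_num)

theorem norm_el (φ : K →+* ℂ) (l : List (ℤ × ℕ)) : ‖φ (el K l : 𝓞 K)‖ ≤ wt l := by
  induction l with
  | nil => simp [el, wt]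
  | cons p l ih =>
    simp only [el, wt, List.map_cons, List.sum_cons, map_add, Nat.cast_add] at *
    refine (norm_add_le _ _).trans (add_le_add ?_ ih)
    rw [map_mul, map_mul, map_pow, map_pow, norm_mul, norm_pow, norm_z, map_intCast, map_intCast]
    simp [Nat.cast_natAbs]

theorem wt_tw (k : ℕ) (l : List (ℤ × ℕ)) : wt (tw k l) = wt l := by
  simp [wt, tw, Function.comp_def]

theorem exists_int_of_fixed (x : 𝓞 K) (h : ∀ g : Gal(K/ℚ), g • x = x) :
    ∃ n : ℤ, x = n := by
  have : IsGalois ℚ K := IsCyclotomicExtension.isGalois {180} ℚ K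
  obtain ⟨q, hq⟩ := (IsGalois.mem_bot_iff_fixed (F := ℚ) (x : K)).mpr (fun g => by
    rw [← coe_gsmul, h])
  have hi : IsIntegral ℤ q := by
    rw [← isIntegral_algebraMap_iff (algebraMap ℚ K).injective]
    erw [hq]; exact x.isIntegral_coe
  obtain ⟨n, rfl⟩ := IsIntegrallyClosed.isIntegral_iff.mp hi
  refine ⟨n, RingOfIntegers.coe_injective ?_⟩
  exact hq.symm.trans (by simp)

theorem norm_eq_prod (x : 𝓞 K) :
    ((Algebra.norm ℤ x : ℤ) : 𝓞 K) = ∏ g : Gal(K/ℚ), g • x := by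
  have : IsGalois ℚ K := IsCyclotomicExtension.isGalois {180} ℚ K
  apply RingOfIntegers.coe_injective
  have := Algebra.norm_eq_prod_automorphisms ℚ (x : K)
  rw [← Algebra.coe_norm_int] at this
  rw [map_prod]
  simp only [map_intCast] at this ⊢
  exact this

/-- Validity of subgroup data. -/
structure HD (hl reps : List ℕ) : Prop where
  cop : ∀ h ∈ hl, Nat.gcd h 180 = 1
  lt : ∀ h ∈ hl, h < 180
  one : 1 ∈ hl
  mul : ∀ a ∈ hl, ∀ b ∈ hl, a * b % 180 ∈ hl
  inv : ∀ a ∈ hl, ∃ b ∈ hl, a * b % 180 = 1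
  nd : hl.Nodup
  rcop : ∀ h ∈ reps, Nat.gcd h 180 = 1
  rnd : reps.Nodup
  rdis : ∀ a ∈ reps, ∀ b ∈ reps, ∀ h ∈ hl, a * h % 180 = b % 180 → a = b
  len : reps.length * hl.length = 48

variable {hl reps : List ℕ}

variable (K) in
/-- The subgroup. -/
noncomputable def Hs (d : HD hl reps) : Subgroup Gal(K/ℚ) where
  carrier := {g | ∃ h ∈ hl, g = s K h}
  one_mem' := ⟨1, d.one, s_one.symm⟩
  mul_mem' := by
    rintro _ _ ⟨a, ha, rfl⟩ ⟨b, hb, rfl⟩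
    refine ⟨_, d.mul a ha b hb, ?_⟩
    rw [s_mul (d.cop a ha) (d.cop b hb)]
    exact s_congr (Nat.Coprime.mul_left (d.cop a ha) (d.cop b hb)) (by simp)
  inv_mem' := by
    rintro _ ⟨a, ha, rfl⟩
    obtain ⟨b, hb, hab⟩ := d.inv a ha
    refine ⟨b, hb, inv_eq_of_mul_eq_one_right ?_⟩
    rw [s_mul (d.cop a ha) (d.cop b hb),
      s_congr (b := 1) (Nat.Coprime.mul_left (d.cop a ha) (d.cop b hb)) (by rw [hab]), s_one]

theorem mem_Hs (d : HD hl reps) (g : Gal(K/ℚ)) : g ∈ Hs K d ↔ ∃ h ∈ hl, g = s K h := Iff.rfl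

noncomputable instance (d : HD hl reps) : Fintype (Hs K d) := Fintype.ofFinite _

theorem prod_Hs (d : HD hl reps) {M : Type*} [CommMonoid M] (f : Gal(K/ℚ) → M) :
    ∏ g : Hs K d, f g = (hl.map (fun k => f (s K k))).prod := by
  classical
  have hnd : (hl.map (fun k => s K k)).Nodup := by
    refine List.Nodup.map_on ?_ d.nd
    intro a ha b hb hab
    have := s_inj (d.cop a ha) (d.cop b hb) hab
    rwa [Nat.mod_eq_of_lt (d.lt a ha), Nat.mod_eq_of_lt (d.lt b hb)] at this
  have e : ∏ g : Hs K d, f g = ∏ g ∈ (hl.map (fun k => s K k)).toFinset, f g := by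
    refine Finset.prod_bij (fun g _ => (g : Gal(K/ℚ))) ?_ ?_ ?_ ?_
    · rintro ⟨g, h, hh, rfl⟩ _
      simp only [List.mem_toFinset, List.mem_map]
      exact ⟨h, hh, rfl⟩
    · intro a _ b _ h; exact Subtype.ext h
    · intro b hb
      simp only [List.mem_toFinset, List.mem_map] at hb
      obtain ⟨h, hh, rfl⟩ := hb
      exact ⟨⟨s K h, h, hh, rfl⟩, Finset.mem_univ _, rfl⟩
    · intros; rfl
  rw [e, List.prod_toFinset f hnd, List.map_map]
  rfl

theorem card_Hs (d : HD hl reps) : Nat.card (Hs K d) = hl.length := by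
  have := prod_Hs (K := K) d (M := Multiplicative ℕ) (fun _ => Multiplicative.ofAdd 1)
  rw [Finset.prod_const, List.map_const', List.prod_replicate, ← ofAdd_nsmul, ← ofAdd_nsmul] at this
  have h2 := Multiplicative.ofAdd.injective this
  simpa [Nat.card_eq_fintype_card] using h2

theorem card_quot (d : HD hl reps) : Nat.card (Gal(K/ℚ) ⧸ Hs K d) = reps.length := by
  have h1 := (Hs K d).card_eq_card_quotient_mul_card_subgroup
  rw [Nat.card_eq_fintype_card (α := Gal(K/ℚ)), card_gal, card_Hs, ← d.len] at h1
  have : 0 < hl.length := List.length_pos_of_mem d.one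
  exact (Nat.eq_of_mul_eq_mul_right this h1).symm

theorem prod_reps (d : HD hl reps) {M : Type*} [CommMonoid M] (f : Gal(K/ℚ) ⧸ Hs K d → M)  :
    (reps.map (fun k => f (s K k : Gal(K/ℚ) ⧸ Hs K d))).prod = ∏ᶠ q, f q := by
  classical
  have hnd : (reps.map (fun k => (s K k : Gal(K/ℚ) ⧸ Hs K d))).Nodup := by
    refine List.Nodup.map_on ?_ d.rnd
    intro a ha b hb hab
    rw [QuotientGroup.eq] at hab
    obtain ⟨h, hh, e⟩ := hab
    rw [inv_mul_eq_iff_eq_mul, s_mul (d.rcop a ha) (d.cop h hh)] at e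
    exact d.rdis a ha b hb h hh
      (s_inj (d.rcop b hb) (Nat.Coprime.mul_left (d.rcop a ha) (d.cop h hh)) e).symm
  have : Fintype (Gal(K/ℚ) ⧸ Hs K d) := Fintype.ofFinite _
  have hu : (reps.map (fun k => (s K k : Gal(K/ℚ) ⧸ Hs K d))).toFinset = Finset.univ := by
    rw [← Finset.card_eq_iff_eq_univ, List.toFinset_card_of_nodup hnd, List.length_map,
      ← Nat.card_eq_fintype_card, card_quot]
  rw [finprod_eq_prod_of_fintype, ← hu, List.prod_toFinset f hnd, List.map_map]
  rfl

/-- partial norm -/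
noncomputable def pn (reps : List ℕ) (x : 𝓞 K) : 𝓞 K := (reps.map fun k => s K k • x).prod

/-- the orbit map on cosets -/
noncomputable def qf (d : HD hl reps) (x : 𝓞 K) (hx : ∀ g ∈ Hs K d, g • x = x) (q : Gal(K/ℚ) ⧸ Hs K d) : 𝓞 K :=
  Quotient.liftOn' q (fun g => g • x) (by
    intro a b hab
    rw [QuotientGroup.leftRel_apply] at hab
    have := hx _ hab
    rw [mul_smul, inv_smul_eq_iff] at this
    exact this.symm)

theorem pn_eq (d : HD hl reps) (x : 𝓞 K) (hx : ∀ g ∈ Hs K d, g • x = x) :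
    pn reps x = ∏ᶠ q, qf d x hx q := (prod_reps d (qf d x hx))

theorem pn_int (d : HD hl reps) (x : 𝓞 K) (hx : ∀ g ∈ Hs K d, g • x = x) :
    ∃ n : ℤ, pn reps x = n := by
  apply exists_int_of_fixed
  intro g
  rw [pn_eq d x hx]
  have : Fintype (Gal(K/ℚ) ⧸ Hs K d) := Fintype.ofFinite _
  rw [finprod_eq_prod_of_fintype]
  rw [Finset.smul_prod']
  refine Fintype.prod_bijective (fun q => g • q) (MulAction.bijective g) _ _ ?_
  intro q
  induction q using QuotientGroup.induction_on with
  | H a => exact (mul_smul g a x).symm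

theorem pn_pow (d : HD hl reps) (x : 𝓞 K) (hx : ∀ g ∈ Hs K d, g • x = x) :
    ((Algebra.norm ℤ x : ℤ) : 𝓞 K) = pn reps x ^ hl.length := by
  classical
  have : Fintype (Gal(K/ℚ) ⧸ Hs K d) := Fintype.ofFinite _
  rw [norm_eq_prod, pn_eq d x hx, finprod_eq_prod_of_fintype, ← Finset.prod_pow,
    ← (Subgroup.groupEquivQuotientProdSubgroup (s := Hs K d)).symm.prod_comp, Fintype.prod_prod_type]
  refine Finset.prod_congr rfl fun q _ => ?_
  rw [← card_Hs (K := K) d, Nat.card_eq_fintype_card, ← Finset.card_univ]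
  refine Finset.prod_eq_pow_card fun h _ => ?_
  have : qf d x hx ((Subgroup.groupEquivQuotientProdSubgroup (s := Hs K d)).symm (q, h) :
      Gal(K/ℚ)) = qf d x hx q := by
    congr 1
    have := (Subgroup.groupEquivQuotientProdSubgroup (s := Hs K d)).apply_symm_apply (q, h)
    exact congrArg Prod.fst this
  rw [← this]; rfl

end elts
end C180
end

section
open NumberField Polynomial
open scoped Pointwise

namespace C180

section fields
variable {K : Type*} [Field K] [NumberField K] [hK : IsCyclotomicExtension {180} ℚ K]
variable {hl reps : List ℕ}

variable (K) in
/-- the fixed field -/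
noncomputable abbrev FF (d : HD hl reps) : IntermediateField ℚ K :=
  IntermediateField.fixedField (Hs K d)

theorem finrank_FF (d : HD hl reps) : Module.finrank (FF K d) K = hl.length := by
  rw [IntermediateField.finrank_fixedField_eq_card, card_Hs]

theorem degree_FF (d : HD hl reps) : Module.finrank ℚ (FF K d) = reps.length := by
  have h := Module.finrank_mul_finrank ℚ (FF K d) K
  have : IsGalois ℚ K := IsCyclotomicExtension.isGalois {180} ℚ K
  rw [finrank_FF, ← IsGalois.card_aut_eq_finrank ℚ K, Nat.card_eq_fintype_card, card_gal,
    ← d.len] at h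
  have : 0 < hl.length := List.length_pos_of_mem d.one
  exact Nat.eq_of_mul_eq_mul_right this h

theorem exists_of_fixed (d : HD hl reps) (x : 𝓞 K) (h : ∀ g ∈ Hs K d, g • x = x) :
    ∃ y : 𝓞 (FF K d), algebraMap (𝓞 (FF K d)) (𝓞 K) y = x := by
  have hm : (x : K) ∈ FF K d := by
    rw [IntermediateField.mem_fixedField_iff]
    intro g hg
    rw [← coe_gsmul, h g hg]
  have hi : IsIntegral ℤ (⟨(x : K), hm⟩ : FF K d) := by
    rw [← isIntegral_algebraMap_iff (algebraMap (FF K d) K).injective]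
    exact x.isIntegral_coe
  exact ⟨⟨_, hi⟩, RingOfIntegers.coe_injective rfl⟩

theorem fixed_of_FF (d : HD hl reps) (y : 𝓞 (FF K d)) (g : Gal(K/ℚ)) (hg : g ∈ Hs K d) :
    g • algebraMap (𝓞 (FF K d)) (𝓞 K) y = algebraMap (𝓞 (FF K d)) (𝓞 K) y := by
  apply RingOfIntegers.coe_injective
  have : ((algebraMap (𝓞 (FF K d)) (𝓞 K) y : 𝓞 K) : K) ∈ FF K d :=
    (y : FF K d).2
  rw [IntermediateField.mem_fixedField_iff] at this
  exact this g hg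

instance (d : HD hl reps) : SMulCommClass (Hs K d) (𝓞 (FF K d)) (𝓞 K) where
  smul_comm g a x := by
    rw [Algebra.smul_def, Algebra.smul_def, smul_mul']
    congr 1
    exact fixed_of_FF d a g g.2

instance (d : HD hl reps) : Algebra.IsInvariant (𝓞 (FF K d)) (𝓞 K) (Hs K d) where
  isInvariant x h := exists_of_fixed d x (fun g hg => h ⟨g, hg⟩)

theorem finrank_OFF (d : HD hl reps) : Module.finrank (𝓞 (FF K d)) (𝓞 K) = hl.length := by
  rw [← finrank_FF (K := K) d]
  exact (Algebra.IsAlgebraic.finrank_of_isFractionRing (𝓞 (FF K d)) (FF K d) (𝓞 K) K).symm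

theorem absNorm_map (d : HD hl reps) (I : Ideal (𝓞 (FF K d))) :
    Ideal.absNorm (I.map (algebraMap (𝓞 (FF K d)) (𝓞 K))) = Ideal.absNorm I ^ hl.length := by
  rw [← Ideal.absNorm_relNorm (𝓞 (FF K d)) (𝓞 K), Ideal.relNorm_algebraMap, map_pow, finrank_OFF]

/-- the residue lemma. -/
theorem residue (d : HD hl reps) (P : Ideal (𝓞 (FF K d))) [hP : P.IsPrime] (h0 : P ≠ ⊥)
    (m t : ℕ) (hmt : m * t = 180) (hm : (m : 𝓞 (FF K d)) ∉ P) :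
    ∃ h ∈ hl, h % m = Ideal.absNorm P % m := by
  obtain ⟨Q, hQ, hQP⟩ := Ideal.exists_ideal_over_prime_of_isIntegral_of_isDomain
    (S := 𝓞 K) P (by
      rw [(RingHom.injective_iff_ker_eq_bot _).mp
        (FaithfulSMul.algebraMap_injective (𝓞 (FF K d)) (𝓞 K))]
      exact bot_le)
  have hQ0 : Q ≠ ⊥ := by
    rintro rfl
    apply h0
    rw [← hQP]
    exact Ideal.comap_bot_of_injective _ (FaithfulSMul.algebraMap_injective (𝓞 (FF K d)) (𝓞 K))
  have : Finite (𝓞 K ⧸ Q) := Ring.HasFiniteQuotients.finiteQuotient hQ0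
  obtain ⟨σ, hσ⟩ := IsArithFrobAt.exists_of_isInvariant (𝓞 (FF K d)) (Hs K d) Q
  obtain ⟨h, hh, e⟩ := σ.2
  refine ⟨h, hh, ?_⟩
  have hz : (z K ^ t) ^ m = 1 := by rw [← pow_mul, mul_comm t, hmt, z_pow]
  have hmQ : (m : 𝓞 K) ∉ Q := by
    intro hc
    apply hm
    rw [← hQP, Ideal.mem_comap, map_natCast]
    exact hc
  have key := AlgHom.IsArithFrobAt.apply_of_pow_eq_one hσ hz hmQ
  have hu : Ideal.under (𝓞 (FF K d)) Q = P := hQP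
  rw [hu] at key
  have key2 : σ • (z K ^ t) = (z K ^ t) ^ Nat.card (𝓞 (FF K d) ⧸ P) := key
  have h3 : σ • (z K ^ t) = z K ^ (t * h) := by
    have : σ • (z K ^ t) = (σ : Gal(K/ℚ)) • (z K ^ t) := rfl
    rw [this, e, smul_pow', s_z (d.cop h hh), ← pow_mul, mul_comm]
  rw [h3, ← pow_mul] at key2
  have h4 := z_pow_inj key2
  have hn : Nat.card (𝓞 (FF K d) ⧸ P) = Ideal.absNorm P := rfl
  rw [hn, ← hmt, mul_comm m, Nat.mul_mod_mul_left, Nat.mul_mod_mul_left] at h4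
  exact Nat.eq_of_mul_eq_mul_left (Nat.pos_of_ne_zero (by rintro rfl; simp at hmt)) h4

end fields
end C180
end

section
open NumberField Polynomial
open scoped Pointwise

namespace C180

/-! ### kernel computations -/

/-- force evaluation of a number -/
def frc {α : Type} (n : ℕ) (f : ℕ → α) : α := Nat.rec (f 0) (fun m _ => f (Nat.succ m)) n

theorem frc_eq {α : Type} (n : ℕ) (f : ℕ → α) : frc n f = f n := by cases n <;> rfl

/-- force evaluation of a list -/
def frcL {α : Type} : List ℕ → (List ℕ → α) → α
  | [], k => k []
  | a :: l, k => frc a fun a' => frcL l fun l' => k (a' :: l')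

theorem frcL_eq {α : Type} (l : List ℕ) (f : List ℕ → α) : frcL l f = f l := by
  induction l generalizing f with
  | nil => rfl
  | cons a l ih => rw [frcL, frc_eq, ih]

/-- force evaluation of a list of lists -/
def frcLL {α : Type} : List (List ℕ) → (List (List ℕ) → α) → α
  | [], k => k []
  | a :: l, k => frcL a fun a' => frcLL l fun l' => k (a' :: l')

theorem frcLL_eq {α : Type} (l : List (List ℕ)) (f : List (List ℕ) → α) : frcLL l f = f l := by
  induction l generalizing f with
  | nil => rfl
  | cons a l ih => rw [frcLL, frcL_eq, ih]

/-- dot product -/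
def dot : List ℕ → List ℕ → ℕ
  | [], _ => 0
  | a :: as, l => List.rec 0 (fun b bs _ => Nat.add (Nat.mul a b) (dot as bs)) l

/-- digits -/
def digs (b : ℕ) : ℕ → ℕ → List ℕ
  | 0, _ => []
  | n + 1, c => (c % b) :: digs b n (c / b)

/-- digits, with continuation -/
def digsK {α : Type} (b : ℕ) (n : ℕ) : ℕ → (List ℕ → α) → α :=
  Nat.rec (fun _ k => k []) (fun _ ih c k => frc (Nat.mod c b) fun d =>
    frc (Nat.div c b) fun c' => ih c' fun l => k (d :: l)) n

theorem digsK_eq {α : Type} (b n c : ℕ) (k : List ℕ → α) : digsK b n c k = k (digs b n c) := by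
  induction n generalizing c k with
  | zero => rfl
  | succ n ih =>
    change frc (Nat.mod c b) (fun d => frc (Nat.div c b) fun c' => digsK b n c' fun l => k (d :: l)) = _
    rw [frc_eq, frc_eq, ih]; rfl

/-- the modulus `Φ₁₈₀(4)` -/
def NN : ℕ := 4^48+4^42-4^30-4^24-4^18+4^6+1

/-- The residue of the norm -/
def val (N : ℕ) (ds : List ℕ) (rows : List (List ℕ)) : ℕ :=
  List.rec 1 (fun row _ ih => Nat.mod (Nat.mul ih (dot row ds)) N) rows

/-- absolute value -/
def absv (N v : ℕ) : ℕ := Nat.min v (Nat.sub N v)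

/-- check for one prime ideal norm `q`. -/
def chkq (CC n q : ℕ) : Bool :=
  frc (Nat.div n q) fun m => Nat.blt (Nat.div m (Nat.gcd m CC)) q

structure Par where
  hl : List ℕ
  reps : List ℕ
  basis : List (List ℕ)
  lo : ℕ
  base : ℕ
  B : ℕ
  r : ℕ
  C : ℕ

/-- rows of the table -/
def mkRow (P : Par) (k : ℕ) : List ℕ :=
  let l := P.basis.map fun o => (o.map fun e => 4 ^ (e * k % 180)).sum % NN
  (NN - (P.lo * l.sum) % NN) :: l

/-- rows of the table -/
def mkRows (P : Par) : List (List ℕ) := P.reps.map (mkRow P)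

/-- norm of code -/
def nrm (P : Par) (code : ℕ) : ℕ :=
  absv NN (val NN (1 :: digs P.base P.basis.length code) (mkRows P))

def chkLarge (N CC b len : ℕ) (rows : List (List ℕ)) (p code : ℕ) : Bool :=
  digsK b len code fun ds => frc (val N (1 :: ds) rows) fun v => frc (absv N v) fun n =>
    and (Nat.blt 0 n) (and (Nat.beq (Nat.mod n p) 0) (chkq CC n p))

/-- loop through residues -/
def stepH (N CC b len bl B r M : ℕ) (rows : List (List ℕ)) (hs : List ℕ) :
    ℕ → ℕ → (ℕ → Bool) → Bool :=
  List.rec (fun _ c k => k c) (fun h _ ih => fun b0 c k =>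
    frc (Nat.add b0 h) fun p =>
      cond (or (Nat.ble p r) (or (Nat.blt B p) (Nat.blt 1 (Nat.gcd p M)))) (ih b0 c k)
        (and (chkLarge N CC b len rows p (Nat.mod c bl)) (frc (Nat.div c bl) fun c' => ih b0 c' k)))
    hs

/-- loop -/
def lp (N CC b len bl B r M : ℕ) (rows : List (List ℕ)) (hs : List ℕ) (fuel : ℕ) :
    ℕ → ℕ → Bool :=
  Nat.rec (fun _ _ => true) (fun _ ih => fun t c =>
    stepH N CC b len bl B r M rows hs (Nat.mul 180 t) c fun c' => frc (Nat.succ t) fun t' => ih t' c') fuel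

/-- chunks -/
def lpc (N CC b len bl B r M T : ℕ) (rows : List (List ℕ)) (hs : List ℕ) (cs : List ℕ) :
    ℕ → Bool :=
  List.rec (fun t => Nat.blt B (Nat.mul 180 t)) (fun c _ ih => fun t =>
    and (lp N CC b len bl B r M rows hs T t c) (frc (Nat.add t T) fun t' => ih t')) cs

def fact : ℕ → ℕ := fun n => Nat.rec 1 (fun m ih => Nat.mul (Nat.succ m) ih) n

def checkLarge (P : Par) (T : ℕ) (cs : List ℕ) : Bool :=
  frc NN fun N => frc (P.C ^ 40) fun CC => frc (P.base ^ P.basis.length) fun bl =>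
  frc P.basis.length fun len =>
  frc (fact P.r) fun M => frcLL (mkRows P) fun rows =>
    lpc N CC P.base len bl P.B P.r M T rows P.hl cs 0

/-- validity of a certificate -/
def CertOK (P : Par) (p q n : ℕ) : Prop :=
  0 < n ∧ p ∣ n ∧ (q ∣ n → (n / q) / Nat.gcd (n / q) (P.C ^ 40) < q)

theorem chkq_spec {CC n q : ℕ} (h : chkq CC n q = true) : (n / q) / Nat.gcd (n / q) CC < q := by
  rw [chkq, frc_eq] at h
  exact Nat.blt_eq.mp h

theorem chkLarge_spec (P : Par) (p code : ℕ)
    (h : chkLarge NN (P.C ^ 40) P.base P.basis.length (mkRows P) p code = true) :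
    CertOK P p p (nrm P code) := by
  rw [chkLarge, digsK_eq, frc_eq, frc_eq] at h
  simp only [Bool.and_eq_true] at h
  obtain ⟨h1, h2, h3⟩ := h
  exact ⟨Nat.blt_eq.mp h1, Nat.dvd_of_mod_eq_zero (Nat.eq_of_beq_eq_true h2), fun _ => chkq_spec h3⟩

/-- covered -/
def CovL (P : Par) (M p : ℕ) : Prop :=
  P.r < p → p ≤ P.B → Nat.gcd p M ≤ 1 → ∃ code, CertOK P p p (nrm P code)

theorem stepH_spec (P : Par) (bl M : ℕ) (hs : List ℕ) (b0 c : ℕ) (k : ℕ → Bool)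
    (h : stepH NN (P.C ^ 40) P.base P.basis.length bl P.B P.r M (mkRows P) hs b0 c k = true) :
    (∀ h ∈ hs, CovL P M (b0 + h)) ∧ ∃ c', k c' = true := by
  induction hs generalizing c with
  | nil => exact ⟨by simp, c, h⟩
  | cons a hs ih =>
    change frc (Nat.add b0 a) (fun p =>
      cond (or (Nat.ble p P.r) (or (Nat.blt P.B p) (Nat.blt 1 (Nat.gcd p M))))
        (stepH NN (P.C ^ 40) P.base P.basis.length bl P.B P.r M (mkRows P) hs b0 c k)
        (and (chkLarge NN (P.C ^ 40) P.base P.basis.length (mkRows P) p (Nat.mod c bl))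
          (frc (Nat.div c bl) fun c' =>
            stepH NN (P.C ^ 40) P.base P.basis.length bl P.B P.r M (mkRows P) hs b0 c' k))) = true at h
    rw [frc_eq] at h
    cases hc : or (Nat.ble (Nat.add b0 a) P.r)
        (or (Nat.blt P.B (Nat.add b0 a)) (Nat.blt 1 (Nat.gcd (Nat.add b0 a) M))) with
    | true =>
      rw [hc, cond_true] at h
      obtain ⟨h1, h2⟩ := ih _ h
      refine ⟨?_, h2⟩
      intro x hx
      rcases List.mem_cons.mp hx with rfl | hx
      · intro i1 i2 i3
        simp only [Bool.or_eq_true, Nat.blt_eq, Nat.ble_eq, Nat.add_eq] at hc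
        omega
      · exact h1 x hx
    | false =>
      rw [hc, cond_false, Bool.and_eq_true, frc_eq] at h
      obtain ⟨h1, h2⟩ := ih _ h.2
      refine ⟨?_, h2⟩
      intro x hx
      rcases List.mem_cons.mp hx with rfl | hx
      · intro i1 i2 i3
        exact ⟨_, chkLarge_spec P _ _ h.1⟩
      · exact h1 x hx

theorem lp_spec (P : Par) (bl M : ℕ) (hs : List ℕ) (fuel t c : ℕ)
    (h : lp NN (P.C ^ 40) P.base P.basis.length bl P.B P.r M (mkRows P) hs fuel t c = true) :
    ∀ t', t ≤ t' → t' < t + fuel → ∀ h ∈ hs, CovL P M (180 * t' + h) := by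
  induction fuel generalizing t c with
  | zero => intro t' h1 h2; omega
  | succ n ih =>
    obtain ⟨h1, c', h2⟩ := stepH_spec P bl M hs _ _ _ h
    rw [frc_eq] at h2
    intro t' g1 g2
    rcases Nat.eq_or_lt_of_le g1 with rfl | g1
    · exact h1
    · exact ih (Nat.succ t) c' h2 t' g1 (by omega)

theorem lpc_spec (P : Par) (bl M T : ℕ) (hs : List ℕ) (cs : List ℕ) (t : ℕ)
    (h : lpc NN (P.C ^ 40) P.base P.basis.length bl P.B P.r M T (mkRows P) hs cs t = true) :
    ∀ t', t ≤ t' → ∀ h ∈ hs, CovL P M (180 * t' + h) := by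
  induction cs generalizing t with
  | nil =>
    intro t' h1 x _ h2 h3
    have := Nat.blt_eq.mp h
    have : P.B < 180 * t := this
    omega
  | cons c cs ih =>
    change and (lp NN (P.C ^ 40) P.base P.basis.length bl P.B P.r M (mkRows P) hs T t c)
      (frc (Nat.add t T) fun t' => lpc NN (P.C ^ 40) P.base P.basis.length bl P.B P.r M T (mkRows P) hs cs t') = true at h
    rw [Bool.and_eq_true, frc_eq] at h
    intro t' ht
    by_cases g : t' < t + T
    · exact lp_spec P _ _ _ _ _ _ h.1 t' ht g
    · exact ih _ h.2 t' (by simpa using g)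

theorem fact_eq (n : ℕ) : fact n = n.factorial := by
  induction n with
  | zero => rfl
  | succ n ih => rw [Nat.factorial_succ, ← ih]; rfl

theorem checkLarge_spec (P : Par) (T : ℕ) (cs : List ℕ) (h : checkLarge P T cs = true) (p : ℕ)
    (hp : p.Prime) (h1 : P.r < p) (h2 : p ≤ P.B) (h3 : p % 180 ∈ P.hl) :
    ∃ code, CertOK P p p (nrm P code) := by
  simp only [checkLarge, frc_eq, frcLL_eq] at h
  have := lpc_spec P _ _ _ _ _ _ h (p / 180) (Nat.zero_le _) _ h3
  rw [Nat.div_add_mod] at this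
  refine this h1 h2 (le_of_eq ?_)
  rw [fact_eq]
  exact (Nat.Prime.coprime_iff_not_dvd hp).mpr (fun hd => by
    have := (Nat.Prime.dvd_factorial hp).mp hd
    omega)

/-- prime to p part of 180 -/
def mp (p : ℕ) : ℕ := if p = 2 then 45 else if p = 3 then 20 else if p = 5 then 36 else 180

def fs (P : Par) (p : ℕ) : List ℕ :=
  ((List.range 20).map fun f => p ^ (f + 1)).filter fun q =>
    Nat.ble q P.B && P.hl.any fun h => Nat.beq (h % mp p) (q % mp p)

def comp (p : ℕ) : Bool :=
  [2, 3, 5, 7, 11, 13, 17, 19, 23].any fun d => Nat.blt d p && Nat.beq (p % d) 0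

def checkSmall (P : Par) (small : List (ℕ × ℕ)) : Bool :=
  (List.range (P.r + 1)).all fun p => Nat.blt p 2 || comp p || Nat.beq (P.C % p) 0 ||
    (fs P p).isEmpty || match small.lookup p with
      | none => false
      | some code => frc (nrm P code) fun n => Nat.blt 0 n && Nat.beq (n % p) 0 &&
          (fs P p).all fun q => Nat.blt 0 (n % q) || chkq (P.C ^ 40) n q

theorem checkSmall_spec (P : Par) (small : List (ℕ × ℕ)) (h : checkSmall P small = true) (p f : ℕ)
    (hp : p.Prime) (h1 : p ≤ P.r) (hC : ¬ p ∣ P.C) (hf : 1 ≤ f) (h2 : p ^ f ≤ P.B) (hB : P.B < 2 ^ 20)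
    (h3 : ∃ h ∈ P.hl, h % mp p = p ^ f % mp p) :
    ∃ code, CertOK P p (p ^ f) (nrm P code) := by
  have h4 := List.all_eq_true.mp h p (List.mem_range.mpr (by omega))
  have hf20 : f < 20 := by
    by_contra hc
    have : 2 ^ 20 ≤ p ^ f := (Nat.pow_le_pow_right (by norm_num) (not_lt.mp hc)).trans
      (Nat.pow_le_pow_left hp.two_le f)
    omega
  have hmem : p ^ f ∈ fs P p := by
    rw [fs, List.mem_filter, List.mem_map]
    refine ⟨⟨f - 1, List.mem_range.mpr (by omega), by rw [Nat.sub_add_cancel hf]⟩, ?_⟩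
    rw [Bool.and_eq_true, List.any_eq_true]
    refine ⟨Nat.ble_eq.mpr h2, ?_⟩
    obtain ⟨x, hx, e⟩ := h3
    exact ⟨x, hx, by simpa using e⟩
  simp only [Bool.or_eq_true] at h4
  rcases h4 with (((h4 | h4) | h4) | h4) | h4
  · have := Nat.blt_eq.mp h4
    have := hp.two_le
    omega
  · rw [comp, List.any_eq_true] at h4
    obtain ⟨e, he, h4⟩ := h4
    rw [Bool.and_eq_true] at h4
    have i1 := Nat.blt_eq.mp h4.1
    have i2 := Nat.dvd_of_mod_eq_zero (Nat.eq_of_beq_eq_true h4.2)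
    rcases (Nat.dvd_prime hp).mp i2 with rfl | rfl
    · simp at he
    · omega
  · exact absurd (Nat.dvd_of_mod_eq_zero (Nat.eq_of_beq_eq_true h4)) hC
  · rw [List.isEmpty_iff] at h4
    rw [h4] at hmem
    simp at hmem
  · cases hl : small.lookup p with
    | none => rw [hl] at h4; simp at h4
    | some code =>
      rw [hl] at h4
      simp only [frc_eq, Bool.and_eq_true] at h4
      obtain ⟨⟨i1, i2⟩, i3⟩ := h4
      refine ⟨code, Nat.blt_eq.mp i1, Nat.dvd_of_mod_eq_zero (Nat.eq_of_beq_eq_true i2), fun hd => ?_⟩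
      have := List.all_eq_true.mp i3 _ hmem
      rw [Bool.or_eq_true] at this
      rcases this with this | this
      · have := Nat.blt_eq.mp this
        rw [Nat.mod_eq_zero_of_dvd hd] at this
        omega
      · exact chkq_spec this

/-- All checks for the parameters. -/
structure Good (P : Par) : Prop where
  d : HD P.hl P.reps
  r1 : 5 ≤ P.r
  r2 : P.B < (P.r + 1) ^ 2
  b20 : P.B < 2 ^ 20
  cov1 : ∃ T cs, checkLarge P T cs = true
  cov2 : ∃ small, checkSmall P small = true
  inv : ∀ o ∈ P.basis, ∀ h ∈ P.hl, (o.map fun e => e * h % 180).Perm o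
  bpos : 0 < P.base
  wt : 2 * ((P.basis.map fun o => (P.lo + P.base) * o.length).sum) ^ P.reps.length < NN

theorem Good.cov {P : Par} (g : Good P) (p f : ℕ) (hp : p.Prime) (hC : ¬ p ∣ P.C) (hf : 1 ≤ f)
    (h2 : p ^ f ≤ P.B) (h3 : ∃ h ∈ P.hl, h % mp p = p ^ f % mp p) :
    ∃ code, CertOK P p (p ^ f) (nrm P code) := by
  by_cases hr : p ≤ P.r
  · obtain ⟨sm, hsm⟩ := g.cov2
    exact checkSmall_spec P sm hsm p f hp hr hC hf h2 g.b20 h3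
  · push Not at hr
    have hf1 : f = 1 := by
      by_contra hc
      have h5 : 2 ≤ f := by omega
      have := Nat.pow_le_pow_right hp.pos h5
      have := Nat.pow_le_pow_left (Nat.succ_le_of_lt hr) 2
      have := g.r2
      simp only [Nat.succ_eq_add_one] at *
      omega
    subst hf1
    rw [pow_one] at *
    obtain ⟨T, cs, hcs⟩ := g.cov1
    have := g.r1
    have hm : mp p = 180 := by
      unfold mp
      rw [if_neg (by omega), if_neg (by omega), if_neg (by omega)]
    obtain ⟨x, hx, e⟩ := h3
    rw [hm, Nat.mod_eq_of_lt (g.d.lt x hx)] at e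
    exact checkLarge_spec P T cs hcs p hp hr h2 (e ▸ hx)
end C180
end

section
namespace C180

/-! ### data -/

def P36 : Par where
  hl := [1, 37, 73, 109]
  reps := [1, 7, 11, 13, 17, 19, 23, 29, 31, 41, 61, 71]
  basis := [[0], [1, 37, 73, 109], [2, 38, 74, 146], [3, 39, 111, 147], [4, 76, 112, 148], [5], [6, 42, 78, 114], [7, 43, 79, 151], [8, 44, 116, 152], [9, 81, 117, 153], [10], [11, 47, 83, 119]]
  lo := 1
  base := 3
  B := 288
  r := 16
  C := 30

set_option maxRecDepth 100000 in
theorem P36_large : checkLarge P36 50 [2101337038634965233] = true := by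
  decide +kernel

set_option maxRecDepth 100000 in
theorem P36_small : checkSmall P36 [] = true := by
  decide +kernel

theorem P36_good : Good P36 where
  d := ⟨by decide +kernel, by decide +kernel, by decide +kernel, by decide +kernel, by decide +kernel,
    by decide +kernel, by decide +kernel, by decide +kernel, by decide +kernel, by decide +kernel⟩
  r1 := by decide +kernel
  r2 := by decide +kernel
  b20 := by decide +kernel
  cov1 := ⟨_, _, P36_large⟩
  cov2 := ⟨_, P36_small⟩
  inv := by decide +kernel
  bpos := by decide +kernel
  wt := by decide +kernel

def PF5 : Par where
  hl := [1, 71, 91, 161]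
  reps := [1, 7, 11, 13, 17, 19, 29, 31, 43, 49, 53, 67]
  basis := [[0], [6, 66], [12, 132], [18], [2, 142], [4, 104], [8, 28], [10, 170], [16, 56], [20, 160], [22, 122], [26, 46]]
  lo := 1
  base := 3
  B := 6296
  r := 79
  C := 30

set_option maxRecDepth 100000 in
theorem PF5_large : checkLarge PF5 50 [6638514550456374669705598068538552115321961065405319682138216068247234288236702488608585023397483293623815072073095901967043209739178670945464418596278627691840657973375937887137834228281963741340666089265321540460620933311200037588553180197614131406132400058214220401115079264396403920364791831254804764109783397223553414787241679801260324543651332759646918] = true := by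
  decide +kernel

set_option maxRecDepth 100000 in
theorem PF5_small : checkSmall PF5 [(11, 1889), (19, 442), (71, 486)] = true := by
  decide +kernel

theorem PF5_good : Good PF5 where
  d := ⟨by decide +kernel, by decide +kernel, by decide +kernel, by decide +kernel, by decide +kernel,
    by decide +kernel, by decide +kernel, by decide +kernel, by decide +kernel, by decide +kernel⟩
  r1 := by decide +kernel
  r2 := by decide +kernel
  b20 := by decide +kernel
  cov1 := ⟨_, _, PF5_large⟩
  cov2 := ⟨_, PF5_small⟩
  inv := by decide +kernel
  bpos := by decide +kernel
  wt := by decide +kernel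

def PF15 : Par where
  hl := [1, 89, 91, 179]
  reps := [1, 7, 11, 13, 17, 19, 23, 29, 31, 37, 41, 43]
  basis := [[0], [18, 162], [2, 178], [4, 176], [8, 172], [10, 170], [14, 166], [16, 164], [20, 160], [22, 158], [6, 174], [12, 168]]
  lo := 1
  base := 3
  B := 1477
  r := 38
  C := 1

set_option maxRecDepth 100000 in
theorem PF15_large : checkLarge PF15 50 [3275626826059701637463574800825727383752399513815468010936628987866053751238607889830636] = true := by
  decide +kernel

set_option maxRecDepth 100000 in
theorem PF15_small : checkSmall PF15 [(3, 265714), (5, 206672), (19, 30)] = true := by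
  decide +kernel

theorem PF15_good : Good PF15 where
  d := ⟨by decide +kernel, by decide +kernel, by decide +kernel, by decide +kernel, by decide +kernel,
    by decide +kernel, by decide +kernel, by decide +kernel, by decide +kernel, by decide +kernel⟩
  r1 := by decide +kernel
  r2 := by decide +kernel
  b20 := by decide +kernel
  cov1 := ⟨_, _, PF15_large⟩
  cov2 := ⟨_, PF15_small⟩
  inv := by decide +kernel
  bpos := by decide +kernel
  wt := by decide +kernel

def PF20 : Par where
  hl := [1, 19, 161, 179]
  reps := [1, 7, 11, 13, 17, 23, 31, 41, 43, 53, 61, 71]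
  basis := [[0], [6, 66, 114, 174], [10, 170], [20, 160], [3, 57, 123, 177], [9, 171], [2, 38, 142, 178], [4, 76, 104, 176], [1, 19, 161, 179], [7, 47, 133, 173], [11, 29, 151, 169], [13, 67, 113, 167]]
  lo := 1
  base := 4
  B := 94579
  r := 307
  C := 30

set_option maxRecDepth 100000 in
theorem PF20_large : checkLarge PF20 50 [88800740412938683042019083203560182180093673363827517343614712460776646953886392064476138547465466808549629886634057850781821606349224717447983269253022748164227039492479011916475847152746086269078454948330902546959184740857250045408359885663215470532244891758592960199676488610871166452243674456918308459179947764368399873743843643203343860571540381560509906484124596237942965680585393221905519068852383694974721485630693083729397436527318503308944260020616661187608188101170251207832863409891395592838050249561706278539516596510280817115663289522031136757642593163835405300337819747651054548509786134, 115674860655083544722889321332642495105724181176274622020598996676408282802009884987199384288254328938824272080783650437986276941771184445609882448805430666190477090048600945363501737500954602281116256926017693681298338640689835620469544391968860619757771162997902136566297234753115420204713126543612291781143718561766935542021107812043368182696017288082395720534424124164568526089767907372647798279636571721191724112404786524873048532625495505589057273714958377774933424201208705698328222940328705895316662872967869505553974787126296195675733659987303342149228903061196523886870624, 48910249172868765526959886114853200184915708434836019432894006715972950735637443760876226001221441600356687110952679292853609087588159818754472327017164773054462199055344146272337906065600324524007825961046737687852098461361122895842006312061493633479094426471915586102340641009892446041133603570731322757728405884184189881395411100503723742852262155454852183368634734147271860183997161701790296054562163385950514216103947463431629186614789380446163287010101082502421785186196436666782842412145091516150907490572082162790714835784106464049671448970738640067580134674946796155830737,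 29434736339515558116061537972730150393466235816416504353123087007935755856013635898803294477445312013706610273700826261390871745220617305965272208754570939991586074151023968570115614536341250601104722609030886875226991214255291093501358695504218835025764746099335323144882917216145337779411109366212683519431059057939797138668504365177334441203078570190828295846155677756529814827338528095494246750357070457428185256451899808327687590410442059778263672684058282819671, 193237602287007061310752634548348565682715205187421229628250809928607831820708659736123113670078193275328357932436517201157023724742224100036381084691699686368566472153773677240253054905919428145823294932486809389537294128051963826192120451916156714483612280420325371581532161557143107520255277395342921400270045421773754140324096240277603701842675992920404749336661986113137700906398054976830985905101767083466765351596940947131140097957056295755378378118634828996875835520652415084990372347367236683859760229, 6503826641683708712477388572609700320385442760440620682385260479873853369654543521921760627405612893514148160737626587281088191975763786271342137095934175239585728032830083905674431959390743592675288446281610277828036240568207387463046082575967635823530932689580777001083309333231491531320580733401731613403876449089654573760116304802113258229578488055704367455572502765329030359406326238357995428468379279594415369060211236991336250561321929951602440070538992429195092776172853999675670303095748831809, 2803373275109985524304389681302137067782280104479309456813550150389625056712928206314035257626304532506906937320255688222555768116592642482777893997587668249115611633161023246199650815545843494061387461340119750934957484995980334364032728932808395104402420328577885533067674671839122375900099680724202544185422853846056089177781431332325486505395189980085141674345142615765129259676239139504423542135563275784880796015402120414352522925360634633914868220978718382783706793474869760444197824783940859688,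 232641739666970005679593816178997208912575100710443750551879930927689596006727214776098542735011555132886216974938765320418133929541487287009619683748511176620884579063617698095493442495647505679536028614312517918361787791386372575375576707353551911638730440458706433951594612508485541929259243426512004508598026005950022345468901932146444512268215214398959212993052920515293778455533530328356619978974007784256604090933728901797870499737530363089488411520997641731799270557, 234322105145353891073017655800261548354911254827321864888882724063774196094890598353333389385498489974061032175273032986478379466026769798060168043660605571167836130264097402928725279563635937162142586357723986248098928562452551720571125296940415732067839662603194560443032257952013880189910698044739048391331919813648875978665055486586966643611803685906232914557537935234718169134880707516407158131050883947028867809564856, 31387088972025597931281089763301130182279489919490497179557465139376746142430013990089212724482940477869438062445834973591523757720599911591541515940613548434939920530595362682024873672963904359289574672924463470031576053518431733540201292058007290095339333109278012971579646259739929127964722186621331117329200634215923142630944715705438407065295483302474877936550669411292770291925530252948041732199773830184835026519839268958387443569449648047516204247596423709939, 16993725837051190981629283458489281419824644918739953374160586517170217333632187556298602585139397726027616004137852789994832845916514017116496316955103020020757742015471740155971249129121257246322610461843328075657390584] = true := by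
  decide +kernel

set_option maxRecDepth 100000 in
theorem PF20_small : checkSmall PF20 [(17, 997473), (19, 1), (41, 258971), (71, 3883), (89, 2634), (109, 199440), (179, 70), (181, 16), (199, 145), (251, 2894), (269, 66396), (271, 200575)] = true := by
  decide +kernel

theorem PF20_good : Good PF20 where
  d := ⟨by decide +kernel, by decide +kernel, by decide +kernel, by decide +kernel, by decide +kernel,
    by decide +kernel, by decide +kernel, by decide +kernel, by decide +kernel, by decide +kernel⟩
  r1 := by decide +kernel
  r2 := by decide +kernel
  b20 := by decide +kernel
  cov1 := ⟨_, _, PF20_large⟩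
  cov2 := ⟨_, PF20_small⟩
  inv := by decide +kernel
  bpos := by decide +kernel
  wt := by decide +kernel

def PF60 : Par where
  hl := [1, 19, 71, 89]
  reps := [1, 7, 11, 13, 17, 31, 37, 43, 91, 101, 103, 121]
  basis := [[0], [6, 66, 114, 174], [10, 170], [20, 160], [2, 38, 142, 178], [4, 76, 104, 176], [1, 19, 71, 89], [7, 83, 133, 137], [11, 29, 61, 79], [13, 23, 67, 77], [3, 33, 57, 87], [21, 39, 51, 69]]
  lo := 1
  base := 4
  B := 402957
  r := 634
  C := 5430

set_option maxRecDepth 100000 in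
theorem PF60_large : checkLarge PF60 50 [2931766748848134725204809452129994620748422590771982959674879308812722845072598250731159960849864442325605043826328381335865246189907542753028381642499193951878642423132928758634195438140940472524461818475859036738493529663781834574647588307969437764586579745751891455125880765460672748825623276245090011254240336671031856240101353433849963984734471637785680542391062571617845732579068442745021849689849092503054744994587221428357962615431656315106065273385042078485176164302654167778176224319274174066916962506107728273460459695822420433692485291214175736785867677526540665322018875377246, 2087291153707302858427706102595361488777325968513590513690935263051387644870505062436864171839458021718783230298773707503667943307288611112031599821511427340495281164719169663799238325953318166357237705283440633256712618193716976236615962089102979782679229512810466743962141164085127464508153895536597675564333108412531370305140488145385560849869303796859859269831812184579713302333227723794148699639401771106569156790668975586507176216231007824922160471671968026113973413745216807544787159079403398864173737861933418836269196804937568577054612901926389019135486309518852555282899884049727, 4746178106897429867596082395456617621348059804013500016746225983944598843888252069958446140640514261401276367020456783875345979677638340941839274527642911923141668112343284360215135344151750491062706397936196843502003834312680855744943099937326487466021973564516640848231720113642417234565195595990634777260768217935201901108736202333494358977859395106511152891209393061902695964724260408835351473104442722794956227012382564320695873199473177374888768965702215054707504885593017711880017703028484372173132760518450587513245341813841546417415208562512789241987,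 759848551643549645955529550086854107579419334300947333778835493169561361591279727576714909732888207907476024415157903006143758905236012978533846313792972759668252072449732028969520247643692773992083024703927848776582321244979849709465621147497890711164637208690976613659029170306483559545519929448009280003077237697064764862658315566457590707360252512729039672580585147457747888552617127540189810078390163559533201311453338745428021679837710652933102851069664, 8941958851931777273666290396496652504688758594384106433567772299559324548086133778661196325139515819740470579647622661042772139164997984495796691512563136290914701271073877037450936890253030075657912561818788440101038478222299177194413673021990195325487857134257551548611087181188554830181419056116841872175818555895564099094554995817245186674553554286755113495231360382788217624420712367239731724837241119178154257025632662609582692085015472116057926030518101204429570418211797316095695424130360823261, 3787745281514604104452553313014177443761522613203001089867406919005773145000441479418872345482352696898197856112812603749665717675050668438417377579999651306680463443172339644368077354731255996297241185963888787238643090806496962419587573466062874986532712357600163624126472474238803266388059917487346619478206758946810780019674697986715650980912438430218500569126122891738211113870320689176991811981743316991760346911183334301257159572961958005505793978729449421555496959887802545, 203377394865680474011704027199530961159170653785928757581849574872176151117559594626222363735729304249833362046781463983431648136847160255775293537839633238376557635494213543389972892093902980123742206899014277575620894309753247892399500686680555211788569119297171572644682369865797294811062570198821670447125406504913904446793608615049379724665495667707238070229884031869680253218744701404396356455078379987195186286436785775897942085021138294818016712917454753923397521026130741125834260613319,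 357664244220738749511654737902642560948955039605111154614386344432207196186680601374649667202828470252024100121767582480504200855209830475138978132213608929149448946840385964500767015314468201270573021301657801073936102353732458842394430688108286698681763671317965774293446068583429766317141671012632419521120328146438067975866123917626982006166547510384316717090709740315722693910478485786907277357830710061887988109640566512127805988049725023588160181286261664354680666989122361583153833250588092677438309083, 88772632077067244236530077569120924377273503709767441332094241864130195719843365017892202084087345039681252634082912167607604276627228638180675383563167890052517870000814430913951400883645190355977620854845014528587517460482359609618384077451784914042796556257610577801650408893799146013204634136612835009498108277614715211363363168537925287686143925917073278042341806513505309233066395974636946178778432893098112961941455211010149318949, 1974704049872318087665318215134336314237883868103210651589939756757999198127838597104758039481497759251509703224218252949216446819324680468539040361833202711617371599665861300530901343196624950218175084109286849838530038057589000977132881085615559798330450770619184184934284643695703346786074155673902166732762675010889383549487472948096365034657683090197954571525256395801024511520722129731526306232108062170200355993714241310049, 144588786822749277698632430313532923704720803544782780533558572101756310949984804787365772495748459622245454489732319878269911521101126827847134100433614883865441890122036712940182933813519502960838935763772169099749129628723924559385886735434572557645672117760274464982158716543145367202699468405258600699619881762179971011422821438281996479909677879568978853540517756523983710564349476292153383711314619160002020751571687312708792619946850282673014381,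 207578627740395680369210865085286011389608109531161198039502073021438897003953181064640060797983809363068103269107617005864655482674623658010330038758500731163590764726879519017821189657437758164050684139538517033898784171886548952196948400382249529177281253415112515382469054743812106833635275809880199048456584591904726858832283564598759753805873687498635479458498644978681390123835282069934102925245579130222529894602366262216242206629450293462744617810877480799528622649008704524492369564113, 812491580966763369868650151755472871514768569840494857367167063062940105963531353182172323458553459239845452432790611512984578069002936595719093338700259392104760853822556752928582453372015199539548211182405708333118741650696942198378716864854459347352922840649151241085592599768024755518943217207590552485771561991562217256918808329711961288967231624025148067277200889386174143468268225222804213142396673760150910072991466234949450861068, 201122704778790452412962470407173475479656046111749296328267920024298936646778333939546178897365228969772982199788345324076526075319009367895031189091075091791323204106197771063436832532933542180186989649805412973366543204010555761568780344791163116861981799912697338712365172852176578193712807141824853499855493295392474038334495153850807409288673519695079733272382579309477794567363949527130667766143516555410797457709569287992264875909232855298875369, 18917596338317140153961331239681317033732461255906004483268101120575578647414499808522303797757297296092184875344847916587707556619142223027084097494912867966164319066158751170361552140514820955560839243672409370165024363235151221475731950450457031446092329588167317158910468958819607607401423854677959130742909868832291978124322998337925130814750302562190535204967209914254273661080835616754775574389611294316534711646020848949354048691118279303,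 1622919667394398047106584787015235083116791983367439595706224306323971494336302630822070005799630737404660455011590043837150401619630960899468047616883302354254849088963168309793641181630213642556420298327985191815245709164855237542704806549287575318807066614883838669518132090036560515408692291371927735092026189645968416280161236077762765291418287279148788872290289134910921205813311321596464698879212184073497426486332315665361, 691077355762531239658937993829021565477578667510589292338649597369430020424445973448001731423204124329610678325698103800632781687036308042135299944881482234205153117645726551654138626084090027334455332528175191012396106026253964836734073375636989946904630626500671042289654919013120796121703518500582532264570094520517603391612764958001462515261683002155729213495908888762221554294039268556059270617685117780533983542511139, 7135984643958994826002957346301995126663641570734646979903711725624119432545904571202568697481027151968624251613315939811237735611630858035189098192900572716308484970965988604333066796203243292408325198752436939591845181641535507584170964979395319611692955230485249468974053982086733815736580819451089169770899696471442480027565535706106622202595836451862159939147988343257732391330923427220248680346434017943652621146432839821317701563332068535877702142737675896128992957581837308437498211017427456082871808440666345, 1151621444323696635460656508701450006748027316455300578467956877225427869065443204656800284693878111093149100960212259177179049280985711024278989373728491043451954837437917419303686571179375399826349695905928934578538867833919076739485611941529264953255791639522890661712126086007106098982186918741198730539875066467678203861177736122018552677028161110236743890694376150110083976695645869, 2667539158278858281939616369115700675153044027255980225089801269087594431280452406348269206195671313241888536792049162852011763641437625529066074700140105876399475185706995989320911541906342412818389977312099597031722549433980932824509139564921952621853876180922292270564354209710114040412160767438144103413218232421161399768803866871003118121589461294229219299924595613742573043852425143432168811911339791088647232461142988132773720889790798675563652584046788539810350269836958360859524793670321374758600218786137584,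 13286316072448128726974780502724859497474923858313884929910666749018654668686801642564102689203439543502534407702092104258932647704233139764800853540259450776680151664425384941330738739781736766953919103041104243415288554031447546590104844254329417255659297121964526380907874109145033417988012127067364412430163157741442457990429955455966293606943770167432139373672163245184314987929587271320277518065999758002043810227794550339796749667593621686, 96493147943624674140708951922263277959356302626493052075598949174446982155620292686493650066035597561817928492430761070178396909556813191113021232910235632064838801168103732983557984425652748357971479861760284677944725977960465635492051551070037721270851732908439641370179738638124260505307768008677080669137249298035560257966736998190781320307240660559697962118833457928528644483991469559946241, 1552835216336521781294939890959933781532612653429931804797437527532023570952385921379522063837976781301039163794532767043449613340464365209259920191514280909559983652633424384452218897372605043699016992153493981231136528663178813568091584551005075771494061847845173083080134547499459688586556925598501201164625039955328448934436263966433012371037323712303572248213109852398415912734411927209983859667933089705, 277434097236979209027872024941981170802129538164731141416207024934905479608543327437065554484832085682147572770177875644541185518189263859624585159579488181075281093540821801877311637257166582744902423148896498259348769076129955454356414783260571458744121240599958801249092968001025798087787498538543174513989940009417463981372068279681404853286687245902951779242556331021047002373903849473018174535888866287888246476755439797276556654863363693338111326365210171122177607078009398743855749, 482199592356051992445807075675524778409265143664393066082042113227712548109393270068731338837327414645971451871367995417441202959889388603861111798785325225198670871640060452547491092921740790498065873526422340412402533915410739117299467123350871770931661644564890165181718948355757505792050516349217608024432183988491657724572215719250220916386479164589665900666031464491467164086614415283713774292658860371600177669416539966612750982551879811390789482,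 383295171132125991964399388406313461679432728344447552489935457704382696599361274989272754010836263309270953011309926724981645123420669144308168019581499141567463365128662489025374100170968349854539787631412627821353672218049433978364969242889844379013133803279907424230071645826384976139622388687735186043042253530996162728150572642241398793640430206129738558116901592826506551464827953627497223554022598446482353743422733729359291996439336742224449090, 302125066107220136140753066537150296716852579741990432746610019513203402449665598537720927614338576553561196094829691130863225683343584080237531565002545931071905309704567989117449342522995234784376252754632567068501648374952935635469462405164808162428696828371151681460656389597834327170153561695373974369763506148728129968367644653688015121536644997424908284580163694387250728241739528973278027835138331742873722269006396862796115955828058293545232314, 551040515024845177551515139439443230985172078019481724087888722485946308338349984625170957415239294710584923716762437372339636336146450248868824571368786844115228075046674602472152532442055838382058626904557174015807380461366769237104461365564890643033990775807687751815236824545435398267717461144114731145805710731952597481419775944710669807504098285, 25410742981471130101008811263405381164811174791717755046053025858964103264263118615114547071917509259745289521821714413252769243028770658270159704638453811969787028183038159218999899185137367385895059582629349725827029930047752847615106427594745015479369441858465437008359930678543586779507894365620657897005739907663905334136031353820298325773182598227765137194909082556888317324689272473683591, 10391635991255418268885388504401873975689702950000479994784161684040929092117268140129546871983407199095584773665461049467362321485305847829532269656119962486530600980763035970416292862886898165358855615861493174115577097579725411092372749937308821919622219307965807166338165753099857050595825535059560408338894114207967965070775652271368595283902793880677210601370822747520511178159490672895428000398432338735271655674456097405950926694761354323546455897344123,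 45728974560873118957572235717905606201113949983894185551139024427194966977320423027711827552958550625461005517663453299094811067124600470183677158710188382117749866586709633931394358159894926207643591173575971029584422920201472314868147042035735542702692697230838846769235283181171539013426655666001514051292317634048961367078411719820030382713373093661459505564572106745206351215704961057835505, 75673304256440805334423297408567554904281116270225949138753632366004847852129600923008489611911219666393631601454377625714309593282920144913766212455110895799849367918843140552745122599158206885034316928553817115194888311202998750538467794796809185607040631836382788561457207911333294473324044617336842803506249319368910137746380104727785662339585514418541714, 5567551209748256256883515097545675244240477468148008471968221246534214570595626777870842177610989412605007249930588352966766890087160328044653808556035549484835482160774400990168228394872287126357799311646566688840668003887207996822891417297118790523871940666523322599608755561837561123926915180084745720736679304285687630229221032052457980574887726822795842752300227512163, 58278132014317609626796210145600094639211885730368927508462795927210142446699919049299276294577159257063871680355690671455552699860619286310247249270407199579680735364282748188670420733923039473681275388631178495909476375946855082795079106571072300327581364859930841822367971916167624521935186566862069582848028762219254856275828782379680461351914218626093183290447410549641465328746985090445510532980483974394897909297345741641983463243613473729710405597405330262794690153499011191330200859280125480770, 20397433627036310235198353451927964328401299143955348426409626550470488855043398763721366615485848054489784043656402775313471213208206247657081340694692152403826192341803523089617396434266952076523847121469630849634113077490443215496806289283235237477626993985261581952158474687279031070083522793268872654486028132034673146174074604240104305338699276007831328031763390155009555356940042317030527699410166088890104521470091287374170035536560265355088314,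 90227636416572832807954650539585065870201624010503943310793620611823233329561064280135066196568606579578793047555181250580366241322957619554471555751190518386457159230794420680079536248468245040693287907782770024660323242751046552189223862565274417078254517389734682813087225933402759688582391774515322574281580267004589672182783936041591706666553833591811392804117896197825199863219334250223002144630063000654849146193832999740865896816571910876458146876728291644237, 419829434909351977761823215783262931980705102174396547749449344263006044740611990529668100295862917707517605386331368887356346982407032892717957409476084929839317044986355027155659878545869396612303753828119110319385520525236620903163682004477919936216391907454594659516345105144702596837300978433582246042385148076207549214907704235491378721385799559982550087357672421616688130684453274655333559441969686536457311214895786709538616463338, 144349061427677965760924577869204078323995350630571079392023260337387505773914016654840100953900561767644297081595023016735945439824696060243947553010439568892718912531417830053306385519369074997464165558426593257386080167654664195177248257059951658657749185376462583862288697904906010636455796465649411595498685151959674247664172884539750066925934668547500861335262201288040790805383687885455100465382850875690678766024341232030049290208475935808772042, 6251330877975237406253867806375998096949466521609269596797183723745275412371431127636872921188092364364267016296323487478264274333209950686775350716416168735959882571082356712480700688687169539535153723545841760651106618893870475927037766048544058990453227590903728678909189841689780647567430940532953232815614620763969158203097704470018830169972680378695159457797255302169387174887789850808664068644006276067306895068089933980617876571796074436658922164117062,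 286868653169312350893265123703284988494413873377731979724888734952785562752730379462927683232419061851988827649550555490389869337739447042743084153276929658412121511984676828069109402044127086166900418470551352938765767420904285776796516670526372462517488173031648159254686132095657711282151025352987866360755654375121932027644334114987141930296840251215176714956733280297914743937958109237137210859470463741057234189702353190407020, 560624059947009002897753794004459867764733826940141648522961039637586386568499362018462064990357937670051620455459145900567510531234047428787164072969724970121056665537199255123605993508871728001904917844954475577479119892913358787809395391531324123402794045059483344756624078053864404074663511620527026212860036783894997102207000092748212697344346559153853941637720791658222373859123095061212082232658, 15889048917467615690564548213108772813208787572565980810530356510684585178445322029061127449072756015428256423691606093139852958950649131575619933361943716277256962001278955231867216138956039454740496313857111789351170878428117821198052152817279300703739356446953838766516336724967595493247012293125000688451084331495873708756760565459091366868811844756065518177565828142628026452429982368666219328140469701263901678188485109, 193448342234687360833951749388730140718028582518915200638992280525771941671516821867710902819714468321438627405404135715022996255476347059992686368691132829345542835624216172501789881142106678128862424595417068424417046857263595631091551834383449726555263771463789188896736024870218570665442130022197451251032050954404151288797162200805313177756588258134037908525673385948263577782875177021657200682851939440888418089878246400354209, 78849486662628098162999740899430222530603334681112267210715203732414062027815427858809867070384352925171998109731979133070655548478859405285286417000435391809875031166518712015396080919773787607585408117767235440836733676791353569252619456339050736995045065320674800104959598968564768968494300843379159944528916527862847285239474706565822054183677491613096102639138120222407006276029237427265536030637749580804376772041790412019905425344729781979091479,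 1467463283406683821494311916691347970571145031396858051968206946036687158229622952839045228069400679215958397894864784297188735016262231514238666740463679713592799977997297576220095854671709555487961762657271496300923716572975605139161529567814158029805570109320843806996364815307182202345884098506276686878706496331544326225504944455969994723886728459] = true := by
  decide +kernel

set_option maxRecDepth 100000 in
theorem PF60_small : checkSmall PF60 [(11, 1129), (17, 1012608), (19, 17804), (29, 1122846), (61, 41152), (71, 1967), (89, 1196), (109, 30037), (179, 139289), (199, 68), (251, 364), (269, 638), (271, 24613), (359, 181080), (379, 89), (431, 256), (449, 153), (521, 193010), (541, 261), (631, 3732821)] = true := by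
  decide +kernel

theorem PF60_good : Good PF60 where
  d := ⟨by decide +kernel, by decide +kernel, by decide +kernel, by decide +kernel, by decide +kernel,
    by decide +kernel, by decide +kernel, by decide +kernel, by decide +kernel, by decide +kernel⟩
  r1 := by decide +kernel
  r2 := by decide +kernel
  b20 := by decide +kernel
  cov1 := ⟨_, _, PF60_large⟩
  cov2 := ⟨_, PF60_small⟩
  inv := by decide +kernel
  bpos := by decide +kernel
  wt := by decide +kernel

def Pm20 : Par where
  hl := [1, 89, 107, 109, 127, 143, 161, 163]
  reps := [1, 7, 11, 13, 17, 23]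
  basis := [[0], [2, 34, 38, 74, 106, 142, 146, 178], [4, 32, 68, 76, 104, 112, 148, 176], [3, 21, 69, 87, 123, 129, 141, 147], [1, 89, 107, 109, 127, 143, 161, 163], [7, 29, 43, 47, 61, 83, 101, 169]]
  lo := 4
  base := 9
  B := 1336
  r := 36
  C := 30

set_option maxRecDepth 100000 in
theorem Pm20_large : checkLarge Pm20 50 [863045707048330446262372597280373735721204559971672222427050194106304114638171576992031527040427296027220595355775888478102035371385944061375655253610156484919966] = true := by
  decide +kernel

set_option maxRecDepth 100000 in
theorem Pm20_small : checkSmall Pm20 [(7, 204), (17, 3661), (19, 1500)] = true := by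
  decide +kernel

theorem Pm20_good : Good Pm20 where
  d := ⟨by decide +kernel, by decide +kernel, by decide +kernel, by decide +kernel, by decide +kernel,
    by decide +kernel, by decide +kernel, by decide +kernel, by decide +kernel, by decide +kernel⟩
  r1 := by decide +kernel
  r2 := by decide +kernel
  b20 := by decide +kernel
  cov1 := ⟨_, _, Pm20_large⟩
  cov2 := ⟨_, Pm20_small⟩
  inv := by decide +kernel
  bpos := by decide +kernel
  wt := by decide +kernel

def Pm15 : Par where
  hl := [1, 17, 19, 53, 91, 107, 109, 143]
  reps := [1, 7, 13, 23, 37, 47]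
  basis := [[0], [10, 170], [20, 160], [2, 34, 38, 106], [4, 32, 68, 76], [6, 102, 114, 138]]
  lo := 4
  base := 9
  B := 167
  r := 12
  C := 30

set_option maxRecDepth 100000 in
theorem Pm15_large : checkLarge Pm15 50 [638139949982904682070198] = true := by
  decide +kernel

set_option maxRecDepth 100000 in
theorem Pm15_small : checkSmall Pm15 [] = true := by
  decide +kernel

theorem Pm15_good : Good Pm15 where
  d := ⟨by decide +kernel, by decide +kernel, by decide +kernel, by decide +kernel, by decide +kernel,
    by decide +kernel, by decide +kernel, by decide +kernel, by decide +kernel, by decide +kernel⟩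
  r1 := by decide +kernel
  r2 := by decide +kernel
  b20 := by decide +kernel
  cov1 := ⟨_, _, Pm15_large⟩
  cov2 := ⟨_, Pm15_small⟩
  inv := by decide +kernel
  bpos := by decide +kernel
  wt := by decide +kernel

def P60 : Par where
  hl := [1, 17, 53, 71, 109, 127, 163, 179]
  reps := [1, 7, 13, 19, 29, 49]
  basis := [[0], [2, 34, 38, 74, 106, 142, 146, 178], [4, 32, 68, 76, 104, 112, 148, 176], [1, 17, 53, 71, 109, 127, 163, 179], [7, 11, 43, 61, 119, 137, 169, 173], [3, 21, 33, 51, 129, 147, 159, 177]]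
  lo := 4
  base := 9
  B := 647
  r := 25
  C := 30

set_option maxRecDepth 100000 in
theorem P60_large : checkLarge P60 50 [2538742999374096661803549216250927525209013331706102562731406734663301225186457669577694363831663990] = true := by
  decide +kernel

set_option maxRecDepth 100000 in
theorem P60_small : checkSmall P60 [(7, 1682), (17, 36), (19, 2445)] = true := by
  decide +kernel

theorem P60_good : Good P60 where
  d := ⟨by decide +kernel, by decide +kernel, by decide +kernel, by decide +kernel, by decide +kernel,
    by decide +kernel, by decide +kernel, by decide +kernel, by decide +kernel, by decide +kernel⟩
  r1 := by decide +kernel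
  r2 := by decide +kernel
  b20 := by decide +kernel
  cov1 := ⟨_, _, P60_large⟩
  cov2 := ⟨_, P60_small⟩
  inv := by decide +kernel
  bpos := by decide +kernel
  wt := by decide +kernel

end C180
end

section
open NumberField Polynomial
open scoped Pointwise

namespace C180
section
variable {K : Type*} [Field K] [NumberField K] [hK : IsCyclotomicExtension {180} ℚ K]

/-- list of terms -/
def lin : List ℤ → List (List ℕ) → List (ℤ × ℕ)
  | c :: cs, o :: os => (o.map fun e => (c, e)) ++ lin cs os
  | _, _ => []

def cfs (P : Par) (code : ℕ) : List ℤ :=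
  (digs P.base P.basis.length code).map fun d : ℕ => (d : ℤ) - P.lo

theorem el_append (l l' : List (ℤ × ℕ)) : el K (l ++ l') = el K l + el K l' := by
  simp [el]

theorem el_orb (c : ℤ) (o : List ℕ) : el K (o.map fun e => (c, e)) = c * (o.map fun e => z K ^ e).sum := by
  induction o with
  | nil => simp [el]
  | cons a o ih =>
    simp only [el, List.map_cons, List.sum_cons] at ih ⊢
    rw [ih]; ring

theorem el_lin_fixed (cs : List ℤ) (bs : List (List ℕ)) (h : ℕ) (hh : h.Coprime 180)
    (hi : ∀ o ∈ bs, (o.map fun e => e * h % 180).Perm o) :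
    s K h • el K (lin cs bs) = el K (lin cs bs) := by
  induction bs generalizing cs with
  | nil => cases cs <;> simp [lin, el]
  | cons o bs ih =>
    cases cs with
    | nil => simp [lin, el]
    | cons c cs =>
      rw [lin, el_append, smul_add, ih _ (fun o ho => hi o (List.mem_cons_of_mem _ ho))]
      congr 1
      rw [s_el hh]
      have : tw h (o.map fun e => (c, e)) = (o.map fun e => e * h).map fun e => (c, e) := by
        simp [tw, Function.comp_def]
      rw [this, el_orb, el_orb]
      congr 1
      have h2 := ((hi o List.mem_cons_self).map (fun e => z K ^ e)).sum_eq
      rw [← h2]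
      simp only [List.map_map, Function.comp_def, z_pow_mod]

theorem wt_lin (cs : List ℤ) (bs : List (List ℕ)) (m : ℕ) (h : ∀ c ∈ cs, c.natAbs ≤ m) :
    wt (lin cs bs) ≤ (bs.map fun o => m * o.length).sum := by
  induction bs generalizing cs with
  | nil => cases cs <;> simp [lin, wt]
  | cons o bs ih =>
    cases cs with
    | nil => simp [lin, wt]
    | cons c cs =>
      have := ih cs (fun c hc => h c (List.mem_cons_of_mem _ hc))
      have h1 := h c List.mem_cons_self
      simp only [lin, wt, List.map_append, List.sum_append, List.map_map, List.map_cons, List.sum_cons,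
        Function.comp_def, List.map_const', List.sum_replicate, smul_eq_mul] at this ⊢
      nlinarith

theorem digs_lt (b n c : ℕ) (hb : 0 < b) : ∀ d ∈ digs b n c, d < b := by
  induction n generalizing c with
  | zero => simp [digs]
  | succ n ih =>
    intro d hd
    rcases List.mem_cons.mp hd with rfl | hd
    · exact Nat.mod_lt _ hb
    · exact ih _ d hd

theorem digs_len (b n c : ℕ) : (digs b n c).length = n := by
  induction n generalizing c with
  | zero => simp [digs]
  | succ n ih => simp [digs, ih]

theorem Phi4 : Phi (4 : ZMod NN) = 0 := by
  have : ((NN : ℕ) : ZMod NN) = 0 := ZMod.natCast_self NN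
  have h2 : ((4^48+4^42-4^30-4^24-4^18+4^6+1 : ℤ) : ZMod NN) = ((NN : ℤ) : ZMod NN) := by
    congr 1
  unfold Phi
  push_cast at h2
  rw [this] at h2
  exact h2

theorem four_pow (e : ℕ) : (4 : ZMod NN) ^ (e % 180) = 4 ^ e := by
  have h : (4 : ZMod NN) ^ 180 = 1 := by
    have : ((4 ^ 180 : ℕ) : ZMod NN) = ((1 : ℕ) : ZMod NN) := by
      rw [ZMod.natCast_eq_natCast_iff']
      decide +kernel
    exact_mod_cast this
  conv_rhs => rw [← Nat.div_add_mod e 180, pow_add, pow_mul, h, one_pow, one_mul]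

theorem dot_spec (lo k : ℕ) (ds : List ℕ) (bs : List (List ℕ)) (hlen : ds.length = bs.length)
    (f : List ℕ → ℕ) (r : ZMod NN) (hf : ∀ o, (f o : ZMod NN) = (o.map fun e => r ^ (e * k)).sum) :
    evl r (tw k (lin (ds.map fun d : ℕ => (d : ℤ) - lo) bs)) =
      (dot (bs.map f) ds : ZMod NN) - lo * ((bs.map f).sum : ℕ) := by
  induction bs generalizing ds with
  | nil => cases ds <;> simp [lin, tw, evl, dot]
  | cons o bs ih =>
    cases ds with
    | nil => simp at hlen
    | cons d ds =>
      have := ih ds (by simpa using hlen)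
      have hd : dot ((o :: bs).map f) (d :: ds) = f o * d + dot (bs.map f) ds := rfl
      rw [hd]
      have e1 : ∀ o : List ℕ, ∀ c : ℤ, evl r (tw k (o.map fun e => (c, e))) = c * (o.map fun e => r ^ (e * k)).sum := by
        intro o c
        induction o with
        | nil => simp [tw, evl]
        | cons a o ih =>
          simp only [tw, evl, List.map_cons, List.sum_cons, List.map_map, Function.comp_def] at ih ⊢
          rw [ih]; ring
      have e2 : ∀ l l' : List (ℤ × ℕ), evl r (tw k (l ++ l')) = evl r (tw k l) + evl r (tw k l') := by
        intro l l'; simp [evl, tw]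
      rw [List.map_cons, lin, e2, this, e1, ← hf, List.map_cons, List.sum_cons]
      push_cast
      ring

theorem row_spec (P : Par) (code k : ℕ) :
    evl (4 : ZMod NN) (tw k (lin (cfs P code) P.basis)) =
      (dot (mkRow P k) (1 :: digs P.base P.basis.length code) : ZMod NN) := by
  rw [cfs, dot_spec P.lo k _ P.basis (digs_len _ _ _)
    (fun o => (o.map fun e => 4 ^ (e * k % 180)).sum % NN) 4 ?_]
  · have : dot (mkRow P k) (1 :: digs P.base P.basis.length code) =
      (NN - (P.lo * (P.basis.map fun o => (o.map fun e => 4 ^ (e * k % 180)).sum % NN).sum) % NN) * 1 +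
       dot (P.basis.map fun o => (o.map fun e => 4 ^ (e * k % 180)).sum % NN)
        (digs P.base P.basis.length code) := rfl
    rw [this, Nat.cast_add, mul_one, Nat.cast_sub (Nat.mod_lt _ (by decide)).le, ZMod.natCast_self,
      ZMod.natCast_mod, Nat.cast_mul]
    ring
  · intro o
    rw [ZMod.natCast_mod, Nat.cast_list_sum, List.map_map]
    congr 1
    refine List.map_congr_left fun e _ => ?_
    simp only [Function.comp_apply, Nat.cast_pow, Nat.cast_ofNat]
    exact four_pow _

theorem val_spec (ds : List ℕ) (rows : List (List ℕ)) :
    (val NN ds rows : ZMod NN) = (rows.map fun r => (dot r ds : ZMod NN)).prod := by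
  induction rows with
  | nil => simp [val]
  | cons r rows ih =>
    have : val NN ds (r :: rows) = (val NN ds rows * dot r ds) % NN := rfl
    rw [this, ZMod.natCast_mod, Nat.cast_mul, ih, List.map_cons, List.prod_cons, mul_comm]

theorem norm_pn (reps : List ℕ) (hr : ∀ k ∈ reps, Nat.Coprime k 180) (l : List (ℤ × ℕ)) (φ : K →+* ℂ) :
    ‖φ (pn reps (el K l) : 𝓞 K)‖ ≤ (wt l : ℝ) ^ reps.length := by
  induction reps with
  | nil => simp [pn]
  | cons k reps ih =>
    have h1 := ih fun k hk => hr k (List.mem_cons_of_mem _ hk)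
    have : pn (k :: reps) (el K l) = el K (tw k l) * pn reps (el K l) := by
      rw [← s_el (hr k List.mem_cons_self)]; simp [pn]
    rw [this]
    change ‖φ (algebraMap (𝓞 K) K (el K (tw k l) * pn reps (el K l)))‖ ≤ _
    rw [map_mul, map_mul, norm_mul, List.length_cons, pow_succ']
    refine mul_le_mul ?_ h1 (norm_nonneg _) (by positivity)
    have := norm_el φ (tw k l)
    rwa [wt_tw] at this

theorem ev_pn {R : Type*} [CommRing R] (r : R) (h : Phi r = 0) (reps : List ℕ)
    (hr : ∀ k ∈ reps, Nat.Coprime k 180) (l : List (ℤ × ℕ)) :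
    ev K r h (pn reps (el K l)) = (reps.map fun k => evl r (tw k l)).prod := by
  rw [pn, map_list_prod, List.map_map]
  congr 1
  refine List.map_congr_left fun k hk => ?_
  rw [Function.comp_apply, s_el (hr k hk), ev_el]

theorem absv_spec (n : ℤ) (v : ℕ) (h : (n : ZMod NN) = v) (hv : v < NN) (hn : 2 * n.natAbs < NN) :
    n.natAbs = absv NN v := by
  have h1 : ((n : ℤ) : ZMod NN) = ((v : ℤ) : ZMod NN) := by rw [h]; simp
  rw [ZMod.intCast_eq_intCast_iff_dvd_sub] at h1
  obtain ⟨c, hc⟩ := h1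
  have e : absv NN v = min v (NN - v) := rfl
  rw [e]
  have hp : (0 : ℤ) < NN := by decide
  have habs : |n| < (NN : ℤ) := by rw [Int.abs_eq_natAbs]; omega
  have hc1 : c < 2 := by nlinarith [abs_lt.mp habs]
  have hc0 : -1 < c := by nlinarith [abs_lt.mp habs]
  have : c = 0 ∨ c = 1 := by omega
  rcases this with rfl | rfl <;> omega

theorem val_lt (ds : List ℕ) (rows : List (List ℕ)) : val NN ds rows < NN := by
  cases rows with
  | nil => exact (by decide : 1 < NN)
  | cons r rows => exact Nat.mod_lt _ (by decide)

theorem abs_pn_int (reps : List ℕ) (hr : ∀ k ∈ reps, Nat.Coprime k 180) (l : List (ℤ × ℕ)) (n : ℤ)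
    (h : pn reps (el K l) = n) : n.natAbs ≤ (wt l) ^ reps.length := by
  obtain ⟨φ⟩ : Nonempty (K →+* ℂ) := inferInstance
  have := norm_pn reps hr l φ
  rw [h] at this
  change ‖φ (algebraMap (𝓞 K) K (n : 𝓞 K))‖ ≤ _ at this
  rw [map_intCast, map_intCast] at this
  have h2 : ‖(n : ℂ)‖ = (n.natAbs : ℝ) := by simp [Nat.cast_natAbs]
  rw [h2] at this
  exact_mod_cast this

theorem pn_code (P : Par) (g : Good P) (code : ℕ) :
    ∃ x : 𝓞 K, (∀ σ ∈ Hs K g.d, σ • x = x) ∧ ∃ n : ℤ, pn P.reps x = n ∧ n.natAbs = nrm P code := by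
  have hfix : ∀ σ ∈ Hs K g.d, σ • el K (lin (cfs P code) P.basis) = el K (lin (cfs P code) P.basis) := by
    rintro σ ⟨h, hh, rfl⟩
    exact el_lin_fixed _ _ h (g.d.cop h hh) (fun o ho => g.inv o ho h hh)
  refine ⟨_, hfix, ?_⟩
  obtain ⟨n, hn⟩ := pn_int g.d _ hfix
  refine ⟨n, hn, ?_⟩
  apply absv_spec
  · have h1 := ev_pn (K := K) (4 : ZMod NN) Phi4 P.reps g.d.rcop (lin (cfs P code) P.basis)
    rw [hn, map_intCast] at h1
    rw [h1, val_spec, mkRows, List.map_map]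
    congr 1
    refine List.map_congr_left fun k _ => ?_
    exact row_spec P code k
  · exact val_lt _ _
  · have h1 := abs_pn_int P.reps g.d.rcop _ n hn
    have h2 := wt_lin (cfs P code) P.basis (P.lo + P.base) (by
      intro c hc
      obtain ⟨d, hd, rfl⟩ := List.mem_map.mp hc
      have := digs_lt _ _ _ g.bpos d hd
      omega)
    have h3 := Nat.pow_le_pow_left h2 P.reps.length
    have := g.wt
    omega
end
end C180
end

section
open NumberField Polynomial
open scoped Pointwise nonZeroDivisors

namespace C180
section
variable {K : Type*} [Field K] [NumberField K] [hK : IsCyclotomicExtension {180} ℚ K]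

/-- closure properties of a family of good ideals. -/
structure GoodFam {R : Type*} [CommRing R] (good : Ideal R → Prop) : Prop where
  pr : ∀ x : R, x ≠ 0 → good (Ideal.span {x})
  mul : ∀ I J, I ≠ ⊥ → J ≠ ⊥ → good I → good J → good (I * J)
  can : ∀ I J, I ≠ ⊥ → J ≠ ⊥ → good (I * J) → good I → good J

theorem good_of_primes {R : Type*} [CommRing R] [IsDedekindDomain R] {good : Ideal R → Prop}
    (hg : GoodFam good) (I : Ideal R) (hI : I ≠ ⊥)
    (h : ∀ Q : Ideal R, Q.IsPrime → Q ≠ ⊥ → I ≤ Q → good Q) : good I := by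
  induction I using UniqueFactorizationMonoid.induction_on_prime with
  | h₁ => exact absurd rfl hI
  | h₂ x hx =>
    rw [Ideal.isUnit_iff] at hx
    rw [hx, ← Ideal.span_singleton_one]
    exact hg.pr 1 one_ne_zero
  | h₃ a p ha hp ih =>
    have hp0 : p ≠ ⊥ := hp.ne_zero
    refine hg.mul _ _ hp0 ha (h p (Ideal.isPrime_of_prime hp) hp0 Ideal.mul_le_left) (ih ha ?_)
    intro Q h1 h2 h3
    exact h Q h1 h2 (Ideal.mul_le_right.trans h3)

theorem list_prod_mem {R : Type*} [CommRing R] {Q : Ideal R} (hQ : Q.IsPrime) (l : List R)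
    (h : l.prod ∈ Q) : ∃ x ∈ l, x ∈ Q := by
  induction l with
  | nil => exact absurd ((Ideal.eq_top_iff_one Q).mpr (by simpa using h)) hQ.ne_top
  | cons a l ih =>
    rw [List.prod_cons] at h
    rcases hQ.mem_or_mem h with h | h
    · exact ⟨a, List.mem_cons_self, h⟩
    · obtain ⟨x, hx, h2⟩ := ih h
      exact ⟨x, List.mem_cons_of_mem _ hx, h2⟩

theorem absNorm_span_of_pn {hl reps : List ℕ} (d : HD hl reps) (x : 𝓞 K) (hx : ∀ σ ∈ Hs K d, σ • x = x) (n : ℤ)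
    (hn : pn reps x = n) (k : ℕ) (y : 𝓞 (FF K d))
    (hy : algebraMap (𝓞 (FF K d)) (𝓞 K) y = s K k • x) :
    Ideal.absNorm (Ideal.span {y}) = n.natAbs := by
  have h1 := absNorm_map (K := K) d (Ideal.span {y})
  rw [Ideal.map_span, Set.image_singleton, hy, Ideal.absNorm_span_singleton] at h1
  have h2 : Algebra.norm ℤ (s K k • x) = Algebra.norm ℤ x := by
    have e1 := norm_eq_prod (s K k • x)
    have e2 := norm_eq_prod x
    have : (∏ g : Gal(K/ℚ), g • (s K k • x)) = ∏ g : Gal(K/ℚ), g • x := by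
      simp_rw [← mul_smul]
      exact (Group.mulRight_bijective (s K k)).prod_comp (fun g => g • x)
    rw [this, ← e2] at e1
    exact_mod_cast e1
  have h3 := pn_pow d x hx
  rw [hn] at h3
  have h4 : Algebra.norm ℤ x = n ^ hl.length := by exact_mod_cast h3
  rw [h2, h4, Int.natAbs_pow] at h1
  have h0 : hl.length ≠ 0 := (List.length_pos_of_mem d.one).ne'
  exact (Nat.pow_left_injective h0 h1).symm

theorem cert_step (P : Par) (g : Good P) (good : Ideal (𝓞 (FF K g.d)) → Prop) (hg : GoodFam good)
    (hC : ∀ Q : Ideal (𝓞 (FF K g.d)), Q.IsPrime → Q ≠ ⊥ → (P.C : 𝓞 (FF K g.d)) ∈ Q → good Q)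
    (Q : Ideal (𝓞 (FF K g.d))) (hQ : Q.IsPrime) (h0 : Q ≠ ⊥) (hB : Ideal.absNorm Q ≤ P.B)
    (ih : ∀ Q' : Ideal (𝓞 (FF K g.d)), Q'.IsPrime → Q' ≠ ⊥ → Ideal.absNorm Q' < Ideal.absNorm Q → good Q') :
    good Q := by
  by_cases hCQ : (P.C : 𝓞 (FF K g.d)) ∈ Q
  · exact hC Q hQ h0 hCQ
  have hmax : Q.IsMaximal := hQ.isMaximal h0
  obtain ⟨p, f, hf, hpQ, hp, hpf⟩ := Ideal.exists_prime_and_absNorm_eq_pow Q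
  have hnot : ∀ m : ℕ, Nat.Coprime p m → (m : 𝓞 (FF K g.d)) ∉ Q := by
    intro m hm hmQ
    have := Nat.Coprime.cast (R := 𝓞 (FF K g.d)) hm
    obtain ⟨a, b, e⟩ := this
    apply hQ.ne_top
    rw [Ideal.eq_top_iff_one, ← e]
    exact Q.add_mem (Q.mul_mem_left _ hpQ) (Q.mul_mem_left _ hmQ)
  have hpC : ¬ p ∣ P.C := by
    rintro ⟨c, hc⟩
    apply hCQ
    rw [hc, Nat.cast_mul]
    exact Q.mul_mem_right _ hpQ
  have hmp : ∃ t, mp p * t = 180 ∧ Nat.Coprime p (mp p) := by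
    unfold mp
    split_ifs with h1 h2 h3
    · subst h1; exact ⟨4, by norm_num, by norm_num⟩
    · subst h2; exact ⟨9, by norm_num, by norm_num⟩
    · subst h3; exact ⟨5, by norm_num, by norm_num⟩
    · refine ⟨1, by norm_num, (Nat.Prime.coprime_iff_not_dvd hp).mpr fun h => ?_⟩
      rw [show 180 = 2 ^ 2 * 3 ^ 2 * 5 by norm_num, hp.dvd_mul, hp.dvd_mul] at h
      rcases h with (h | h) | h
      · exact h1 ((Nat.prime_dvd_prime_iff_eq hp Nat.prime_two).mp (hp.dvd_of_dvd_pow h))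
      · exact h2 ((Nat.prime_dvd_prime_iff_eq hp Nat.prime_three).mp (hp.dvd_of_dvd_pow h))
      · exact h3 ((Nat.prime_dvd_prime_iff_eq hp Nat.prime_five).mp h)
  obtain ⟨t, ht, hcop⟩ := hmp
  have hres := residue g.d Q h0 (mp p) t ht (hnot _ hcop)
  rw [hpf] at hres hB
  obtain ⟨code, hn0, hpn, hq⟩ := g.cov p f hp hpC hf hB hres
  obtain ⟨x, hx, n, hn, hnn⟩ := pn_code (K := K) P g code
  rw [← hnn] at hn0 hpn hq
  have hy : ∀ k : ℕ, ∃ y : 𝓞 (FF K g.d), k ∈ P.reps → algebraMap (𝓞 (FF K g.d)) (𝓞 K) y = s K k • x := by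
    intro k
    by_cases hk : k ∈ P.reps
    · obtain ⟨y, hy⟩ := exists_of_fixed g.d (s K k • x) (by
        intro σ hσ
        obtain ⟨a, -, ha, rfl⟩ := gal_eq_s σ
        rw [← mul_smul, s_mul ha (g.d.rcop k hk), mul_comm, ← s_mul (g.d.rcop k hk) ha, mul_smul, hx _ hσ])
      exact ⟨y, fun _ => hy⟩
    · exact ⟨0, fun h => absurd h hk⟩
  choose y hy using hy
  have hprod : (P.reps.map y).prod = (n : 𝓞 (FF K g.d)) := by
    apply FaithfulSMul.algebraMap_injective (𝓞 (FF K g.d)) (𝓞 K)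
    rw [map_intCast, ← hn, pn, map_list_prod, List.map_map]
    congr 1
    exact List.map_congr_left fun k hk => hy k hk
  have hnQ : (n : 𝓞 (FF K g.d)) ∈ Q := by
    obtain ⟨c, hc⟩ := Int.natCast_dvd.mpr hpn
    rw [hc, Int.cast_mul, Int.cast_natCast]
    exact Q.mul_mem_right _ hpQ
  have : ∃ k ∈ P.reps, y k ∈ Q := by
    rw [← hprod] at hnQ
    obtain ⟨w, hw, hw2⟩ := list_prod_mem hQ _ hnQ
    obtain ⟨k, hk, rfl⟩ := List.mem_map.mp hw
    exact ⟨k, hk, hw2⟩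
  obtain ⟨k, hk, hkQ⟩ := this
  have hnorm := absNorm_span_of_pn g.d x hx n hn k (y k) (hy k hk)
  have hy0 : y k ≠ 0 := by
    intro h
    rw [h] at hnorm
    simp at hnorm
    omega
  obtain ⟨J, hJ⟩ := Ideal.dvd_iff_le.mpr ((Ideal.span_singleton_le_iff_mem Q).mpr hkQ)
  have hJ0 : J ≠ ⊥ := by
    rintro rfl
    rw [Ideal.mul_bot, Ideal.span_singleton_eq_bot] at hJ
    exact hy0 hJ
  have hmul : n.natAbs = p ^ f * Ideal.absNorm J := by
    rw [← hnorm, hJ, map_mul, hpf]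
  have hpf0 : 0 < p ^ f := Nat.pow_pos hp.pos
  have hq2 := hq ⟨_, hmul⟩
  rw [hmul, Nat.mul_div_cancel_left _ hpf0] at hq2
  have hgJ : good J := by
    apply good_of_primes hg J hJ0
    intro R hR hR0 hJR
    by_cases hCR : (P.C : 𝓞 (FF K g.d)) ∈ R
    · exact hC R hR hR0 hCR
    apply ih R hR hR0
    rw [hpf]
    refine lt_of_le_of_lt (Nat.le_of_dvd ?_ ?_) hq2
    · have : 0 < Ideal.absNorm J := Nat.pos_of_ne_zero (by rwa [Ne, Ideal.absNorm_eq_zero_iff])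
      exact Nat.div_pos (Nat.gcd_le_left _ this) (Nat.gcd_pos_of_pos_left _ this)
    · have hd : Ideal.absNorm R ∣ Ideal.absNorm J := Ideal.absNorm_dvd_absNorm_of_le hJR
      have hRmax : R.IsMaximal := hR.isMaximal hR0
      have hc : Nat.Coprime (Ideal.absNorm R) P.C := by
        obtain ⟨p', f', hf', hpR, hp', hpf'⟩ := Ideal.exists_prime_and_absNorm_eq_pow R
        rw [hpf']
        apply Nat.Coprime.pow_left
        rw [Nat.Prime.coprime_iff_not_dvd hp']
        rintro ⟨c, hc⟩
        apply hCR
        rw [hc, Nat.cast_mul]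
        exact R.mul_mem_right _ hpR
      have hc2 : Nat.Coprime (Ideal.absNorm R) (Nat.gcd (Ideal.absNorm J) (P.C ^ 40)) :=
        Nat.Coprime.coprime_dvd_right (Nat.gcd_dvd_right _ _) (hc.pow_right 40)
      refine hc2.dvd_of_dvd_mul_left ?_
      rwa [Nat.mul_div_cancel' (Nat.gcd_dvd_left _ _)]
  refine hg.can J Q hJ0 h0 ?_ hgJ
  rw [mul_comm, ← hJ]
  exact hg.pr _ hy0

theorem all_good (P : Par) (g : Good P) (good : Ideal (𝓞 (FF K g.d)) → Prop) (hg : GoodFam good)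
    (hC : ∀ Q : Ideal (𝓞 (FF K g.d)), Q.IsPrime → Q ≠ ⊥ → (P.C : 𝓞 (FF K g.d)) ∈ Q → good Q)
    (hB : ∀ c : ClassGroup (𝓞 (FF K g.d)), ∃ I : (Ideal (𝓞 (FF K g.d)))⁰, ClassGroup.mk0 I = c ∧
      Ideal.absNorm (I : Ideal (𝓞 (FF K g.d))) ≤ P.B) (I : Ideal (𝓞 (FF K g.d))) (hI : I ≠ ⊥) : good I := by
  have key : ∀ (m : ℕ) (Q : Ideal (𝓞 (FF K g.d))), Q.IsPrime → Q ≠ ⊥ → Ideal.absNorm Q = m →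
      m ≤ P.B → good Q := by
    intro m
    induction m using Nat.strong_induction_on with
    | _ m ih =>
      intro Q hQ h0 e hm
      refine cert_step P g good hg hC Q hQ h0 (e ▸ hm) fun Q' hQ' h0' hlt => ?_
      exact ih _ (e ▸ hlt) Q' hQ' h0' rfl (hlt.le.trans (e ▸ hm))
  obtain ⟨J, hJ, hJB⟩ := hB (ClassGroup.mk0 ⟨I, mem_nonZeroDivisors_of_ne_zero hI⟩)
  have hJ0 : (J : Ideal (𝓞 (FF K g.d))) ≠ ⊥ := nonZeroDivisors.ne_zero J.2
  have hgJ : good J := by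
    apply good_of_primes hg _ hJ0
    intro Q hQ h0 hle
    refine key _ Q hQ h0 rfl (le_trans (Nat.le_of_dvd ?_ (Ideal.absNorm_dvd_absNorm_of_le hle)) hJB)
    exact Nat.pos_of_ne_zero (by rwa [Ne, Ideal.absNorm_eq_zero_iff])
  obtain ⟨x, y, hx, hy, e⟩ := ClassGroup.mk0_eq_mk0_iff.mp hJ
  refine hg.can (Ideal.span {y}) I (by simpa using hy) hI ?_ (hg.pr y hy)
  have : good (Ideal.span {x} * (J : Ideal (𝓞 (FF K g.d)))) :=
    hg.mul _ _ (by simpa using hx) hJ0 (hg.pr x hx) hgJ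
  rw [e] at this
  exact this
end
end C180
end

section
open NumberField Polynomial
open scoped Pointwise nonZeroDivisors

namespace C180

section mink
variable {K : Type*} [Field K] [NumberField K] [hK : IsCyclotomicExtension {180} ℚ K]
variable {hl reps : List ℕ}

theorem hom_ext_z {R : Type*} [CommRing R] [Algebra ℚ R] {f g : K →+* R}
    (h : f (z K : K) = g (z K : K)) : f = g := by
  have : f.toRatAlgHom = g.toRatAlgHom := by
    apply ((IsCyclotomicExtension.zeta_spec 180 ℚ K).powerBasis ℚ).algHom_ext
    rw [IsPrimitiveRoot.powerBasis_gen]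
    exact h
  ext x
  exact DFunLike.congr_fun this x

theorem conj_emb (φ : K →+* ℂ) (x : K) : (starRingEnd ℂ) (φ x) = φ (s K 179 x) := by
  have : (starRingEnd ℂ).comp φ = φ.comp (s K 179 : K →+* K) := by
    apply hom_ext_z
    have h2 : s K 179 (z K : K) = (z K : K) ^ 179 := by
      have := congrArg (fun t : 𝓞 K => (t : K)) (s_z (K := K) (k := 179) (by decide))
      simpa [coe_gsmul] using this
    have h1 : (z K : K) ^ 180 = 1 := by
      have := congrArg (fun t : 𝓞 K => (t : K)) (z_pow (K := K))
      simpa using this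
    change (starRingEnd ℂ) (φ _) = φ (s K 179 (z K : K))
    rw [h2, map_pow]
    have h3 : φ (z K : K) ^ 180 = 1 := by rw [← map_pow, h1, map_one]
    have h4 : ‖φ (z K : K)‖ = 1 := Complex.norm_eq_one_of_pow_eq_one h3 (by norm_num)
    have h5 : φ (z K : K) ≠ 0 := by intro h; rw [h] at h4; simp at h4
    apply mul_left_cancel₀ h5
    rw [Complex.mul_conj, Complex.normSq_eq_norm_sq, h4, ← pow_succ', h3]
    simp
  exact DFunLike.congr_fun this x

theorem real_FF (d : HD hl reps) (h : 179 ∈ hl) : InfinitePlace.nrComplexPlaces (FF K d) = 0 := by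
  rw [nrComplexPlaces_eq_zero_iff, isTotallyReal_iff]
  intro v
  rw [← InfinitePlace.mk_embedding v, InfinitePlace.isReal_mk_iff]
  ext x
  obtain ⟨ψ, hψ⟩ : ∃ ψ : K →+* ℂ, ψ.comp (algebraMap (FF K d) K) = v.embedding :=
    ⟨ComplexEmbedding.lift K v.embedding, ComplexEmbedding.lift_comp_algebraMap K v.embedding⟩
  rw [← hψ]
  change (starRingEnd ℂ) (ψ x) = ψ x
  rw [conj_emb]
  congr 1
  have := x.2
  rw [IntermediateField.mem_fixedField_iff] at this
  apply this
  exact (mem_Hs d _).mpr ⟨179, h, rfl⟩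

theorem le_adj (d : HD hl reps) (m : ℕ) (hm : m ∣ 180)
    (hH : ∀ k < 180, k.Coprime 180 → k % m = 1 % m → k ∈ hl) :
    FF K d ≤ IntermediateField.adjoin ℚ {(z K : K) ^ (180 / m)} := by
  have : IsGalois ℚ K := IsCyclotomicExtension.isGalois {180} ℚ K
  rw [← IsGalois.fixedField_fixingSubgroup (IntermediateField.adjoin ℚ {(z K : K) ^ (180 / m)})]
  apply IntermediateField.fixedField_antitone
  intro g hg
  obtain ⟨k, hk, hc, rfl⟩ := gal_eq_s g
  refine (mem_Hs d _).mpr ⟨k, hH k hk hc ?_, rfl⟩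
  rw [IntermediateField.mem_fixingSubgroup_iff] at hg
  have := hg _ (IntermediateField.mem_adjoin_simple_self ℚ _)
  have h2 : s K k • (z K ^ (180 / m)) = z K ^ (180 / m) := by
    apply RingOfIntegers.coe_injective
    change s K k (algebraMap (𝓞 K) K (z K ^ (180 / m))) = algebraMap (𝓞 K) K (z K ^ (180 / m))
    rw [map_pow]
    exact this
  rw [smul_pow', s_z hc, ← pow_mul] at h2
  have h3 := z_pow_inj h2
  obtain ⟨c, hc'⟩ := hm
  have hc0 : 0 < c := by rcases Nat.eq_zero_or_pos c with rfl | h <;> omega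
  have hm0 : 0 < m := by rcases Nat.eq_zero_or_pos m with rfl | h <;> omega
  have h4 : 180 / m = c := by rw [hc']; exact Nat.mul_div_cancel_left _ hm0
  rw [h4] at h3
  rw [hc', Nat.mul_mod_mul_right] at h3
  have h5 : c % (m * c) = 1 * c % (m * c) := by rw [one_mul]
  rw [h5, Nat.mul_mod_mul_right] at h3
  exact Nat.eq_of_mul_eq_mul_right hc0 h3

theorem disc_dvd (d : HD hl reps) (m f : ℕ) [NeZero m] (hm : m ∣ 180)
    (hH : ∀ k < 180, k.Coprime 180 → k % m = 1 % m → k ∈ hl) (hf : Nat.totient m = reps.length * f) :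
    (discr (FF K d)).natAbs ^ f ∣ m ^ m.totient / ∏ p ∈ m.primeFactors, p ^ (m.totient / (p - 1)) := by
  have hle := le_adj (K := K) d m hm hH
  have hz : IsPrimitiveRoot ((z K : K) ^ (180 / m)) m := by
    have := (IsPrimitiveRoot.map_of_injective (z_prim (K := K))
      (RingOfIntegers.coe_injective (K := K)))
    exact this.pow (by norm_num) (Nat.div_mul_cancel hm).symm
  have hE := hz.intermediateField_adjoin_isCyclotomicExtension ℚ
  generalize IntermediateField.adjoin ℚ {(z K : K) ^ (180 / m)} = E at hle hE
  have hE2 : @IsCyclotomicExtension {m} ℚ E _ _ DivisionRing.toRatAlgebra := by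
    have e : @DivisionRing.toRatAlgebra E _ _ = IntermediateField.algebra' E := Subsingleton.elim _ _
    rw [e]; exact hE
  let _ : Algebra (FF K d) E := (IntermediateField.inclusion hle).toRingHom.toAlgebra
  have : IsScalarTower ℚ (FF K d) E := IsScalarTower.of_algebraMap_eq' (RingHom.ext fun x => rfl)
  have h1 := @IsCyclotomicExtension.Rat.natAbs_discr m E _ _ _ hE2
  have h2 := natAbs_discr_eq_absNorm_differentIdeal_mul_natAbs_discr_pow (FF K d) (𝓞 (FF K d)) E (𝓞 E)
  have h3 := Module.finrank_mul_finrank ℚ (FF K d) E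
  have h5 := @IsCyclotomicExtension.Rat.finrank m E _ _ _ hE2
  rw [degree_FF] at h3
  have h6 : reps.length * Module.finrank (FF K d) E = reps.length * f := by
    rw [h3, ← hf, ← h5]
  have h4 : 0 < reps.length := Nat.pos_of_mul_pos_right (d.len ▸ (by norm_num : 0 < 48))
  rw [Nat.eq_of_mul_eq_mul_left h4 h6, h1] at h2
  exact ⟨_, h2.trans (mul_comm _ _)⟩

theorem mink (P : Par) (g : Good P) (m f R D : ℕ) [NeZero m] (hm : m ∣ 180)
    (hH : ∀ k < 180, k.Coprime 180 → k % m = 1 % m → k ∈ P.hl)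
    (hf : Nat.totient m = P.reps.length * f)
    (hD : m ^ m.totient / ∏ p ∈ m.primeFactors, p ^ (m.totient / (p - 1)) = D) (hD0 : 0 < D)
    (hR : InfinitePlace.nrComplexPlaces (FF K g.d) ≤ R)
    (hnum : 4000000000 ^ (R * (2 * f)) * P.reps.length.factorial ^ (2 * f) * D <
      (P.B + 1) ^ (2 * f) * 3141592653 ^ (R * (2 * f)) * P.reps.length ^ (P.reps.length * (2 * f)))
    (c : ClassGroup (𝓞 (FF K g.d))) :
    ∃ I : (Ideal (𝓞 (FF K g.d)))⁰, ClassGroup.mk0 I = c ∧ Ideal.absNorm I.1 ≤ P.B := by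
  obtain ⟨I, h1, h2⟩ := exists_ideal_in_class_of_norm_le c
  refine ⟨I, h1, ?_⟩
  by_contra hlt
  push Not at hlt
  have hd := Nat.le_of_dvd (hD ▸ hD0) (disc_dvd (K := K) g.d m f hm hH hf)
  rw [hD] at hd
  have h4 : 0 < P.reps.length := Nat.pos_of_mul_pos_right (g.d.len ▸ (by norm_num : 0 < 48))
  set n := P.reps.length with hn
  have hpi : (4 / Real.pi) ^ InfinitePlace.nrComplexPlaces (FF K g.d) ≤ ((4000000000 : ℝ) / 3141592653) ^ R := by
    have : (4 / Real.pi) ≤ (4000000000 : ℝ) / 3141592653 := by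
      rw [div_le_div_iff₀ Real.pi_pos (by norm_num)]
      have := Real.pi_gt_d20
      linarith
    refine (pow_le_pow_left₀ (by positivity) this _).trans (pow_le_pow_right₀ (by norm_num) hR)
  rw [degree_FF, ← hn] at h2
  have h5 : ((P.B + 1 : ℕ) : ℝ) ≤ ((4000000000 : ℝ) / 3141592653) ^ R * ((n.factorial : ℝ) / n ^ n *
      √|(discr (FF K g.d) : ℝ)|) := by
    have : ((P.B + 1 : ℕ) : ℝ) ≤ (Ideal.absNorm I.1 : ℝ) := by
      exact_mod_cast hlt
    refine this.trans (h2.trans ?_)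
    gcongr
  have h6 := pow_le_pow_left₀ (by positivity) h5 (2 * f)
  have h7 : √|(discr (FF K g.d) : ℝ)| ^ (2 * f) ≤ D := by
    rw [pow_mul, Real.sq_sqrt (abs_nonneg _)]
    have : |(discr (FF K g.d) : ℝ)| = ((discr (FF K g.d)).natAbs : ℝ) := by
      rw [Nat.cast_natAbs]; push_cast; rfl
    rw [this]
    exact_mod_cast hd
  rw [mul_pow, mul_pow, ← pow_mul, div_pow, div_pow, ← pow_mul] at h6
  have h8 : ((P.B + 1 : ℕ) : ℝ) ^ (2 * f) ≤ 4000000000 ^ (R * (2 * f)) / 3141592653 ^ (R * (2 * f)) *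
    ((n.factorial : ℝ) ^ (2 * f) / n ^ (n * (2 * f)) * D) := h6.trans (by gcongr)
  have h9 : (4000000000 : ℝ) ^ (R * (2 * f)) / 3141592653 ^ (R * (2 * f)) *
    ((n.factorial : ℝ) ^ (2 * f) / n ^ (n * (2 * f)) * D) =
    (4000000000 ^ (R * (2 * f)) * n.factorial ^ (2 * f) * D) / (3141592653 ^ (R * (2 * f)) * n ^ (n * (2 * f))) := by
    field_simp
  rw [h9, le_div_iff₀ (by positivity)] at h8
  have h10 : (P.B + 1) ^ (2 * f) * (3141592653 ^ (R * (2 * f)) * n ^ (n * (2 * f))) ≤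
    4000000000 ^ (R * (2 * f)) * n.factorial ^ (2 * f) * D := by exact_mod_cast h8
  rw [← mul_assoc] at h10
  exact absurd h10 (not_le.mpr hnum)

theorem ncp_le (d : HD hl reps) : InfinitePlace.nrComplexPlaces (FF K d) ≤ reps.length / 2 := by
  have := InfinitePlace.card_add_two_mul_card_eq_rank (FF K d)
  rw [degree_FF] at this
  omega

theorem d180 : 180 ^ (Nat.totient 180) / ∏ p ∈ (180 : ℕ).primeFactors, p ^ ((Nat.totient 180) / (p - 1))
    = 2 ^ 48 * 3 ^ 72 * 5 ^ 36 := by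
  have h1 : Nat.totient 180 = 48 := by decide +kernel
  have h2 : (180 : ℕ).primeFactors = {2, 3, 5} := by decide +kernel
  rw [h1, h2]; decide +kernel

theorem d45 : 45 ^ (Nat.totient 45) / ∏ p ∈ (45 : ℕ).primeFactors, p ^ ((Nat.totient 45) / (p - 1))
    = 3 ^ 36 * 5 ^ 18 := by
  have h1 : Nat.totient 45 = 24 := by decide +kernel
  have h2 : (45 : ℕ).primeFactors = {3, 5} := by decide +kernel
  rw [h1, h2]; decide +kernel

theorem d36 : 36 ^ (Nat.totient 36) / ∏ p ∈ (36 : ℕ).primeFactors, p ^ ((Nat.totient 36) / (p - 1))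
    = 2 ^ 12 * 3 ^ 18 := by
  have h1 : Nat.totient 36 = 12 := by decide +kernel
  have h2 : (36 : ℕ).primeFactors = {2, 3} := by decide +kernel
  rw [h1, h2]; decide +kernel

theorem mk_36 (c : ClassGroup (𝓞 (FF K P36_good.d))) :
    ∃ I : (Ideal (𝓞 (FF K P36_good.d)))⁰, ClassGroup.mk0 I = c ∧ Ideal.absNorm I.1 ≤ P36.B :=
  mink P36 P36_good 36 1 6 _ (by decide) (by decide +kernel) (by decide +kernel) d36 (by decide +kernel)
    (ncp_le _) (by decide +kernel) c

theorem mk_F5 (c : ClassGroup (𝓞 (FF K PF5_good.d))) :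
    ∃ I : (Ideal (𝓞 (FF K PF5_good.d)))⁰, ClassGroup.mk0 I = c ∧ Ideal.absNorm I.1 ≤ PF5.B :=
  mink PF5 PF5_good 45 2 6 _ (by decide) (by decide +kernel) (by decide +kernel) d45 (by decide +kernel)
    (ncp_le _) (by decide +kernel) c

theorem mk_F15 (c : ClassGroup (𝓞 (FF K PF15_good.d))) :
    ∃ I : (Ideal (𝓞 (FF K PF15_good.d)))⁰, ClassGroup.mk0 I = c ∧ Ideal.absNorm I.1 ≤ PF15.B :=
  mink PF15 PF15_good 45 2 0 _ (by decide) (by decide +kernel) (by decide +kernel) d45 (by decide +kernel)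
    (real_FF _ (by decide +kernel)).le (by decide +kernel) c

theorem mk_F20 (c : ClassGroup (𝓞 (FF K PF20_good.d))) :
    ∃ I : (Ideal (𝓞 (FF K PF20_good.d)))⁰, ClassGroup.mk0 I = c ∧ Ideal.absNorm I.1 ≤ PF20.B :=
  mink PF20 PF20_good 180 4 0 _ (by decide) (by decide +kernel) (by decide +kernel) d180 (by decide +kernel)
    (real_FF _ (by decide +kernel)).le (by decide +kernel) c

theorem mk_F60 (c : ClassGroup (𝓞 (FF K PF60_good.d))) :
    ∃ I : (Ideal (𝓞 (FF K PF60_good.d)))⁰, ClassGroup.mk0 I = c ∧ Ideal.absNorm I.1 ≤ PF60.B :=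
  mink PF60 PF60_good 180 4 6 _ (by decide) (by decide +kernel) (by decide +kernel) d180 (by decide +kernel)
    (ncp_le _) (by decide +kernel) c

theorem mk_m20 (c : ClassGroup (𝓞 (FF K Pm20_good.d))) :
    ∃ I : (Ideal (𝓞 (FF K Pm20_good.d)))⁰, ClassGroup.mk0 I = c ∧ Ideal.absNorm I.1 ≤ Pm20.B :=
  mink Pm20 Pm20_good 180 8 3 _ (by decide) (by decide +kernel) (by decide +kernel) d180 (by decide +kernel)
    (ncp_le _) (by decide +kernel) c

theorem mk_m15 (c : ClassGroup (𝓞 (FF K Pm15_good.d))) :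
    ∃ I : (Ideal (𝓞 (FF K Pm15_good.d)))⁰, ClassGroup.mk0 I = c ∧ Ideal.absNorm I.1 ≤ Pm15.B :=
  mink Pm15 Pm15_good 45 4 3 _ (by decide) (by decide +kernel) (by decide +kernel) d45 (by decide +kernel)
    (ncp_le _) (by decide +kernel) c

theorem mk_60 (c : ClassGroup (𝓞 (FF K P60_good.d))) :
    ∃ I : (Ideal (𝓞 (FF K P60_good.d)))⁰, ClassGroup.mk0 I = c ∧ Ideal.absNorm I.1 ≤ P60.B :=
  mink P60 P60_good 180 8 0 _ (by decide) (by decide +kernel) (by decide +kernel) d180 (by decide +kernel)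
    (real_FF _ (by decide +kernel)).le (by decide +kernel) c

end mink
end C180
end

section
open NumberField Polynomial
open scoped Pointwise nonZeroDivisors

namespace C180

section cls
variable {R : Type*} [CommRing R] [IsDedekindDomain R]

open Classical in
/-- class of an ideal -/
noncomputable def cl (I : Ideal R) : ClassGroup R :=
  if h : I ≠ ⊥ then ClassGroup.mk0 ⟨I, mem_nonZeroDivisors_iff_ne_zero.mpr h⟩ else 1

theorem cl_of {I : Ideal R} (h : I ≠ ⊥) :
    cl I = ClassGroup.mk0 ⟨I, mem_nonZeroDivisors_iff_ne_zero.mpr h⟩ := dif_pos h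

theorem cl_mul {I J : Ideal R} (hI : I ≠ ⊥) (hJ : J ≠ ⊥) : cl (I * J) = cl I * cl J := by
  rw [cl_of hI, cl_of hJ, cl_of (mul_ne_zero hI hJ), ← map_mul]
  rfl

theorem cl_top : cl (⊤ : Ideal R) = 1 := by
  have := cl_mul (R := R) (I := ⊤) (J := ⊤) top_ne_bot top_ne_bot
  rw [← Ideal.one_eq_top, one_mul] at *
  exact left_eq_mul.mp this

theorem cl_pow {I : Ideal R} (hI : I ≠ ⊥) (n : ℕ) : cl (I ^ n) = cl I ^ n := by
  induction n with
  | zero => rw [pow_zero, pow_zero, Ideal.one_eq_top, cl_top]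
  | succ n ih => rw [pow_succ, pow_succ, cl_mul (pow_ne_zero n hI) hI, ih]

theorem cl_prod (l : List (Ideal R)) (h : ∀ I ∈ l, I ≠ ⊥) : cl l.prod = (l.map cl).prod ∧ l.prod ≠ ⊥ := by
  induction l with
  | nil => simp [cl_top, Ideal.one_eq_top]
  | cons a l ih =>
    obtain ⟨h1, h2⟩ := ih fun I hI => h I (List.mem_cons_of_mem _ hI)
    have h3 := h a List.mem_cons_self
    rw [List.prod_cons, List.map_cons, List.prod_cons, cl_mul h3 h2, h1]
    exact ⟨rfl, mul_ne_zero h3 h2⟩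

theorem cl_eq_one {I : Ideal R} (hI : I ≠ ⊥) : cl I = 1 ↔ ∃ x, x ≠ 0 ∧ I = Ideal.span {x} := by
  rw [cl_of hI, ClassGroup.mk0_eq_one_iff]
  constructor
  · intro h
    obtain ⟨x, hx⟩ := h
    refine ⟨x, ?_, hx⟩
    rintro rfl
    apply hI
    change I = _ at hx
    rw [hx]
    simp
  · rintro ⟨x, -, hx⟩
    exact ⟨x, hx⟩

theorem cl_span (x : R) : cl (Ideal.span {x}) = 1 := by
  by_cases h : x = 0
  · rw [cl, dif_neg]
    simp [h]
  · exact (cl_eq_one (by simpa using h)).mpr ⟨x, h, rfl⟩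

theorem cl_surj (c : ClassGroup R) : ∃ I : Ideal R, I ≠ ⊥ ∧ cl I = c := by
  obtain ⟨I, rfl⟩ := ClassGroup.mk0_surjective c
  have : I.1 ≠ ⊥ := mem_nonZeroDivisors_iff_ne_zero.mp I.2
  exact ⟨I.1, this, by rw [cl_of this]⟩

theorem goodFam_cl (S : Subgroup (ClassGroup R)) : GoodFam (fun I : Ideal R => cl I ∈ S) where
  pr x _ := by rw [cl_span]; exact S.one_mem
  mul I J hI hJ h1 h2 := by rw [cl_mul hI hJ]; exact S.mul_mem h1 h2
  can I J hI hJ h1 h2 := by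
    rw [cl_mul hI hJ] at h1
    exact (S.mul_mem_cancel_left h2).mp h1

theorem goodFam_map {A : Type*} [CommRing A] [IsDomain A] (f : A →+* R) (hf : Function.Injective f)
    (S : Subgroup (ClassGroup R)) : GoodFam (fun I : Ideal A => cl (I.map f) ∈ S) where
  pr x _ := by rw [Ideal.map_span, Set.image_singleton, cl_span]; exact S.one_mem
  mul I J hI hJ h1 h2 := by
    rw [Ideal.map_mul]
    exact (goodFam_cl S).mul _ _ (by simpa [Ideal.map_eq_bot_iff_of_injective hf] using hI)
      (by simpa [Ideal.map_eq_bot_iff_of_injective hf] using hJ) h1 h2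
  can I J hI hJ h1 h2 := by
    rw [Ideal.map_mul] at h1
    exact (goodFam_cl S).can _ _ (by simpa [Ideal.map_eq_bot_iff_of_injective hf] using hI)
      (by simpa [Ideal.map_eq_bot_iff_of_injective hf] using hJ) h1 h2

end cls

section nrms
variable {K : Type*} [Field K] [NumberField K]

theorem absNorm_gsmul (g : Gal(K/ℚ)) (I : Ideal (𝓞 K)) : Ideal.absNorm (g • I) = Ideal.absNorm I := by
  rw [Ideal.absNorm_apply, Ideal.absNorm_apply, Submodule.cardQuot_apply, Submodule.cardQuot_apply]
  refine (Nat.card_congr (Ideal.quotientEquiv I (g • I) (MulSemiringAction.toRingEquiv _ (𝓞 K) g) ?_).toEquiv).symm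
  rfl

theorem gsmul_ne_bot (g : Gal(K/ℚ)) {I : Ideal (𝓞 K)} (h : I ≠ ⊥) : g • I ≠ ⊥ := by
  intro hc
  apply h
  rw [← Ideal.absNorm_eq_zero_iff, ← absNorm_gsmul g, hc, Ideal.absNorm_bot]

theorem eq_of_le_of_norm {I J : Ideal (𝓞 K)} (hI : I ≠ ⊥) (h : J ≤ I) (hn : Ideal.absNorm J = Ideal.absNorm I) :
    J = I := by
  obtain ⟨Q, rfl⟩ := Ideal.dvd_iff_le.mpr h
  rw [map_mul] at hn
  have h0 : Ideal.absNorm I ≠ 0 := by rwa [Ne, Ideal.absNorm_eq_zero_iff]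
  have : Ideal.absNorm Q = 1 := by
    apply Nat.eq_of_mul_eq_mul_left (Nat.pos_of_ne_zero h0)
    rw [hn, mul_one]
  rw [Ideal.absNorm_eq_one_iff.mp this, Ideal.mul_top]

variable [hK : IsCyclotomicExtension {180} ℚ K]
variable {hl reps : List ℕ}

theorem alg_inj (d : HD hl reps) : Function.Injective (algebraMap (𝓞 (FF K d)) (𝓞 K)) :=
  FaithfulSMul.algebraMap_injective _ _

theorem prod_mem_prod (I : Ideal (𝓞 K)) (x : 𝓞 K) (hx : x ∈ I) (l : List ℕ) :
    (l.map fun h => s K h • x).prod ∈ (l.map fun h => s K h • I).prod := by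
  induction l with
  | nil => simp
  | cons a l ih =>
    rw [List.map_cons, List.map_cons, List.prod_cons, List.prod_cons]
    exact Ideal.mul_mem_mul (Ideal.smul_mem_pointwise_smul _ _ _ hx) ih

theorem norm_H (d : HD hl reps) (I : Ideal (𝓞 K)) (hI : I ≠ ⊥) :
    ∃ J : Ideal (𝓞 (FF K d)), J ≠ ⊥ ∧ J.map (algebraMap (𝓞 (FF K d)) (𝓞 K)) =
      (hl.map fun h => s K h • I).prod := by
  have : IsGalois (FF K d) K := by
    have : IsGalois ℚ K := IsCyclotomicExtension.isGalois {180} ℚ K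
    infer_instance
  refine ⟨Ideal.relNorm _ I, by rwa [Ne, Ideal.relNorm_eq_bot_iff], ?_⟩
  have hn := (cl_prod (hl.map fun h => s K h • I) (by
      intro J hJ
      obtain ⟨h, -, rfl⟩ := List.mem_map.mp hJ
      exact gsmul_ne_bot _ hI)).2
  apply eq_of_le_of_norm hn
  · rw [Ideal.map_relNorm, Ideal.span_le]
    rintro _ ⟨x, hx, rfl⟩
    have e : (algebraMap (𝓞 (FF K d)) (𝓞 K)) (Algebra.intNorm (𝓞 (FF K d)) (𝓞 K) x) =
        (hl.map fun h => s K h • x).prod := by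
      rw [← prod_Hs (K := K) d (fun g => g • x)]
      apply RingOfIntegers.coe_injective
      rw [← IsScalarTower.algebraMap_apply, IsScalarTower.algebraMap_apply (𝓞 (FF K d)) (FF K d) K,
        Algebra.algebraMap_intNorm (L := K), Algebra.norm_eq_prod_automorphisms, map_prod]
      refine (Fintype.prod_equiv (IntermediateField.subgroupEquivAlgEquiv (Hs K d)).toEquiv _ _ ?_).symm
      intro g
      rfl
    change (algebraMap (𝓞 (FF K d)) (𝓞 K)) (Algebra.intNorm (𝓞 (FF K d)) (𝓞 K) x) ∈ _
    rw [e]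
    exact prod_mem_prod I x hx hl
  · rw [absNorm_map, Ideal.absNorm_relNorm, map_list_prod, List.map_map]
    have : ((Ideal.absNorm : Ideal (𝓞 K) →*₀ ℕ) ∘ fun h => s K h • I) = fun _ => Ideal.absNorm I := by
      ext h
      exact absNorm_gsmul _ _
    rw [this, List.map_const', List.prod_replicate]

theorem nrm_mem (P : Par) (g : Good P) (S : Subgroup (ClassGroup (𝓞 K)))
    (hC : ∀ Q : Ideal (𝓞 (FF K g.d)), Q.IsPrime → Q ≠ ⊥ → (P.C : 𝓞 (FF K g.d)) ∈ Q →
      cl (Q.map (algebraMap (𝓞 (FF K g.d)) (𝓞 K))) ∈ S)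
    (hB : ∀ c : ClassGroup (𝓞 (FF K g.d)), ∃ I : (Ideal (𝓞 (FF K g.d)))⁰, ClassGroup.mk0 I = c ∧
      Ideal.absNorm I.1 ≤ P.B) (I : Ideal (𝓞 K)) (hI : I ≠ ⊥) :
    (P.hl.map fun h => cl (s K h • I)).prod ∈ S := by
  obtain ⟨J, hJ, e⟩ := norm_H g.d I hI
  have := all_good P g _ (goodFam_map _ (alg_inj (K := K) g.d) S) hC hB J hJ
  rw [e, (cl_prod _ _).1, List.map_map] at this
  · exact this
  · intro J hJ
    obtain ⟨h, -, rfl⟩ := List.mem_map.mp hJ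
    exact gsmul_ne_bot _ hI

/-- the ring of integers of the field `F15` is a PID -/
theorem F15_pid (I : Ideal (𝓞 (FF K PF15_good.d))) (hI : I ≠ ⊥) : cl I = 1 := by
  have := all_good PF15 (PF15_good) _ (goodFam_cl (⊥ : Subgroup (ClassGroup (𝓞 (FF K PF15_good.d))))) ?_
    mk_F15 I hI
  · simpa using this
  · intro Q hQ _ h
    have : ((PF15.C : ℕ) : 𝓞 (FF K PF15_good.d)) = 1 := Nat.cast_one
    rw [this] at h
    exact absurd ((Ideal.eq_top_iff_one Q).mpr h) hQ.ne_top

theorem map_mem_of_primes (S : Subgroup (ClassGroup (𝓞 K))) (n : ℕ)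
    (h : ∀ Q : Ideal (𝓞 K), Q.IsPrime → Q ≠ ⊥ → (n : 𝓞 K) ∈ Q → cl Q ∈ S) (d : HD hl reps)
    (Q : Ideal (𝓞 (FF K d))) (hQ : Q ≠ ⊥) (hn : (n : 𝓞 (FF K d)) ∈ Q) :
    cl (Q.map (algebraMap (𝓞 (FF K d)) (𝓞 K))) ∈ S := by
  apply good_of_primes (goodFam_cl S) _
    (by simpa [Ideal.map_eq_bot_iff_of_injective (alg_inj (K := K) d)] using hQ)
  intro Q' h1 h2 h3
  apply h Q' h1 h2
  have := h3 (Ideal.mem_map_of_mem _ hn)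
  rwa [map_natCast] at this

theorem grp_mem {A : Type*} [CommGroup A] (S : Subgroup A) (a : ℕ → A)
    (h36 : a 1 * (a 37 * (a 73 * a 109)) ∈ S)
    (hF5 : a 1 * (a 71 * (a 91 * a 161)) ∈ S)
    (hF15 : a 1 * (a 89 * (a 91 * a 179)) ∈ S)
    (hF20 : a 1 * (a 19 * (a 161 * a 179)) ∈ S)
    (hF60 : a 1 * (a 19 * (a 71 * a 89)) ∈ S)
    (hm20 : a 1 * (a 89 * (a 107 * (a 109 * (a 127 * (a 143 * (a 161 * a 163)))))) ∈ S)
    (hm15 : a 1 * (a 17 * (a 19 * (a 53 * (a 91 * (a 107 * (a 109 * a 143)))))) ∈ S)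
    (h60 : a 1 * (a 17 * (a 53 * (a 71 * (a 109 * (a 127 * (a 163 * a 179)))))) ∈ S)
    (hb : a 19 * (a 71 * (a 109 * a 161)) ∈ S)
    (hc : a 17 * (a 73 * (a 107 * a 163)) ∈ S)
    (hd : a 143 * (a 127 * (a 53 * a 37)) ∈ S) : a 1 ^ 16 ∈ S := by
  have e : a 1 ^ 16 * ((a 1 * (a 89 * (a 91 * a 179))) ^ 10 * (a 19 * (a 71 * (a 109 * a 161))) ^ 10 * (a 17 * (a 73 * (a 107 * a 163))) ^ 4 * (a 143 * (a 127 * (a 53 * a 37))) ^ 4) = (a 1 * (a 37 * (a 73 * a 109))) ^ 4 * (a 1 * (a 71 * (a 91 * a 161))) ^ 4 * (a 1 * (a 89 * (a 91 * a 179))) ^ 4 * (a 1 * (a 19 * (a 161 * a 179))) ^ 4 * (a 1 * (a 19 * (a 71 * a 89))) ^ 4 *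
      (a 1 * (a 89 * (a 107 * (a 109 * (a 127 * (a 143 * (a 161 * a 163))))))) ^ 2 * (a 1 * (a 17 * (a 19 * (a 53 * (a 91 * (a 107 * (a 109 * a 143))))))) ^ 2 * (a 1 * (a 17 * (a 53 * (a 71 * (a 109 * (a 127 * (a 163 * a 179))))))) ^ 2 := by
    apply Additive.ofMul.injective
    simp only [ofMul_mul, ofMul_pow]
    abel
  have hD : ((a 1 * (a 89 * (a 91 * a 179))) ^ 10 * (a 19 * (a 71 * (a 109 * a 161))) ^ 10 * (a 17 * (a 73 * (a 107 * a 163))) ^ 4 * (a 143 * (a 127 * (a 53 * a 37))) ^ 4) ∈ S := mul_mem (mul_mem (mul_mem (pow_mem hF15 _) (pow_mem hb _)) (pow_mem hc _)) (pow_mem hd _)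
  rw [← S.mul_mem_cancel_right hD, e]
  exact mul_mem (mul_mem (mul_mem (mul_mem (mul_mem (mul_mem (mul_mem (pow_mem h36 _) (pow_mem hF5 _)) (pow_mem hF15 _))
    (pow_mem hF20 _)) (pow_mem hF60 _)) (pow_mem hm20 _)) (pow_mem hm15 _)) (pow_mem h60 _)

theorem top_of_mem (S : Subgroup (ClassGroup (𝓞 K)))
    (hodd : (Nat.card (ClassGroup (𝓞 K))).Coprime 2)
    (h30 : ∀ Q : Ideal (𝓞 K), Q.IsPrime → Q ≠ ⊥ → ((30 : ℕ) : 𝓞 K) ∈ Q → cl Q ∈ S)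
    (h181 : ∀ Q : Ideal (𝓞 (FF K PF60_good.d)), Q.IsPrime → Q ≠ ⊥ →
      ((181 : ℕ) : 𝓞 (FF K PF60_good.d)) ∈ Q → cl (Q.map (algebraMap _ (𝓞 K))) ∈ S) : S = ⊤ := by
  rw [eq_top_iff]
  rintro c -
  obtain ⟨I, hI, rfl⟩ := cl_surj c
  have m36 := nrm_mem P36 P36_good S (fun Q _ h => map_mem_of_primes S 30 h30 _ Q h) mk_36
  have mF5 := nrm_mem PF5 PF5_good S (fun Q _ h => map_mem_of_primes S 30 h30 _ Q h) mk_F5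
  have mF20 := nrm_mem PF20 PF20_good S (fun Q _ h => map_mem_of_primes S 30 h30 _ Q h) mk_F20
  have mm20 := nrm_mem Pm20 Pm20_good S (fun Q _ h => map_mem_of_primes S 30 h30 _ Q h) mk_m20
  have mm15 := nrm_mem Pm15 Pm15_good S (fun Q _ h => map_mem_of_primes S 30 h30 _ Q h) mk_m15
  have m60 := nrm_mem P60 P60_good S (fun Q _ h => map_mem_of_primes S 30 h30 _ Q h) mk_60
  have mF15 := nrm_mem PF15 PF15_good S (fun Q hQ _ h => by
    have e : ((PF15.C : ℕ) : 𝓞 (FF K PF15_good.d)) = 1 := Nat.cast_one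
    rw [e] at h
    exact absurd ((Ideal.eq_top_iff_one Q).mpr h) hQ.ne_top) mk_F15
  have mF60 := nrm_mem PF60 PF60_good S (fun Q hQ h0 h => by
    have e : ((PF60.C : ℕ) : 𝓞 (FF K PF60_good.d)) = ((30 : ℕ) : 𝓞 (FF K PF60_good.d)) * ((181 : ℕ) : 𝓞 (FF K PF60_good.d)) := by
      rw [← Nat.cast_mul]; rfl
    rw [e] at h
    rcases hQ.mem_or_mem h with h | h
    · exact map_mem_of_primes S 30 h30 _ Q h0 h
    · exact h181 Q hQ h0 h) mk_F60
  have sm : ∀ a b c : ℕ, a.Coprime 180 → b.Coprime 180 → a * b % 180 = c % 180 →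
      cl (s K a • s K b • I) = cl (s K c • I) := by
    intro a b c ha hb h
    rw [smul_smul, s_mul ha hb, s_congr (Nat.Coprime.mul_left ha hb) h]
  have h16 : cl (s K 1 • I) ^ 16 ∈ S := by
    have n36 := m36 I hI
    have nF5 := mF5 I hI
    have nF20 := mF20 I hI
    have nm20 := mm20 I hI
    have nm15 := mm15 I hI
    have n60 := m60 I hI
    have nF60 := mF60 I hI
    have nF15 := mF15 I hI
    have nF15b := mF15 _ (gsmul_ne_bot (s K 19) hI)
    have nF15c := mF15 _ (gsmul_ne_bot (s K 17) hI)
    have nF15d := mF15 _ (gsmul_ne_bot (s K 143) hI)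
    simp only [P36, PF5, PF15, PF20, PF60, Pm20, Pm15, P60, List.map_cons, List.map_nil, List.prod_cons,
      List.prod_nil, mul_one] at n36 nF5 nF20 nm20 nm15 n60 nF60 nF15 nF15b nF15c nF15d
    rw [sm 1 19 19 (by decide) (by decide) (by decide), sm 89 19 71 (by decide) (by decide) (by decide),
      sm 91 19 109 (by decide) (by decide) (by decide), sm 179 19 161 (by decide) (by decide) (by decide)] at nF15b
    rw [sm 1 17 17 (by decide) (by decide) (by decide), sm 89 17 73 (by decide) (by decide) (by decide),
      sm 91 17 107 (by decide) (by decide) (by decide), sm 179 17 163 (by decide) (by decide) (by decide)] at nF15c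
    rw [sm 1 143 143 (by decide) (by decide) (by decide), sm 89 143 127 (by decide) (by decide) (by decide),
      sm 91 143 53 (by decide) (by decide) (by decide), sm 179 143 37 (by decide) (by decide) (by decide)] at nF15d
    exact grp_mem S (fun k => cl (s K k • I)) n36 nF5 nF15 nF20 nF60 nm20 nm15 n60 nF15b nF15c nF15d
  rw [s_one, one_smul] at h16
  have hc : (Nat.card (ClassGroup (𝓞 K))).Coprime 16 := Nat.Coprime.pow_right 4 hodd
  have h1 := orderOf_dvd_natCard (cl I)
  have h2 : (16 : ℕ).Coprime (orderOf (cl I)) := (Nat.Coprime.coprime_dvd_left h1 hc).symm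
  obtain ⟨m, hm⟩ := exists_pow_eq_self_of_coprime h2
  rw [← hm]
  exact S.pow_mem h16 m

end nrms
end C180
end

section
open NumberField Polynomial
open scoped Pointwise nonZeroDivisors

namespace C180

section lemD
variable {O : Type*} [CommRing O] [IsDedekindDomain O]

theorem cl_eq_cl {I J : Ideal O} (hI : I ≠ ⊥) (hJ : J ≠ ⊥) (h : cl I = cl J) :
    ∃ x y : O, x ≠ 0 ∧ y ≠ 0 ∧ Ideal.span {x} * I = Ideal.span {y} * J := by
  have h1 : cl I = ClassGroup.mk0 ⟨I, mem_nonZeroDivisors_of_ne_zero hI⟩ := cl_of hI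
  have h2 : cl J = ClassGroup.mk0 ⟨J, mem_nonZeroDivisors_of_ne_zero hJ⟩ := cl_of hJ
  rw [h1, h2, ClassGroup.mk0_eq_mk0_iff] at h
  obtain ⟨x, y, hx, hy, e⟩ := h
  exact ⟨x, y, hx, hy, e⟩

theorem eq_one_of_odd {G : Type*} [Group G] {c : G} {n : ℕ} (hn : Odd n) (h : c ^ n = 1)
    (h2 : c ^ 2 = 1) : c = 1 := by
  obtain ⟨k, rfl⟩ := hn
  rw [pow_add, pow_mul, h2, one_pow, one_mul, pow_one] at h
  exact h

theorem lemD (τ : O →+* O) (hτ : ∀ x, τ (τ x) = x)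
    (hU : ∀ u a b : O, IsUnit u → a ≠ 0 → u * (a * τ a) = b * τ b →
      ∃ w, IsUnit w ∧ u = w * τ w)
    (hInv : ∀ I : Ideal O, I ≠ ⊥ → (∀ x ∈ I, τ x ∈ I) → ∃ n, Odd n ∧ cl I ^ n = 1)
    (c : ClassGroup O) (hc : c ^ 2 = 1) : c = 1 := by
  have hinj : Function.Injective τ := fun x y h => by rw [← hτ x, h, hτ]
  have hmap0 : ∀ I : Ideal O, I ≠ ⊥ → I.map τ ≠ ⊥ := fun I hI h =>
    hI ((Ideal.map_eq_bot_iff_of_injective hinj).mp h)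
  have hmm : ∀ I : Ideal O, (I.map τ).map τ = I := fun I => by
    rw [Ideal.map_map]
    have : τ.comp τ = RingHom.id O := RingHom.ext hτ
    rw [this, Ideal.map_id]
  have hsp : ∀ x : O, (Ideal.span {x}).map τ = Ideal.span {τ x} := fun x => by
    rw [Ideal.map_span, Set.image_singleton]
  have hInv' : ∀ I : Ideal O, I ≠ ⊥ → I.map τ = I → ∃ n, Odd n ∧ cl I ^ n = 1 := fun I h0 h =>
    hInv I h0 (fun x hx => by rw [← h]; exact Ideal.mem_map_of_mem _ hx)
  have hs0 : ∀ x : O, x ≠ 0 → Ideal.span {x} ≠ ⊥ := fun x hx h =>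
    hx (Ideal.span_singleton_eq_bot.mp h)
  obtain ⟨I, hI, rfl⟩ := cl_surj c
  obtain ⟨J, hJd⟩ : ∃ J, J = I.map τ := ⟨_, rfl⟩
  have hJ : J ≠ ⊥ := hJd ▸ hmap0 I hI
  have hJt : J.map τ = I := hJd ▸ hmm I
  have hJ2 : cl J ^ 2 = 1 := by
    rw [← cl_pow hI, cl_eq_one (pow_ne_zero 2 hI)] at hc
    obtain ⟨x, hx, e⟩ := hc
    rw [← cl_pow hJ, cl_eq_one (pow_ne_zero 2 hJ)]
    refine ⟨τ x, fun h => hx (hinj (by rw [h, map_zero])), ?_⟩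
    rw [hJd, ← Ideal.map_pow, e, hsp]
  have h1 : cl I * cl J = 1 := by
    obtain ⟨n, hn, e⟩ := hInv' (I * J) (mul_ne_zero hI hJ) (by
      rw [Ideal.map_mul, hJt, ← hJd, mul_comm])
    rw [← cl_mul hI hJ]
    refine eq_one_of_odd hn e ?_
    rw [cl_mul hI hJ, mul_pow, hc, hJ2, one_mul]
  have h2 : cl J = cl I := by
    have : cl I * cl I = 1 := by rw [← sq, hc]
    exact mul_left_cancel (h1.trans this.symm)
  obtain ⟨a, b, ha, hb, e⟩ := cl_eq_cl hJ hI h2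
  have e' := congrArg (Ideal.map τ) e
  rw [Ideal.map_mul, Ideal.map_mul, hsp, hsp, hJt, ← hJd] at e'
  have e2 : Ideal.span {a * τ a} = Ideal.span {b * τ b} := by
    rw [← Ideal.span_singleton_mul_span_singleton, ← Ideal.span_singleton_mul_span_singleton]
    apply mul_right_cancel₀ (mul_ne_zero hI hJ)
    calc _ = (Ideal.span {a} * J) * (Ideal.span {τ a} * I) := by ring
      _ = (Ideal.span {b} * I) * (Ideal.span {τ b} * J) := by rw [e, e']
      _ = _ := by ring
  rw [Ideal.span_singleton_eq_span_singleton] at e2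
  obtain ⟨u, hu⟩ := e2
  obtain ⟨w, hw, huw⟩ := hU u a b u.isUnit ha (by rw [← hu]; ring)
  obtain ⟨A, hA⟩ : ∃ A, A = a * w := ⟨_, rfl⟩
  have hA0 : A ≠ 0 := hA ▸ mul_ne_zero ha hw.ne_zero
  have hAs : Ideal.span {A} = Ideal.span {a} := by
    rw [hA]; exact Ideal.span_singleton_mul_right_unit hw a
  rw [← hAs] at e
  have hN : A * τ A = b * τ b := by rw [hA, map_mul, ← hu, huw]; ring
  by_cases hAb : A + b = 0
  · have : Ideal.span {A} = Ideal.span {b} := by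
      rw [show A = -b by linear_combination hAb, Ideal.span_singleton_neg]
    rw [this] at e
    have e3 : J = I := mul_left_cancel₀ (hs0 b hb) e
    obtain ⟨n, hn, h⟩ := hInv' I hI (by rw [← hJd, e3])
    exact eq_one_of_odd hn h hc
  · obtain ⟨D, hD⟩ : ∃ D, D = τ b * (A + b) := ⟨_, rfl⟩
    have htb : τ b ≠ 0 := fun h => hb (hinj (by rw [h, map_zero]))
    have hD0 : D ≠ 0 := hD ▸ mul_ne_zero htb hAb
    have htD0 : τ D ≠ 0 := fun h => hD0 (hinj (by rw [h, map_zero]))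
    have hbD : b * D = A * τ D := by
      rw [hD, map_mul, hτ, map_add]; linear_combination (-b) * hN
    have e3 : Ideal.span {D} * J = Ideal.span {τ D} * I := by
      apply mul_left_cancel₀ (hs0 A hA0)
      calc _ = Ideal.span {D} * (Ideal.span {A} * J) := by ring
        _ = (Ideal.span {b} * Ideal.span {D}) * I := by rw [e]; ring
        _ = (Ideal.span {A} * Ideal.span {τ D}) * I := by
          rw [Ideal.span_singleton_mul_span_singleton, hbD,
            Ideal.span_singleton_mul_span_singleton]
        _ = _ := by ring
    obtain ⟨n, hn, h⟩ := hInv' (Ideal.span {τ D} * I) (mul_ne_zero (hs0 _ htD0) hI) (by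
      rw [Ideal.map_mul, hsp, hτ, ← hJd, e3])
    rw [cl_mul (hs0 _ htD0) hI, cl_span, one_mul] at h
    exact eq_one_of_odd hn h hc

theorem coprime_two_of (G : Type*) [Group G] [Finite G] (h : ∀ c : G, c ^ 2 = 1 → c = 1) :
    (Nat.card G).Coprime 2 := by
  rw [Nat.coprime_comm, Nat.Prime.coprime_iff_not_dvd Nat.prime_two]
  intro hd
  obtain ⟨x, hx⟩ := exists_prime_orderOf_dvd_card' (G := G) 2 hd
  have := h x (hx ▸ pow_orderOf_eq_one x)
  rw [this, orderOf_one] at hx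
  omega

end lemD

section lift
variable {K : Type*} [Field K] [NumberField K] [hK : IsCyclotomicExtension {180} ℚ K]
variable {hl reps : List ℕ}

/-- lift of a ring hom into the fixed ring -/
noncomputable def lft (d : HD hl reps) {A : Type*} [CommRing A] (f : A →+* 𝓞 K)
    (hf : ∀ a, ∀ g ∈ Hs K d, g • f a = f a) : A →+* 𝓞 (FF K d) :=
  have spec : ∀ a, algebraMap (𝓞 (FF K d)) (𝓞 K) (Classical.choose (exists_of_fixed d (f a) (hf a)))
    = f a := fun a => Classical.choose_spec (exists_of_fixed d (f a) (hf a))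
  { toFun := fun a => Classical.choose (exists_of_fixed d (f a) (hf a))
    map_one' := alg_inj d (by rw [spec, map_one, map_one])
    map_mul' := fun x y => alg_inj d (by rw [spec, map_mul, map_mul, spec, spec])
    map_zero' := alg_inj d (by rw [spec, map_zero, map_zero])
    map_add' := fun x y => alg_inj d (by rw [spec, map_add, map_add, spec, spec]) }

theorem lft_spec (d : HD hl reps) {A : Type*} [CommRing A] (f : A →+* 𝓞 K)
    (hf : ∀ a, ∀ g ∈ Hs K d, g • f a = f a) (a : A) :
    algebraMap (𝓞 (FF K d)) (𝓞 K) (lft d f hf a) = f a :=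
  Classical.choose_spec (exists_of_fixed d (f a) (hf a))

theorem gal_comm (g h : Gal(K/ℚ)) : g * h = h * g := by
  obtain ⟨a, -, ha, rfl⟩ := gal_eq_s g
  obtain ⟨b, -, hb, rfl⟩ := gal_eq_s h
  rw [s_mul ha hb, s_mul hb ha, mul_comm]

/-- Galois action on the fixed ring -/
noncomputable def gF (d : HD hl reps) (g : Gal(K/ℚ)) : 𝓞 (FF K d) →+* 𝓞 (FF K d) :=
  lft d ((MulSemiringAction.toRingHom Gal(K/ℚ) (𝓞 K) g).comp (algebraMap (𝓞 (FF K d)) (𝓞 K)))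
    (fun a h hh => by
      change h • g • algebraMap (𝓞 (FF K d)) (𝓞 K) a = g • algebraMap (𝓞 (FF K d)) (𝓞 K) a
      rw [← mul_smul, gal_comm, mul_smul, fixed_of_FF d a h hh])

theorem gF_spec (d : HD hl reps) (g : Gal(K/ℚ)) (y : 𝓞 (FF K d)) :
    algebraMap (𝓞 (FF K d)) (𝓞 K) (gF d g y) = g • algebraMap (𝓞 (FF K d)) (𝓞 K) y :=
  lft_spec _ _ _ _

end lift
end C180
end

section
open NumberField Polynomial
open scoped Pointwise nonZeroDivisors

namespace C180

section sqgen
variable {E : Type*} [CommGroup E]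

theorem prod_symmDiff_sq {ι : Type*} [DecidableEq ι] (g : ι → E) (S T : Finset ι) :
    (∏ i ∈ S, g i) * (∏ i ∈ T, g i) = (∏ i ∈ symmDiff S T, g i) * (∏ i ∈ S ∩ T, g i) ^ 2 := by
  have h1 : ∏ i ∈ S, g i = (∏ i ∈ S \ T, g i) * ∏ i ∈ S ∩ T, g i := by
    rw [mul_comm]; exact (Finset.prod_inter_mul_prod_sdiff S T g).symm
  have h2 : ∏ i ∈ T, g i = (∏ i ∈ T \ S, g i) * ∏ i ∈ S ∩ T, g i := by
    rw [mul_comm, Finset.inter_comm]; exact (Finset.prod_inter_mul_prod_sdiff T S g).symm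
  have h3 : ∏ i ∈ symmDiff S T, g i = (∏ i ∈ S \ T, g i) * ∏ i ∈ T \ S, g i := by
    rw [symmDiff_def]
    exact Finset.prod_union (disjoint_sdiff_sdiff)
  rw [h1, h2, h3, sq]
  exact mul_mul_mul_comm _ _ _ _

theorem sq_gen {ι : Type*} [Fintype ι] [DecidableEq ι] (f : ι → E)
    (hf : ∀ u, ∃ e : ι → ℤ, u = ∏ i, f i ^ e i) (g : ι → E)
    (hg : ∀ T : Finset ι, T.Nonempty → ∀ v, ∏ i ∈ T, g i ≠ v ^ 2) (u : E) :
    ∃ (T : Finset ι) (v : E), u = (∏ i ∈ T, g i) * v ^ 2 := by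
  have key : ∀ u, ∃ (P : Finset ι) (v : E), u = (∏ i ∈ P, f i) * v ^ 2 := by
    intro u
    obtain ⟨e, rfl⟩ := hf u
    refine ⟨Finset.univ.filter (fun i => Odd (e i)), ∏ i, f i ^ (e i / 2), ?_⟩
    rw [← Finset.prod_pow, Finset.prod_filter, ← Finset.prod_mul_distrib]
    refine Finset.prod_congr rfl fun i _ => ?_
    split_ifs with h
    · obtain ⟨k, hk⟩ := h
      have : e i / 2 = k := by omega
      rw [this, hk, ← zpow_natCast, ← zpow_mul, zpow_add, zpow_one, mul_comm, mul_comm k]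
      rfl
    · rw [Int.not_odd_iff_even] at h
      obtain ⟨k, hk⟩ := h
      have : e i / 2 = k := by omega
      rw [this, hk, one_mul, zpow_add, sq]
  choose P v hP using key
  have hsame : ∀ a b, P a = P b → ∃ w, a = b * w ^ 2 := by
    intro a b h
    refine ⟨v a * (v b)⁻¹, ?_⟩
    have h1 := hP a
    have h2 := hP b
    rw [h] at h1
    generalize v a = x at h1 ⊢
    generalize v b = y at h2 ⊢
    rw [h1]
    nth_rewrite 2 [h2]
    rw [mul_pow, inv_pow, mul_assoc, mul_comm (x ^ 2), mul_inv_cancel_left]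
  have inj : Function.Injective (fun T : Finset ι => P (∏ i ∈ T, g i)) := by
    intro S T h
    obtain ⟨w, hw⟩ := hsame _ _ h
    by_contra hne
    have hn : (symmDiff S T).Nonempty := by
      rw [Finset.nonempty_iff_ne_empty]
      intro h0
      exact hne (symmDiff_eq_bot.mp h0)
    have h1 := prod_symmDiff_sq g S T
    apply hg _ hn ((∏ i ∈ T, g i) * w * (∏ i ∈ S ∩ T, g i)⁻¹)
    rw [← mul_inv_eq_iff_eq_mul] at h1
    rw [← h1, hw, mul_pow, mul_pow, inv_pow, sq (∏ i ∈ T, g i)]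
    congr 1
    rw [mul_right_comm]
  obtain ⟨T, hT⟩ := (Finite.injective_iff_surjective.mp inj) (P u)
  obtain ⟨w, hw⟩ := hsame u _ hT.symm
  exact ⟨T, w, hw⟩

end sqgen

section units

theorem sign_unit_sq (x : SignType) (h : IsUnit x) : x ^ 2 = 1 := by
  revert h
  cases x
  · intro h; exact absurd h not_isUnit_zero
  · intro; rfl
  · intro; rfl

theorem units_gen (F : Type*) [Field F] [NumberField F] (m : ℕ)
    (hr : InfinitePlace.nrComplexPlaces F = 0) (hm : Module.finrank ℚ F = m + 1)
    (g : Fin m → (𝓞 F)ˣ) (χ : Fin m → (𝓞 F)ˣ →* SignType)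
    (hχ : ∀ i j, χ i (g j) = if i = j then -1 else 1) (ε : (𝓞 F)ˣ) (hε : ∀ i, χ i ε = 1)
    (hns : ∀ v, ε ≠ v ^ 2) (u : (𝓞 F)ˣ) :
    ∃ (T : Finset (Fin m)) (e : ℕ) (v : (𝓞 F)ˣ), u = (∏ i ∈ T, g i) * ε ^ e * v ^ 2 ∧
      ∀ i, χ i u = if i ∈ T then -1 else 1 := by
  classical
  have hrank : Units.rank F = m := by
    have h1 := InfinitePlace.card_add_two_mul_card_eq_rank F
    have h2 := InfinitePlace.card_eq_nrRealPlaces_add_nrComplexPlaces F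
    rw [Units.rank]
    omega
  obtain ⟨ω, hω⟩ := IsCyclic.exists_generator (α := Units.torsion F)
  have hsq : ∀ i v, χ i (v ^ 2) = 1 := fun i v => by
    rw [map_pow]
    exact sign_unit_sq _ ((Group.isUnit v).map (χ i))
  have hT : ∀ i (T : Finset (Fin m)), χ i (∏ j ∈ T, g j) = if i ∈ T then -1 else 1 := by
    intro i T
    rw [map_prod]
    simp_rw [hχ]
    rw [Finset.prod_ite_eq]
  let f : Option (Fin m) → (𝓞 F)ˣ := fun o => o.elim ω.1 (fun i => Units.fundSystem F (Fin.cast hrank.symm i))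
  let g' : Option (Fin m) → (𝓞 F)ˣ := fun o => o.elim ε g
  have hsplit : ∀ T : Finset (Option (Fin m)), ∃ e : ℕ,
      ∏ i ∈ T, g' i = (∏ i ∈ T.eraseNone, g i) * ε ^ e ∧ (T.eraseNone = ∅ → T.Nonempty → e = 1) := by
    intro T
    by_cases h : none ∈ T
    · refine ⟨1, ?_, fun _ _ => rfl⟩
      rw [← Finset.mul_prod_erase T g' h, mul_comm, pow_one]
      congr 1
      rw [← Finset.map_some_eraseNone, Finset.prod_map]
      rfl
    · refine ⟨0, ?_, fun h0 hne => ?_⟩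
      · rw [pow_zero, mul_one]
        conv_lhs => rw [← Finset.erase_eq_of_notMem h]
        rw [← Finset.map_some_eraseNone, Finset.prod_map]
        rfl
      · exfalso
        obtain ⟨x, hx⟩ := hne
        cases x with
        | none => exact h hx
        | some a =>
          have : a ∈ T.eraseNone := Finset.mem_eraseNone.mpr hx
          rw [h0] at this
          simp at this
  have hχT : ∀ i T (e : ℕ) v, χ i ((∏ j ∈ T, g j) * ε ^ e * v ^ 2) = if i ∈ T then -1 else 1 := by
    intro i T e v
    rw [map_mul, map_mul, hsq, hT, map_pow, hε, one_pow, mul_one, mul_one]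
  obtain ⟨T, v, h⟩ := sq_gen f (fun u => by
    obtain ⟨⟨t, e⟩, h, -⟩ := Units.exist_unique_eq_mul_prod F u
    obtain ⟨k, hk⟩ := Subgroup.mem_zpowers_iff.mp (hω t)
    refine ⟨fun o => o.elim k (fun i => e (Fin.cast hrank.symm i)), ?_⟩
    rw [Fintype.prod_option, h]
    congr 1
    · change (t : (𝓞 F)ˣ) = ω.1 ^ k
      rw [← hk]; rfl
    · exact (Fintype.prod_equiv (finCongr hrank.symm) _ _ (fun i => rfl)).symm) g' (by
    intro T hTn v hv
    obtain ⟨e, he, he'⟩ := hsplit T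
    have h0 : T.eraseNone = ∅ := by
      rw [Finset.eq_empty_iff_forall_notMem]
      intro i hi
      have := hχT i T.eraseNone e 1
      rw [one_pow, mul_one, ← he, hv, hsq, if_pos hi] at this
      exact absurd this (by decide)
    rw [he' h0 hTn, h0, Finset.prod_empty, one_mul, pow_one] at he
    exact hns v (he.symm.trans hv)) u
  obtain ⟨e, he, -⟩ := hsplit T
  rw [he] at h
  exact ⟨_, e, v, h, fun i => by rw [h]; exact hχT i _ e v⟩

end units
end C180
end

section
open NumberField Polynomial
open scoped Pointwise nonZeroDivisors

namespace C180

section signs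
variable {K : Type*} [Field K] [NumberField K] [hK : IsCyclotomicExtension {180} ℚ K]
variable {hl reps : List ℕ}

theorem exists_emb : ∃ φ : K →+* ℂ, φ (z K : K) = Complex.exp (2 * Real.pi * Complex.I / (180 : ℕ)) := by
  let ψ : K →+* ℂ := Classical.arbitrary (K →+* ℂ)
  have h1 : IsPrimitiveRoot (ψ (z K : K)) 180 :=
    (z_prim.map_of_injective (f := algebraMap (𝓞 K) K) RingOfIntegers.coe_injective).map_of_injective
      ψ.injective
  have h2 := Complex.isPrimitiveRoot_exp 180 (by norm_num)
  obtain ⟨i, -, hi, e⟩ := h1.isPrimitiveRoot_iff.mp h2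
  refine ⟨ψ.comp (s K i : K →+* K), ?_⟩
  rw [← e, ← map_pow]
  change ψ (s K i (z K : K)) = _
  congr 1
  rw [← coe_gsmul, s_z hi]
  exact map_pow (algebraMap (𝓞 K) K) _ _

variable (K) in
/-- the standard embedding -/
noncomputable def emb : K →+* ℂ := Classical.choose (exists_emb (K := K))

variable (K) in
/-- the standard embedding on integers -/
noncomputable def em : 𝓞 K →+* ℂ := (emb K).comp (algebraMap (𝓞 K) K)

theorem em_z : em K (z K) = Complex.exp (2 * Real.pi * Complex.I / (180 : ℕ)) :=
  Classical.choose_spec (exists_emb (K := K))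

theorem em_inj : Function.Injective (em K) :=
  (emb K).injective.comp RingOfIntegers.coe_injective

theorem em_conj (x : 𝓞 K) : starRingEnd ℂ (em K x) = em K (s K 179 • x) := conj_emb (emb K) _

theorem em_real (x : 𝓞 K) (k : ℕ) (h : s K 179 • x = x) : ((em K (s K k • x)).re : ℂ) = em K (s K k • x) := by
  rw [← Complex.conj_eq_iff_re, em_conj, ← mul_smul, gal_comm, mul_smul, h]

/-- sign of the k-th conjugate -/
noncomputable def sgnc (k : ℕ) (x : 𝓞 K) : SignType := SignType.sign (em K (s K k • x)).re

theorem sgnc_mul (k : ℕ) (x y : 𝓞 K) (h : s K 179 • x = x) :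
    sgnc k (x * y) = sgnc k x * sgnc k y := by
  rw [sgnc, sgnc, sgnc, smul_mul', map_mul, ← em_real x k h, ← sign_mul, Complex.re_ofReal_mul]
  rfl

/-- real embeddings of the integers of a real subfield. -/
noncomputable def rho (d : HD hl reps) (h : 179 ∈ hl) (k : ℕ) : 𝓞 (FF K d) →* SignType where
  toFun y := sgnc k (algebraMap (𝓞 (FF K d)) (𝓞 K) y)
  map_one' := by rw [map_one, sgnc, smul_one, map_one, Complex.one_re, sign_one]
  map_mul' x y := by
    rw [map_mul, sgnc_mul]
    exact fixed_of_FF d x _ ((mem_Hs d _).mpr ⟨179, h, rfl⟩)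

/-- sign of the sine -/
def S (n : ℕ) : SignType := if n % 360 % 180 = 0 then 0 else if n % 360 < 180 then 1 else -1

theorem sign_sin (n : ℕ) : SignType.sign (Real.sin (Real.pi * n / 180)) = S n := by
  have hp := Real.pi_pos
  have h1 : Real.sin (Real.pi * n / 180) = Real.sin (Real.pi * (n % 360 : ℕ) / 180) := by
    have : (n : ℝ) = (n % 360 : ℕ) + 360 * (n / 360 : ℕ) := by
      exact_mod_cast (Nat.mod_add_div n 360).symm
    rw [show Real.pi * n / 180 = Real.pi * (n % 360 : ℕ) / 180 + (n / 360 : ℕ) * (2 * Real.pi) by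
      rw [this]; ring]
    exact Real.sin_add_nat_mul_two_pi _ _
  rw [h1, S]
  have hlt : n % 360 < 360 := Nat.mod_lt _ (by norm_num)
  generalize n % 360 = r at *
  have hr : (r : ℝ) < 360 := by exact_mod_cast hlt
  split_ifs with h2 h3
  · have : r = 0 ∨ r = 180 := by omega
    rcases this with rfl | rfl
    · simp
    · rw [show Real.pi * (180 : ℕ) / 180 = Real.pi by push_cast; ring, Real.sin_pi, sign_zero]
  · have h4 : (0 : ℝ) < r := by exact_mod_cast (show 0 < r by omega)
    have h5 : (r : ℝ) < 180 := by exact_mod_cast h3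
    rw [sign_pos]
    apply Real.sin_pos_of_pos_of_lt_pi
    · positivity
    · rw [div_lt_iff₀ (by norm_num)]; nlinarith
  · have h4 : (180 : ℝ) < r := by exact_mod_cast (show 180 < r by omega)
    rw [sign_neg]
    have : Real.sin (Real.pi * r / 180) = - Real.sin (Real.pi * (r - 180) / 180) := by
      rw [← Real.sin_add_pi]; congr 1; ring
    rw [this, neg_neg_iff_pos]
    apply Real.sin_pos_of_pos_of_lt_pi
    · have : 0 < (r : ℝ) - 180 := by linarith
      positivity
    · rw [div_lt_iff₀ (by norm_num)]; nlinarith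

variable (K) in
/-- the real cyclotomic units -/
noncomputable def eu (b : ℕ) : 𝓞 K :=
  if b = 0 then -1 else z K ^ (180 - (1 + b) / 2) * (1 - z K) * (1 - z K ^ b)

/-- predicted sign -/
def sg (b k : ℕ) : SignType := if b = 0 then -1 else - (S k * S (b * k))

theorem sgnc_eu (b k : ℕ) (hb : b = 0 ∨ b % 2 = 1) (hb2 : b < 180) (hk : k.Coprime 180) :
    sgnc k (eu K b) = sg b k := by
  rw [sgnc, sg, eu]
  split_ifs with h0
  · rw [smul_neg, smul_one, map_neg, map_one]; simp
  have hb' : b % 2 = 1 := hb.resolve_left h0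
  obtain ⟨c, rfl⟩ : ∃ c, b = 2 * c + 1 := ⟨b / 2, by omega⟩
  have hs : s K k • (z K ^ (180 - (1 + (2 * c + 1)) / 2) * (1 - z K) * (1 - z K ^ (2 * c + 1))) =
    (z K ^ k) ^ (180 - (1 + (2 * c + 1)) / 2) * (1 - z K ^ k) * (1 - (z K ^ k) ^ (2 * c + 1)) := by
    simp only [smul_mul', smul_sub, smul_pow', smul_one, s_z hk]
  rw [hs]
  obtain ⟨t, ht⟩ : ∃ t : ℂ, t = Complex.exp ((Real.pi * k / 180 : ℝ) * Complex.I) := ⟨_, rfl⟩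
  have hzt : em K (z K) ^ k = t ^ 2 := by
    rw [em_z, ht, ← Complex.exp_nat_mul, ← Complex.exp_nat_mul]
    congr 1; push_cast; ring
  have ht0 : t ≠ 0 := ht ▸ Complex.exp_ne_zero _
  have ht1 : (t ^ 2) ^ 180 = 1 := by
    rw [← hzt, ← map_pow, ← map_pow, ← pow_mul, mul_comm, pow_mul, z_pow, one_pow, map_one]
  have hsin1 : t - t⁻¹ = 2 * Complex.I * (Real.sin (Real.pi * k / 180) : ℂ) := by
    rw [ht, ← Complex.exp_neg, Complex.ofReal_sin, Complex.sin]
    rw [← neg_mul]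
    have := Complex.I_mul_I
    linear_combination (Complex.exp (-((Real.pi * k / 180 : ℝ) : ℂ) * Complex.I) - Complex.exp (((Real.pi * k / 180 : ℝ) : ℂ) * Complex.I)) * (-this)
  have hsin2 : t ^ (2 * c + 1) - (t ^ (2 * c + 1))⁻¹ =
      2 * Complex.I * (Real.sin (Real.pi * ((2 * c + 1) * k : ℕ) / 180) : ℂ) := by
    have : t ^ (2 * c + 1) = Complex.exp ((Real.pi * ((2 * c + 1) * k : ℕ) / 180 : ℝ) * Complex.I) := by
      rw [ht, ← Complex.exp_nat_mul]; congr 1; push_cast; ring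
    rw [this, ← Complex.exp_neg, Complex.ofReal_sin, Complex.sin]
    rw [← neg_mul]
    have := Complex.I_mul_I
    linear_combination (Complex.exp (-((Real.pi * ((2 * c + 1) * k : ℕ) / 180 : ℝ) : ℂ) * Complex.I) - Complex.exp (((Real.pi * ((2 * c + 1) * k : ℕ) / 180 : ℝ) : ℂ) * Complex.I)) * (-this)
  have key : em K ((z K ^ k) ^ (180 - (1 + (2 * c + 1)) / 2) * (1 - z K ^ k) * (1 - (z K ^ k) ^ (2 * c + 1)))
      = ((-4 * (Real.sin (Real.pi * k / 180) * Real.sin (Real.pi * ((2 * c + 1) * k : ℕ) / 180)) : ℝ) : ℂ) := by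
    simp only [map_mul, map_sub, map_one, map_pow, hzt]
    rw [show (1 + (2 * c + 1)) / 2 = c + 1 by omega]
    have e1 : (t ^ 2) ^ (180 - (c + 1)) = (t⁻¹) ^ 2 * ((t ^ c)⁻¹) ^ 2 := by
      rw [pow_sub₀ _ (pow_ne_zero _ ht0) (by omega), ht1, one_mul]
      rw [pow_succ, inv_pow, inv_pow, ← mul_inv]; congr 1; ring
    have e2 : (t⁻¹ ^ 2 * ((t ^ c)⁻¹) ^ 2) * (1 - t ^ 2) * (1 - (t ^ 2) ^ (2 * c + 1)) =
      (t - t⁻¹) * (t ^ (2 * c + 1) - (t ^ (2 * c + 1))⁻¹) := by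
      field_simp
      ring
    rw [e1, e2, hsin1, hsin2]
    have := Complex.I_mul_I
    push_cast
    linear_combination (4 * Complex.sin (Real.pi * k / 180) * Complex.sin (Real.pi * ((2 * c + 1) * k) / 180)) * this
  rw [key, Complex.ofReal_re, sign_mul, sign_mul, sign_sin, sign_sin, sign_neg (by norm_num)]
  simp

theorem eu_fix (b : ℕ) (hb : b = 0 ∨ b % 2 = 1) (hb2 : b < 180) : s K 179 • eu K b = eu K b := by
  rw [eu]
  split_ifs with h0
  · rw [smul_neg, smul_one]
  have hb' : b % 2 = 1 := hb.resolve_left h0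
  obtain ⟨c, rfl⟩ : ∃ c, b = 2 * c + 1 := ⟨b / 2, by omega⟩
  simp only [smul_mul', smul_sub, smul_pow', smul_one, s_z (show Nat.Coprime 179 180 by decide)]
  rw [show (1 + (2 * c + 1)) / 2 = c + 1 by omega]
  obtain ⟨y, hy⟩ : ∃ y, y = z K ^ 179 := ⟨_, rfl⟩
  rw [← hy]
  have h1 : z K * y = 1 := by rw [hy, ← pow_succ', z_pow]
  have h2 : z K ^ (180 - (c + 1)) = y ^ (c + 1) := by
    have : z K ^ (180 - (c + 1)) * (z K ^ (c + 1) * y ^ (c + 1)) = y ^ (c + 1) := by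
      rw [← mul_assoc, ← pow_add, show 180 - (c + 1) + (c + 1) = 180 by omega, z_pow, one_mul]
    rwa [← mul_pow, h1, one_pow, mul_one] at this
  have h3 : y ^ (180 - (c + 1)) = z K ^ (c + 1) := by
    have : y ^ (180 - (c + 1)) * (y ^ (c + 1) * z K ^ (c + 1)) = z K ^ (c + 1) := by
      rw [← mul_assoc, ← pow_add, show 180 - (c + 1) + (c + 1) = 180 by omega, hy, ← pow_mul,
        mul_comm 179, pow_mul, z_pow, one_pow, one_mul]
    rwa [← mul_pow, mul_comm y, h1, one_pow, mul_one] at this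
  rw [h2, h3]
  have h4 : z K ^ (2 * c + 1) * y ^ (2 * c + 1) = 1 := by rw [← mul_pow, h1, one_pow]
  have h5 : z K ^ (c + 1) * y ^ (c + 1) = 1 := by rw [← mul_pow, h1, one_pow]
  have e1 : z K ^ (c+1) * (1 - y) = - (z K ^ c * (1 - z K)) := by
    linear_combination (-z K ^ c) * h1
  have e2 : z K ^ (c) * (1 - y ^ (2 * c + 1)) = - y ^ (c + 1) * (1 - z K ^ (2 * c + 1)) := by
    have h6 : z K ^ c * y ^ c = 1 := by rw [← mul_pow, h1, one_pow]
    linear_combination (-z K ^ c) * h5 - (y^(c+1)) * h6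
  rw [e1]
  linear_combination (-(1 - z K)) * e2

theorem dvd_one_sub (b c e : ℕ) (h : b * c % 180 = e % 180) : (1 - z K ^ b) ∣ (1 - z K ^ e) := by
  have : z K ^ e = (z K ^ b) ^ c := by rw [← pow_mul, ← z_pow_mod, ← h, z_pow_mod]
  rw [this]
  simpa using sub_dvd_pow_sub_pow (1 : 𝓞 K) (z K ^ b) c

theorem z90 : z K ^ 90 = -1 := by
  have h1 : (z K ^ 90 - 1) * (z K ^ 90 + 1) = 0 := by linear_combination z_pow (K := K)
  rcases mul_eq_zero.mp h1 with h | h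
  · exfalso
    have := z_pow_inj (K := K) (a := 90) (b := 0) (by linear_combination h)
    omega
  · linear_combination h

theorem z60 : z K ^ 120 + z K ^ 60 + 1 = 0 := by
  have h1 : (z K ^ 60 - 1) * (z K ^ 120 + z K ^ 60 + 1) = 0 := by linear_combination z_pow (K := K)
  rcases mul_eq_zero.mp h1 with h | h
  · exfalso
    have := z_pow_inj (K := K) (a := 60) (b := 0) (by linear_combination h)
    omega
  · exact h

theorem z36 : z K ^ 144 + z K ^ 108 + z K ^ 72 + z K ^ 36 + 1 = 0 := by
  have h1 : (z K ^ 36 - 1) * (z K ^ 144 + z K ^ 108 + z K ^ 72 + z K ^ 36 + 1) = 0 := by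
    linear_combination z_pow (K := K)
  rcases mul_eq_zero.mp h1 with h | h
  · exfalso
    have := z_pow_inj (K := K) (a := 36) (b := 0) (by linear_combination h)
    omega
  · exact h

/-- boolean test for `1 - ζ^b` to be a unit -/
def ut (b : ℕ) : Bool := (List.range 180).any (fun c => b * c % 180 = 90) &&
  ((List.range 180).any (fun c => b * c % 180 = 60) || (List.range 180).any (fun c => b * c % 180 = 36))

theorem unit_one_sub (b : ℕ) (h : ut b = true) : IsUnit (1 - z K ^ b) := by
  rw [ut, Bool.and_eq_true, Bool.or_eq_true] at h
  simp only [List.any_eq_true, List.mem_range, decide_eq_true_eq] at h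
  obtain ⟨⟨c, -, h2⟩, h15⟩ := h
  have d2 : (1 - z K ^ b) ∣ (2 : 𝓞 K) := by
    have := dvd_one_sub (K := K) b c 90 h2
    rwa [z90, sub_neg_eq_add, one_add_one_eq_two] at this
  have d15 : (1 - z K ^ b) ∣ (15 : 𝓞 K) := by
    rcases h15 with ⟨c, -, h3⟩ | ⟨c, -, h5⟩
    · refine (dvd_one_sub (K := K) b c 60 h3).trans ⟨5 * (1 - z K ^ 120), ?_⟩
      have h180 := z_pow (K := K)
      linear_combination (5 : 𝓞 K) * z60 (K := K) - 5 * h180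
    · refine (dvd_one_sub (K := K) b c 36 h5).trans
        ⟨3 * ((1 - z K ^ 72) * (1 - z K ^ 108) * (1 - z K ^ 144)), ?_⟩
      have h := z36 (K := K)
      generalize hw : z K ^ 36 = w at *
      have e2 : z K ^ 72 = w ^ 2 := by rw [← hw]; ring
      have e3 : z K ^ 108 = w ^ 3 := by rw [← hw]; ring
      have e4 : z K ^ 144 = w ^ 4 := by rw [← hw]; ring
      rw [e2, e3, e4] at h
      rw [e2, e3, e4]
      linear_combination (-3) * ((-4)*w^0 + (3)*w^1 + (0)*w^2 + (1)*w^3 + (0)*w^4 + (-2)*w^5 + (1)*w^6) * h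
  have : (1 - z K ^ b) ∣ 1 := by
    have := dvd_sub d15 (d2.mul_right 7)
    norm_num at this
    exact this
  exact isUnit_of_dvd_one this

theorem z_unit : IsUnit (z K) := IsUnit.of_mul_eq_one (z K ^ 179) (by rw [← pow_succ', z_pow])

theorem eu_unit (b : ℕ) (hb : b = 0 ∨ ut b = true) : IsUnit (eu K b) := by
  rw [eu]
  split_ifs with h0
  · exact isUnit_one.neg
  · have h1 : IsUnit (1 - z K) := by
      have := unit_one_sub (K := K) 1 (by decide +kernel)
      rwa [pow_one] at this
    exact ((z_unit.pow _).mul h1).mul (unit_one_sub b (hb.resolve_left h0))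

end signs
end C180
end

section
open NumberField Polynomial
open scoped Pointwise nonZeroDivisors

namespace C180

section step2
variable {K : Type*} [Field K] [NumberField K] [hK : IsCyclotomicExtension {180} ℚ K]
variable {hl reps : List ℕ}

theorem exists_unit_of_fixed (d : HD hl reps) (x : 𝓞 K) (hx : IsUnit x)
    (h : ∀ g ∈ Hs K d, g • x = x) : ∃ u : (𝓞 (FF K d))ˣ, algebraMap (𝓞 (FF K d)) (𝓞 K) u = x := by
  obtain ⟨y, hy⟩ := exists_of_fixed d x h
  obtain ⟨x', hx'⟩ := hx.exists_right_inv
  obtain ⟨y', hy'⟩ := exists_of_fixed d x' (fun g hg => by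
    have h1 : x * g • x' = 1 := by
      have := congrArg (fun t => g • t) hx'
      simpa only [smul_mul', smul_one, h g hg] using this
    exact hx.mul_left_cancel (h1.trans hx'.symm))
  have : y * y' = 1 := alg_inj d (by rw [map_mul, hy, hy', hx', map_one])
  exact ⟨⟨y, y', this, by rw [mul_comm, this]⟩, hy⟩

/-- the characters -/
noncomputable def chi (d : HD hl reps) (h : 179 ∈ hl) (L : List ℕ) : (𝓞 (FF K d))ˣ →* SignType where
  toFun u := (L.map fun k => rho (K := K) d h k u.1).prod
  map_one' := by simp
  map_mul' x y := by
    rw [Units.val_mul]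
    simp_rw [map_mul]
    exact List.prod_map_mul

theorem chi_apply (d : HD hl reps) (h : 179 ∈ hl) (L : List ℕ) (u : (𝓞 (FF K d))ˣ) (x : 𝓞 K)
    (hx : algebraMap (𝓞 (FF K d)) (𝓞 K) u = x) (f : ℕ → SignType) (hf : ∀ k ∈ L, sgnc k x = f k) :
    chi d h L u = (L.map f).prod := by
  have : chi d h L u = (L.map fun k => sgnc k x).prod := by rw [← hx]; rfl
  rw [this]
  congr 1
  exact List.map_congr_left hf

theorem sgnc_sq (k : ℕ) (x : 𝓞 K) (hx : x ≠ 0) (h : s K 179 • x = x) : sgnc k (x * x) = 1 := by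
  rw [sgnc_mul k x x h, ← sq]
  apply sign_unit_sq
  have h0 : (em K (s K k • x)).re ≠ 0 := by
    intro h0
    have h1 := em_real x k h
    rw [h0, Complex.ofReal_zero] at h1
    have h2 : s K k • x = 0 := em_inj (by rw [← h1, map_zero])
    exact hx ((smul_eq_zero_iff_eq (s K k)).mp h2)
  rw [sgnc]
  exact IsUnit.mk0 _ (sign_ne_zero.mpr h0)

theorem sgnc_smul (k m : ℕ) (hk : k.Coprime 180) (hm : m.Coprime 180) (x : 𝓞 K) :
    sgnc k (s K m • x) = sgnc (m * k % 180) x := by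
  rw [sgnc, sgnc, ← mul_smul, s_mul hk hm, s_congr (b := m * k % 180)
    (Nat.Coprime.mul_left hk hm) (by rw [Nat.mod_mod, mul_comm])]

/-- data for the maximal real subfield -/
theorem d2 : HD [1, 179] [1, 7, 11, 13, 17, 19, 23, 29, 31, 37, 41, 43, 47, 49, 53, 59, 61, 67, 71,
    73, 77, 79, 83, 89] where
  cop := by decide
  lt := by decide
  one := by decide
  mul := by decide
  inv := by decide
  nd := by decide
  rcop := by decide +kernel
  rnd := by decide +kernel
  rdis := by decide +kernel
  len := by decide

theorem fix_d2 (x : 𝓞 K) (h : s K 179 • x = x) : ∀ g ∈ Hs K d2, g • x = x := by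
  intro g hg
  obtain ⟨k, hk, rfl⟩ := (mem_Hs d2 g).mp hg
  simp only [List.mem_cons, List.not_mem_nil, or_false] at hk
  rcases hk with rfl | rfl
  · rw [s_one, one_smul]
  · exact h

theorem fix_d15 (x : 𝓞 K) (h : s K 179 • x = x) (h' : s K 91 • x = x) :
    ∀ g ∈ Hs K PF15_good.d, g • x = x := by
  intro g hg
  obtain ⟨k, hk, rfl⟩ := (mem_Hs PF15_good.d g).mp hg
  simp only [PF15, List.mem_cons, List.not_mem_nil, or_false] at hk
  rcases hk with rfl | rfl | rfl | rfl
  · rw [s_one, one_smul]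
  · have : s K 89 = s K 179 * s K 91 := by
      rw [s_mul (by decide) (by decide)]; exact s_congr (by decide) (by decide)
    rw [this, mul_smul, h', h]
  · exact h'
  · exact h

theorem fix179_d2 (y : 𝓞 (FF K d2)) : s K 179 • algebraMap (𝓞 (FF K d2)) (𝓞 K) y =
    algebraMap (𝓞 (FF K d2)) (𝓞 K) y :=
  fixed_of_FF d2 y _ ((mem_Hs d2 _).mpr ⟨179, by decide, rfl⟩)

theorem fix_d15' (y : 𝓞 (FF K PF15_good.d)) (k : ℕ) (hk : k ∈ PF15.hl) :
    s K k • algebraMap (𝓞 (FF K PF15_good.d)) (𝓞 K) y = algebraMap (𝓞 (FF K PF15_good.d)) (𝓞 K) y :=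
  fixed_of_FF PF15_good.d y _ ((mem_Hs PF15_good.d _).mpr ⟨k, hk, rfl⟩)

theorem s91_91 : s K 91 * s K 91 = 1 := by
  rw [s_mul (by decide) (by decide), ← s_one]; exact s_congr (by decide) (by decide)

theorem s179_179 : s K 179 * s K 179 = 1 := by
  rw [s_mul (by decide) (by decide), ← s_one]; exact s_congr (by decide) (by decide)

variable (K) in
/-- the involution of `K⁺` over `M` -/
noncomputable def tau : 𝓞 (FF K d2) →+* 𝓞 (FF K d2) := gF d2 (s K 91)

theorem tau_spec (y : 𝓞 (FF K d2)) : algebraMap (𝓞 (FF K d2)) (𝓞 K) (tau K y) =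
    s K 91 • algebraMap (𝓞 (FF K d2)) (𝓞 K) y := gF_spec _ _ _

theorem tau_tau (y : 𝓞 (FF K d2)) : tau K (tau K y) = y := by
  apply alg_inj d2
  rw [tau_spec, tau_spec, ← mul_smul, s91_91, one_smul]

variable (K) in
/-- inclusion of `M` in `K⁺` -/
noncomputable def inc : 𝓞 (FF K PF15_good.d) →+* 𝓞 (FF K d2) :=
  lft d2 (algebraMap (𝓞 (FF K PF15_good.d)) (𝓞 K))
    (fun a => fix_d2 _ (fix_d15' a 179 (by decide)))

theorem inc_spec (y : 𝓞 (FF K PF15_good.d)) : algebraMap (𝓞 (FF K d2)) (𝓞 K) (inc K y) =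
    algebraMap (𝓞 (FF K PF15_good.d)) (𝓞 K) y := lft_spec _ _ _ _

theorem inc_inj : Function.Injective (inc K) := fun x y h => alg_inj PF15_good.d (by
  rw [← inc_spec, h, inc_spec])

theorem tau_inc (y : 𝓞 (FF K PF15_good.d)) : tau K (inc K y) = inc K y := by
  apply alg_inj d2
  rw [tau_spec, inc_spec, fix_d15' y 91 (by decide)]

theorem of_tau (y : 𝓞 (FF K d2)) (h : tau K y = y) : ∃ m, inc K m = y := by
  obtain ⟨m, hm⟩ := exists_of_fixed PF15_good.d (algebraMap (𝓞 (FF K d2)) (𝓞 K) y)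
    (fix_d15 _ (fix179_d2 y) (by rw [← tau_spec, h]))
  exact ⟨m, alg_inj d2 (by rw [inc_spec, hm])⟩

theorem unit_35 (b c c' : ℕ) (h3 : b * c % 180 = 60) (h5 : b * c' % 180 = 36) :
    IsUnit (1 - z K ^ b) := by
  have d3 : (1 - z K ^ b) ∣ (3 : 𝓞 K) := by
    refine (dvd_one_sub (K := K) b c 60 h3).trans ⟨(1 - z K ^ 120), ?_⟩
    have h180 := z_pow (K := K)
    linear_combination z60 (K := K) - h180
  have d5 : (1 - z K ^ b) ∣ (5 : 𝓞 K) := by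
    refine (dvd_one_sub (K := K) b c' 36 h5).trans
        ⟨((1 - z K ^ 72) * (1 - z K ^ 108) * (1 - z K ^ 144)), ?_⟩
    have h := z36 (K := K)
    generalize hw : z K ^ 36 = w at *
    have e2 : z K ^ 72 = w ^ 2 := by rw [← hw]; ring
    have e3 : z K ^ 108 = w ^ 3 := by rw [← hw]; ring
    have e4 : z K ^ 144 = w ^ 4 := by rw [← hw]; ring
    rw [e2, e3, e4] at h
    rw [e2, e3, e4]
    linear_combination (-1) * (-4 + 3 * w + w ^ 3 - 2 * w ^ 5 + w ^ 6) * h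
  have : (1 - z K ^ b) ∣ 1 := by
    have := dvd_sub (d3.mul_right 2) d5
    norm_num at this
    exact this
  exact isUnit_of_dvd_one this

theorem exists_s : ∃ t : (𝓞 (FF K d2))ˣ, algebraMap (𝓞 (FF K d2)) (𝓞 K) t = z K + z K ^ 179 ∧
    tau K t = - t := by
  have h90 := z90 (K := K)
  obtain ⟨t, ht⟩ := exists_unit_of_fixed d2 (z K + z K ^ 179) (by
    have : z K + z K ^ 179 = z K ^ 179 * (1 - z K ^ 92) := by
      linear_combination z K * (z K ^ 180 - z K ^ 90 + 1) * h90
    rw [this]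
    exact (z_unit.pow _).mul (unit_35 92 30 18 (by decide) (by decide))) (fix_d2 _ (by
      simp only [smul_add, smul_pow', s_z (show Nat.Coprime 179 180 by decide)]
      rw [← pow_mul, ← z_pow_mod (179 * 179)]
      norm_num [add_comm]))
  refine ⟨t, ht, alg_inj d2 ?_⟩
  rw [tau_spec, map_neg, ht]
  simp only [smul_add, smul_pow', s_z (show Nat.Coprime 91 180 by decide)]
  rw [← pow_mul, ← z_pow_mod (91 * 179)]
  norm_num
  linear_combination (z K + z K ^ 89) * h90

theorem sqrt3 : (z K ^ 15 + z K ^ 165) ^ 2 = 3 := by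
  have h90 := z90 (K := K)
  have h60 := z60 (K := K)
  have h180 := z_pow (K := K)
  have : z K ^ 60 - z K ^ 30 + 1 = 0 := by linear_combination h60 - z K ^ 30 * h90
  linear_combination 2 * h180 + z K ^ 150 * h180 + z K ^ 60 * h90 - this

theorem phi5 : (z K ^ 18 + z K ^ 162) ^ 2 = z K ^ 18 + z K ^ 162 + 1 := by
  have h90 := z90 (K := K)
  have h36 := z36 (K := K)
  have h180 := z_pow (K := K)
  linear_combination (2 + z K ^ 144) * h180 + h36 - (z K ^ 18 + z K ^ 72) * h90

theorem exists_sqrt3 : ∃ t : 𝓞 (FF K d2), algebraMap (𝓞 (FF K d2)) (𝓞 K) t = z K ^ 15 + z K ^ 165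
    ∧ t ^ 2 = 3 ∧ tau K t = - t := by
  obtain ⟨t, ht⟩ := exists_of_fixed d2 (z K ^ 15 + z K ^ 165) (fix_d2 _ (by
      simp only [smul_add, smul_pow', s_z (show Nat.Coprime 179 180 by decide)]
      rw [← pow_mul, ← z_pow_mod (179 * 15), ← pow_mul, ← z_pow_mod (179 * 165)]
      norm_num [add_comm]))
  refine ⟨t, ht, alg_inj d2 ?_, alg_inj d2 ?_⟩
  · rw [map_pow, ht, sqrt3, map_ofNat]
  · rw [tau_spec, map_neg, ht]
    simp only [smul_add, smul_pow', s_z (show Nat.Coprime 91 180 by decide)]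
    rw [← pow_mul, ← z_pow_mod (91 * 15), ← pow_mul, ← z_pow_mod (91 * 165)]
    norm_num
    linear_combination (z K ^ 15 + z K ^ 75) * (z90 (K := K))

theorem exists_phi5 : ∃ t : 𝓞 (FF K d2), t ^ 2 = t + 1 ∧ tau K t = t := by
  obtain ⟨t, ht⟩ := exists_of_fixed d2 (z K ^ 18 + z K ^ 162) (fix_d2 _ (by
      simp only [smul_add, smul_pow', s_z (show Nat.Coprime 179 180 by decide)]
      rw [← pow_mul, ← z_pow_mod (179 * 18), ← pow_mul, ← z_pow_mod (179 * 162)]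
      norm_num [add_comm]))
  refine ⟨t, alg_inj d2 ?_, alg_inj d2 ?_⟩
  · rw [map_pow, ht, phi5, map_add, ht, map_one]
  · rw [tau_spec, ht]
    simp only [smul_add, smul_pow', s_z (show Nat.Coprime 91 180 by decide)]
    rw [← pow_mul, ← z_pow_mod (91 * 18), ← pow_mul, ← z_pow_mod (91 * 162)]

end step2
end C180
end

section
open NumberField Polynomial
open scoped Pointwise nonZeroDivisors

namespace C180

section step2
variable {K : Type*} [Field K] [NumberField K] [hK : IsCyclotomicExtension {180} ℚ K]

/-- indices of the units for step 2 -/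
def B2 : List ℕ := [3, 5, 7, 9, 11, 13, 15, 17, 19, 23, 27]

/-- dual signs for step 2 -/
def K2 : List (List ℕ) := [[1, 7, 11, 17, 19, 31], [7, 17, 31, 41], [7, 11, 37, 41], [7, 23, 31], [1, 11, 13, 19, 23, 29, 31, 41], [1, 7, 11, 13, 17, 23, 31, 41], [7, 11, 17, 19, 23, 29, 31, 41], [7, 29, 31, 37], [11, 17, 23, 29], [11, 13, 17, 19, 23, 29, 31, 37], [1, 7, 41]]

theorem step2_chk (i j : Fin 11) : (((K2.getD i []).map fun k =>
    sg (B2.getD j 0) k * sg (B2.getD j 0) (91 * k % 180)).prod) = if i = j then -1 else 1 := by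
  revert i j
  decide +kernel

theorem K2_cop (i : Fin 11) : ∀ k ∈ K2.getD i [], Nat.gcd k 180 = 1 := by
  revert i; decide +kernel

theorem B2_ok (i : Fin 11) : (B2.getD i 0) % 2 = 1 ∧ (B2.getD i 0) < 180 ∧ ut (B2.getD i 0) = true := by
  revert i; decide +kernel

/-- units of `M` are norms from `K⁺`. -/
theorem step2_U (m : (𝓞 (FF K PF15_good.d))ˣ) : ∃ w, IsUnit w ∧ inc K m = w * tau K w := by
  have h179 : 179 ∈ PF15.hl := by decide
  obtain ⟨t, ht, htau⟩ := exists_s (K := K)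
  have hg : ∀ i : Fin 11, ∃ g : (𝓞 (FF K PF15_good.d))ˣ,
      algebraMap (𝓞 (FF K PF15_good.d)) (𝓞 K) g = eu K (B2.getD i 0) * s K 91 • eu K (B2.getD i 0) := by
    intro i
    obtain ⟨h1, h2, h3⟩ := B2_ok i
    have hf := eu_fix (K := K) _ (Or.inr h1) h2
    apply exists_unit_of_fixed
    · have := eu_unit (K := K) _ (Or.inr h3)
      exact this.mul (this.map (MulSemiringAction.toRingHom Gal(K/ℚ) (𝓞 K) (s K 91)))
    · apply fix_d15
      · rw [smul_mul', ← mul_smul, gal_comm, mul_smul, hf]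
      · rw [smul_mul', ← mul_smul, s91_91, one_smul, mul_comm]
  choose g hg using hg
  have hfix : s K 179 • (z K + z K ^ 179) = z K + z K ^ 179 := by rw [← ht]; exact fix179_d2 _
  have h91 : s K 91 • (z K + z K ^ 179) = - (z K + z K ^ 179) := by
    rw [← ht, ← tau_spec, htau, map_neg]
  have hne : (z K + z K ^ 179) ≠ 0 := by
    rw [← ht, Ne, map_eq_zero_iff _ (alg_inj d2)]; exact t.ne_zero
  obtain ⟨ε, hε⟩ := exists_unit_of_fixed PF15_good.d ((z K + z K ^ 179) * (z K + z K ^ 179)) (by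
      rw [← ht, ← map_mul]
      exact (t.isUnit.mul t.isUnit).map _) (fix_d15 _ (by rw [smul_mul', hfix])
        (by rw [smul_mul', h91, neg_mul_neg]))
  have hie : inc K ε = t * t := alg_inj d2 (by rw [inc_spec, hε, map_mul, ht])
  obtain ⟨T, e, v, hv, -⟩ := units_gen (FF K PF15_good.d) 11 (real_FF _ h179)
    (by rw [degree_FF]; decide) g (fun i => chi PF15_good.d h179 (K2.getD i []))
    (fun i j => by
      rw [← step2_chk i j]
      refine chi_apply _ _ _ _ _ (hg j) _ fun k hk => ?_
      obtain ⟨h1, h2, h3⟩ := B2_ok j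
      have hk' : Nat.Coprime k 180 := K2_cop i k hk
      rw [sgnc_mul _ _ _ (eu_fix (K := K) _ (Or.inr h1) h2), sgnc_smul k 91 hk' (by decide),
        sgnc_eu _ _ (Or.inr h1) h2 hk', sgnc_eu _ _ (Or.inr h1) h2
          (cop_mod (Nat.Coprime.mul_left (by decide) hk'))])
    ε (fun i => by
      rw [chi_apply _ _ _ _ _ hε (fun _ => 1) (fun k _ => sgnc_sq k _ hne hfix)]
      simp)
    (fun v hv => by
      have h1 : (inc K v) ^ 2 = (t : 𝓞 (FF K d2)) ^ 2 := by
        rw [← map_pow, ← Units.val_pow_eq_pow_val, ← hv, hie, sq]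
      have h2 := tau_inc (K := K) v.1
      have h3 : tau K t = t := by
        rcases sq_eq_sq_iff_eq_or_eq_neg.mp h1 with h | h
        · rw [← h, h2]
        · rw [← neg_eq_iff_eq_neg.mpr h, map_neg, h2]
      rw [htau, neg_eq_iff_add_eq_zero, ← two_mul] at h3
      exact (mul_ne_zero two_ne_zero t.ne_zero) h3) m
  -- norms form a submonoid
  let N : Submonoid (𝓞 (FF K d2)) :=
    { carrier := {x | ∃ w, IsUnit w ∧ x = w * tau K w}
      one_mem' := ⟨1, isUnit_one, by rw [map_one, mul_one]⟩
      mul_mem' := by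
        rintro _ _ ⟨a, ha, rfl⟩ ⟨b, hb, rfl⟩
        exact ⟨a * b, ha.mul hb, by rw [map_mul]; ring⟩ }
  change inc K m ∈ N
  rw [hv, Units.val_mul, Units.val_mul, map_mul, map_mul]
  refine N.mul_mem (N.mul_mem ?_ ?_) ?_
  · rw [Units.coe_prod, map_prod]
    refine N.prod_mem fun i _ => ?_
    obtain ⟨h1, h2, h3⟩ := B2_ok i
    obtain ⟨w, hw⟩ := exists_unit_of_fixed d2 _ (eu_unit (K := K) _ (Or.inr h3))
      (fix_d2 _ (eu_fix (K := K) _ (Or.inr h1) h2))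
    refine ⟨w, w.isUnit, alg_inj d2 ?_⟩
    rw [inc_spec, hg, map_mul, tau_spec, hw]
  · rw [Units.val_pow_eq_pow_val, map_pow]
    refine N.pow_mem ?_ e
    obtain ⟨r, -, hr, hrt⟩ := exists_sqrt3 (K := K)
    obtain ⟨p, hp, hpt⟩ := exists_phi5 (K := K)
    have key : t * (p * (p + r)) * tau K (t * (p * (p + r))) = t * t := by
      rw [map_mul, map_mul, map_add, hpt, hrt, htau]
      linear_combination (t.1 ^ 2 * p ^ 2) * hr - (t.1 ^ 2) * (p ^ 2 + p - 1) * hp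
    refine ⟨_, ?_, by rw [hie, key]⟩
    exact isUnit_of_mul_isUnit_left (key ▸ t.isUnit.mul t.isUnit)
  · refine ⟨inc K v, v.isUnit.map _, ?_⟩
    rw [tau_inc, Units.val_pow_eq_pow_val, map_pow, sq]

theorem finrank_int (F : Type*) [Field F] [NumberField F] (n : ℕ) :
    Ideal.absNorm (Ideal.span {(n : 𝓞 F)}) = n ^ Module.finrank ℚ F := by
  rw [Ideal.absNorm_span_singleton]
  have : (n : 𝓞 F) = algebraMap ℤ (𝓞 F) n := by simp
  rw [this, Algebra.norm_algebraMap, Int.natAbs_pow, RingOfIntegers.rank]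
  simp

theorem prime_pi : ∃ P : Ideal (𝓞 (FF K d2)), Prime P ∧ cl P = 1 ∧ Ideal.span {2} = P ^ 2 := by
  obtain ⟨r, -, hr, hrt⟩ := exists_sqrt3 (K := K)
  have hu : IsUnit (2 + r) := IsUnit.of_mul_eq_one (2 - r) (by linear_combination - hr)
  have hsq : Ideal.span {(2 : 𝓞 (FF K d2))} = Ideal.span {1 + r} ^ 2 := by
    rw [Ideal.span_singleton_pow, show (1 + r) ^ 2 = 2 * (2 + r) by linear_combination hr,
      Ideal.span_singleton_mul_right_unit hu]
  refine ⟨Ideal.span {1 + r}, ?_, cl_span _, hsq⟩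
  have hn : Ideal.absNorm (Ideal.span {1 + r}) = 2 ^ 12 := by
    have h1 := finrank_int (FF K d2) 2
    rw [Nat.cast_ofNat, hsq, map_pow, degree_FF] at h1
    exact Nat.pow_left_injective (n := 2) (by norm_num) h1
  have hne : Ideal.span {1 + r} ≠ ⊤ := by
    intro h
    rw [h, Ideal.absNorm_top] at hn
    norm_num at hn
  have hb : Ideal.span {1 + r} ≠ ⊥ := by
    intro h
    rw [h, Ideal.absNorm_bot] at hn
    norm_num at hn
  obtain ⟨q, hq, hle⟩ := Ideal.exists_le_maximal _ hne
  have hqp : q.IsPrime := hq.isPrime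
  have hq0 : q ≠ ⊥ := fun h => hb (le_bot_iff.mp (h ▸ hle))
  have h2q : (2 : 𝓞 (FF K d2)) ∈ q := by
    have : (2 : 𝓞 (FF K d2)) ∈ Ideal.span {(2 : 𝓞 (FF K d2))} := Ideal.mem_span_singleton_self _
    rw [hsq] at this
    exact hle (Ideal.pow_le_self two_ne_zero this)
  have hd : Ideal.absNorm q ∣ 2 ^ 12 := hn ▸ Ideal.absNorm_dvd_absNorm_of_le hle
  obtain ⟨f, hf, hqf⟩ := (Nat.dvd_prime_pow Nat.prime_two).mp hd
  obtain ⟨h, hh, he⟩ := residue d2 q hq0 45 4 (by norm_num) (by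
    intro h45
    apply hqp.ne_top
    rw [Ideal.eq_top_iff_one]
    have := q.sub_mem h45 (q.mul_mem_left 22 h2q)
    norm_num at this
    exact this)
  have hf12 : f = 12 := by
    have hf0 : f ≠ 0 := by
      rintro rfl
      rw [pow_zero, Ideal.absNorm_eq_one_iff] at hqf
      exact hqp.ne_top hqf
    rw [hqf] at he
    clear hqf
    revert h f
    decide
  have : Ideal.span {1 + r} = q := eq_of_le_of_norm hq0 hle (by rw [hn, hqf, hf12])
  rw [this]
  exact Ideal.prime_of_isPrime hq0 hqp

theorem step2_inv (J : Ideal (𝓞 (FF K d2))) (hJ : J ≠ ⊥) (hst : ∀ x ∈ J, tau K x ∈ J) :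
    cl J = 1 := by
  obtain ⟨t, ht, htau⟩ := exists_s (K := K)
  obtain ⟨P, hP, hP1, hP2⟩ := prime_pi (K := K)
  have htinj : Function.Injective (tau K) := fun x y h => by rw [← tau_tau x, h, tau_tau]
  have h0 : J.comap (inc K) ≠ ⊥ := by
    obtain ⟨x, hx, hx0⟩ := Submodule.exists_mem_ne_zero_of_ne_bot hJ
    obtain ⟨m, hm⟩ := of_tau (x * tau K x) (by rw [map_mul, tau_tau, mul_comm])
    intro h
    have h1 : m ∈ J.comap (inc K) := by
      rw [Ideal.mem_comap, hm]; exact J.mul_mem_right _ hx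
    rw [h, Ideal.mem_bot] at h1
    rw [h1, map_zero] at hm
    refine mul_ne_zero hx0 (fun h => hx0 (htinj (by rw [h, map_zero]))) hm.symm
  obtain ⟨m, hm0, hm⟩ := (cl_eq_one h0).mp (F15_pid _ h0)
  have him : inc K m ≠ 0 := fun h => hm0 (inc_inj (by rw [h, map_zero]))
  have hle : Ideal.span {inc K m} ≤ J := by
    rw [Ideal.span_singleton_le_iff_mem, ← Ideal.mem_comap, hm]
    exact Ideal.mem_span_singleton_self m
  have hfixmem : ∀ y ∈ J, tau K y = y → y ∈ Ideal.span {inc K m} := by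
    intro y hy hyt
    obtain ⟨n, rfl⟩ := of_tau y hyt
    have : n ∈ J.comap (inc K) := hy
    rw [hm, Ideal.mem_span_singleton] at this
    rw [Ideal.mem_span_singleton]
    exact map_dvd (inc K) this
  have h2 : Ideal.span {2} * J ≤ Ideal.span {inc K m} := by
    rw [Ideal.mul_le]
    intro a ha x hx
    obtain ⟨a', rfl⟩ := Ideal.mem_span_singleton.mp ha
    have hti : tau K (↑t⁻¹) = - (↑t⁻¹ : 𝓞 (FF K d2)) := by
      have h1 : tau K t * tau K (↑t⁻¹) = 1 := by rw [← map_mul, Units.mul_inv, map_one]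
      rw [htau] at h1
      have h2 := Units.mul_inv t
      apply t.isUnit.mul_left_cancel
      linear_combination h2 - h1
    have e : 2 * a' * x = a' * ((x + tau K x) + t * ((x - tau K x) * ↑t⁻¹)) := by
      have h2 := Units.mul_inv t
      linear_combination (-a' * (x - tau K x)) * h2
    rw [e]
    apply Ideal.mul_mem_left
    apply Ideal.add_mem
    · exact hfixmem _ (J.add_mem hx (hst x hx)) (by rw [map_add, tau_tau, add_comm])
    · apply Ideal.mul_mem_left
      exact hfixmem _ (J.mul_mem_right _ (J.sub_mem hx (hst x hx))) (by
        rw [map_mul, map_sub, tau_tau, hti]; ring)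
  obtain ⟨Q, hQ⟩ := Ideal.dvd_iff_le.mpr hle
  have hs0 : Ideal.span {inc K m} ≠ ⊥ := fun h => him (Ideal.span_singleton_eq_bot.mp h)
  have hQ0 : Q ≠ ⊥ := by
    rintro rfl
    exact hs0 (by rw [hQ, Ideal.mul_bot])
  have hQ2 : Q ∣ P ^ 2 := by
    rw [← hP2]
    have := Ideal.dvd_iff_le.mpr h2
    rw [hQ, mul_comm _ J] at this
    exact (mul_dvd_mul_iff_left hJ).mp this
  obtain ⟨i, -, hi⟩ := (dvd_prime_pow hP 2).mp hQ2
  have hQ1 : cl Q = 1 := by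
    rw [associated_iff_eq.mp hi, cl_pow hP.ne_zero, hP1, one_pow]
  have := cl_span (inc K m)
  rwa [hQ, cl_mul hJ hQ0, hQ1, mul_one] at this

theorem step2 (c : ClassGroup (𝓞 (FF K d2))) (hc : c ^ 2 = 1) : c = 1 := by
  refine lemD (tau K) tau_tau ?_ (fun I hI h => ⟨1, odd_one, by rw [pow_one, step2_inv I hI h]⟩) c hc
  intro u a b hu ha h
  have htinj : Function.Injective (tau K) := fun x y h => by rw [← tau_tau x, h, tau_tau]
  have hta : tau K a ≠ 0 := fun h => ha (htinj (by rw [h, map_zero]))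
  have hfix : tau K u = u := by
    have h' := congrArg (tau K) h
    rw [map_mul, map_mul, map_mul, tau_tau, tau_tau, mul_comm (tau K a), mul_comm (tau K b), ← h] at h'
    exact mul_right_cancel₀ (mul_ne_zero ha hta) h'
  obtain ⟨m, hm⟩ := exists_unit_of_fixed PF15_good.d (algebraMap (𝓞 (FF K d2)) (𝓞 K) u) (hu.map _)
    (fix_d15 _ (fix179_d2 u) (by rw [← tau_spec, hfix]))
  have : inc K m = u := alg_inj d2 (by rw [inc_spec, hm])
  rw [← this]
  exact step2_U m

end step2
end C180
end

section
open NumberField Polynomial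
open scoped Pointwise nonZeroDivisors

namespace C180

section step1
variable {K : Type*} [Field K] [NumberField K] [hK : IsCyclotomicExtension {180} ℚ K]

/-- indices of the units for step 1 -/
def B1 : List ℕ := [0,3,5,7,9,11,13,15,17,19,21,23,25,27,29,31,33,35,37,41,43,47,55]

/-- dual signs for step 1 -/
def K1 : List (List ℕ) := [[1, 7, 11, 17, 29, 43, 47, 53, 61, 67, 77, 79, 83], [1, 7, 11, 19, 31, 47, 59, 61, 71, 73], [7, 11, 13, 17, 31, 37, 47, 59, 61, 67, 77, 79], [11, 17, 31, 41, 47, 49, 53, 59, 61, 67, 71, 73, 77, 83], [7, 17, 19, 29, 31, 37, 41, 43, 67, 73, 77, 79], [7, 13, 17, 23, 31, 41, 43, 49, 53, 59, 67, 77], [11, 13, 19, 23, 31, 37, 47, 53, 61, 73, 77, 83], [23, 29, 31, 43, 71, 73, 77, 83], [1, 7, 11, 29, 43, 47, 49, 59, 61, 71, 79, 83], [1, 7, 17, 23, 31, 37, 41, 43, 49, 53, 61, 83], [1, 7, 13, 19, 43, 47, 53, 59, 61, 67, 73, 77], [13, 19, 23, 29, 37, 43, 47, 49, 53, 59, 73,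 83], [1, 7, 23, 29, 37, 41, 43, 49, 53, 59, 61, 67, 73, 83], [1, 7, 11, 13, 17, 19, 23, 29, 31, 41, 43, 47, 49, 59, 61, 67, 71, 77, 79, 83], [1, 11, 17, 23, 29, 37, 53, 59, 67, 77, 79, 83], [1, 7, 17, 23, 29, 43, 49, 53, 67, 73, 77, 79], [1, 29, 37, 47, 49, 53, 67, 71], [7, 19, 47, 59, 77, 79], [1, 11, 13, 17, 23, 29, 31, 37, 43, 53, 61, 67, 71, 73], [7, 11, 13, 23, 31, 41, 43, 47, 67, 77], [1, 13, 17, 23, 47, 53, 73, 83], [1, 7, 17, 29, 31, 37, 47, 49, 53, 59, 71, 73, 77, 83], [13, 19, 41, 43, 61, 67]]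

theorem step1_chk (i j : Fin 23) : (((K1.getD i []).map fun k => sg (B1.getD j 0) k).prod) =
    if i = j then -1 else 1 := by
  revert i j
  decide +kernel

theorem K1_cop (i : Fin 23) : ∀ k ∈ K1.getD i [], Nat.gcd k 180 = 1 := by
  revert i; decide +kernel

theorem B1_ok (i : Fin 23) : (B1.getD i 0 = 0 ∨ (B1.getD i 0) % 2 = 1) ∧ (B1.getD i 0) < 180 ∧
    (B1.getD i 0 = 0 ∨ ut (B1.getD i 0) = true) := by
  revert i; decide +kernel

theorem phi_181 : Phi (2 : ZMod 181) = 0 := by decide +kernel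

theorem nonsq_181 (v : ZMod 181) : (1 - 2) * (1 - 2 ^ 179) ≠ v ^ 2 := by
  revert v; decide +kernel

theorem sgnc_conj (k : ℕ) (x : 𝓞 K) (hx : x ≠ 0) : sgnc k (x * s K 179 • x) = 1 := by
  rw [sgnc, smul_mul', map_mul, ← mul_smul, gal_comm, mul_smul, ← em_conj, Complex.mul_conj,
    Complex.ofReal_re]
  apply sign_pos
  rw [Complex.normSq_pos]
  intro h
  have h2 : s K k • x = 0 := em_inj (by rw [h, map_zero])
  exact hx ((smul_eq_zero_iff_eq (s K k)).mp h2)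

theorem conj_conj (x : 𝓞 K) : s K 179 • s K 179 • x = x := by
  rw [← mul_smul, s179_179, one_smul]

theorem step1_U (u : (𝓞 (FF K d2))ˣ) (hu : ∀ k, sgnc k (algebraMap (𝓞 (FF K d2)) (𝓞 K) u) = 1) :
    ∃ w, IsUnit w ∧ algebraMap (𝓞 (FF K d2)) (𝓞 K) u = w * s K 179 • w := by
  have h179 : 179 ∈ [1, 179] := by decide
  have hg : ∀ i : Fin 23, ∃ g : (𝓞 (FF K d2))ˣ,
      algebraMap (𝓞 (FF K d2)) (𝓞 K) g = eu K (B1.getD i 0) := by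
    intro i
    obtain ⟨h1, h2, h3⟩ := B1_ok i
    exact exists_unit_of_fixed _ _ (eu_unit (K := K) _ h3) (fix_d2 _ (eu_fix (K := K) _ h1 h2))
  choose g hg using hg
  have h1z : IsUnit (1 - z K) := by
    have := unit_one_sub (K := K) 1 (by decide +kernel)
    rwa [pow_one] at this
  obtain ⟨ε, hε⟩ := exists_unit_of_fixed d2 ((1 - z K) * s K 179 • (1 - z K))
    (h1z.mul (h1z.map (MulSemiringAction.toRingHom Gal(K/ℚ) (𝓞 K) (s K 179))))
    (fix_d2 _ (by rw [smul_mul', conj_conj, mul_comm]))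
  obtain ⟨T, e, v, hv, hT⟩ := units_gen (FF K d2) 23 (real_FF _ h179)
    (by rw [degree_FF]; decide) g (fun i => chi d2 h179 (K1.getD i []))
    (fun i j => by
      rw [← step1_chk i j]
      refine chi_apply _ _ _ _ _ (hg j) _ fun k hk => ?_
      obtain ⟨h1, h2, h3⟩ := B1_ok j
      exact sgnc_eu _ _ h1 h2 (K1_cop i k hk))
    ε (fun i => by
      rw [chi_apply _ _ _ _ _ hε (fun _ => 1) (fun k _ => sgnc_conj k _ h1z.ne_zero)]
      simp)
    (fun v hv => by
      have h1 := congrArg (fun t : (𝓞 (FF K d2))ˣ =>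
        ev K (2 : ZMod 181) phi_181 (algebraMap (𝓞 (FF K d2)) (𝓞 K) t)) hv
      simp only [Units.val_pow_eq_pow_val, map_pow, hε, smul_sub, smul_one,
        s_z (show Nat.Coprime 179 180 by decide), map_mul, map_sub, map_one, ev_z] at h1
      exact nonsq_181 _ h1) u
  have hT0 : T = ∅ := by
    rw [Finset.eq_empty_iff_forall_notMem]
    intro i hi
    have := hT i
    rw [if_pos hi, chi_apply _ _ _ _ _ rfl (fun _ => 1) (fun k _ => hu k)] at this
    simp at this
  rw [hT0, Finset.prod_empty, one_mul] at hv
  refine ⟨(1 - z K) ^ e * algebraMap (𝓞 (FF K d2)) (𝓞 K) v, (h1z.pow e).mul (v.isUnit.map _), ?_⟩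
  rw [smul_mul', fix179_d2, hv, smul_pow', Units.val_mul, map_mul, Units.val_pow_eq_pow_val, map_pow, hε,
    Units.val_pow_eq_pow_val, map_pow, mul_pow]
  ring

theorem step1_inv (I : Ideal (𝓞 K)) (hst : ∀ x ∈ I, s K 179 • x ∈ I) :
    (I.comap (algebraMap (𝓞 (FF K d2)) (𝓞 K))).map (algebraMap (𝓞 (FF K d2)) (𝓞 K)) = I := by
  apply le_antisymm Ideal.map_comap_le
  intro x hx
  have h1 : z K * z K ^ 179 = 1 := by rw [← pow_succ', z_pow]
  have hc : s K 179 • (z K ^ 179) = z K := by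
    rw [smul_pow', s_z (show Nat.Coprime 179 180 by decide), ← pow_mul, ← z_pow_mod]; norm_num
  have hc1 : s K 179 • z K = z K ^ 179 := s_z (show Nat.Coprime 179 180 by decide)
  obtain ⟨y, hy⟩ : ∃ y, y = z K ^ 179 := ⟨_, rfl⟩
  rw [← hy] at h1 hc hc1
  have hu : IsUnit (z K - y) := by
    have : z K - y = - (y * (1 - z K ^ 2)) := by linear_combination (-z K) * h1
    rw [this]
    exact ((isUnit_of_mul_isUnit_right (h1 ▸ isUnit_one)).mul
      (unit_one_sub 2 (by decide +kernel))).neg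
  obtain ⟨D, hD⟩ := hu.exists_right_inv
  have hDc : s K 179 • D = - D := by
    have := congrArg (fun t => s K 179 • t) hD
    simp only [smul_mul', smul_sub, hc, hc1, smul_one] at this
    apply hu.mul_left_cancel
    linear_combination - this - hD + 2 * hD
  have hfix : ∀ p ∈ I, s K 179 • p = p →
      p ∈ (I.comap (algebraMap (𝓞 (FF K d2)) (𝓞 K))).map (algebraMap (𝓞 (FF K d2)) (𝓞 K)) := by
    intro p hp hpf
    obtain ⟨p', rfl⟩ := exists_of_fixed d2 p (fix_d2 _ hpf)
    exact Ideal.mem_map_of_mem _ hp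
  have e : x = (s K 179 • x * z K - x * y) * D + (x - s K 179 • x) * D * z K := by
    linear_combination (-x) * hD
  rw [e]
  apply Ideal.add_mem
  · apply hfix
    · exact I.mul_mem_right _ (I.sub_mem (I.mul_mem_right _ (hst x hx)) (I.mul_mem_right _ hx))
    · rw [smul_mul', smul_sub, smul_mul', smul_mul', conj_conj, hc, hc1, hDc]; ring
  · apply Ideal.mul_mem_right
    apply hfix
    · exact I.mul_mem_right _ (I.sub_mem hx (hst x hx))
    · rw [smul_mul', smul_sub, conj_conj, hDc]; ring

theorem step1 (c : ClassGroup (𝓞 K)) (hc : c ^ 2 = 1) : c = 1 := by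
  refine lemD (MulSemiringAction.toRingHom Gal(K/ℚ) (𝓞 K) (s K 179)) conj_conj ?_ ?_ c hc
  · intro u a b hu ha h
    change u * (a * s K 179 • a) = b * s K 179 • b at h
    have hta : s K 179 • a ≠ 0 := fun h => ha ((smul_eq_zero_iff_eq _).mp h)
    have hfix : s K 179 • u = u := by
      have h' := congrArg (fun t => s K 179 • t) h
      simp only [smul_mul', conj_conj] at h'
      rw [mul_comm (s K 179 • a), mul_comm (s K 179 • b), ← h] at h'
      exact mul_right_cancel₀ (mul_ne_zero ha hta) h'
    have hb : b ≠ 0 := by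
      rintro rfl
      rw [zero_mul] at h
      exact mul_ne_zero hu.ne_zero (mul_ne_zero ha hta) h
    obtain ⟨m, hm⟩ := exists_unit_of_fixed d2 u hu (fix_d2 _ hfix)
    obtain ⟨w, hw, e⟩ := step1_U m (fun k => by
      have := sgnc_conj k b hb
      rwa [← h, sgnc_mul _ _ _ hfix, sgnc_conj k a ha, mul_one, ← hm] at this)
    exact ⟨w, hw, by rw [← hm]; exact e⟩
  · intro I hI hst
    have hI' := step1_inv I hst
    generalize I.comap (algebraMap (𝓞 (FF K d2)) (𝓞 K)) = J at hI'
    have hJ : J ≠ ⊥ := by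
      rintro rfl
      rw [Ideal.map_bot] at hI'
      exact hI hI'.symm
    have hodd := coprime_two_of (ClassGroup (𝓞 (FF K d2))) step2
    refine ⟨Nat.card (ClassGroup (𝓞 (FF K d2))), Nat.coprime_two_right.mp hodd, ?_⟩
    have h1 : cl J ^ Nat.card (ClassGroup (𝓞 (FF K d2))) = 1 := pow_card_eq_one'
    rw [← cl_pow hJ, cl_eq_one (pow_ne_zero _ hJ)] at h1
    obtain ⟨x, -, hx⟩ := h1
    rw [← cl_pow hI, ← hI', ← Ideal.map_pow, hx, Ideal.map_span, Set.image_singleton, cl_span]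

theorem odd_card : (Nat.card (ClassGroup (𝓞 K))).Coprime 2 := coprime_two_of _ step1

end step1
end C180
end

section
open NumberField Polynomial
open scoped Pointwise nonZeroDivisors

namespace C180
section
variable {K : Type*} [Field K] [NumberField K] [hK : IsCyclotomicExtension {180} ℚ K]
variable {hl reps : List ℕ}

/-- evaluation at 4, reduced exponents -/
def ev4 (k : ℕ) (l : List (ℤ × ℕ)) : ℤ := (l.map fun p => p.1 * ((4 ^ (p.2 * k % 180) : ℕ) : ℤ)).sum

/-- product of conjugates mod `NN` -/
def val4 (l : List (ℤ × ℕ)) : List ℕ → ℤ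
  | [] => 1
  | k :: ks => (val4 l ks * ev4 k l) % (NN : ℤ)

theorem ev4_spec (k : ℕ) (l : List (ℤ × ℕ)) : ((ev4 k l : ℤ) : ZMod NN) = evl (4 : ZMod NN) (tw k l) := by
  induction l with
  | nil => simp [ev4, evl, tw]
  | cons p l ih =>
    simp only [ev4, evl, tw, List.map_cons, List.sum_cons, Int.cast_add, Int.cast_mul] at ih ⊢
    rw [ih]
    congr 2
    rw [Int.cast_natCast, Nat.cast_pow, Nat.cast_ofNat]
    exact four_pow _

theorem val4_spec (l : List (ℤ × ℕ)) (ks : List ℕ) :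
    ((val4 l ks : ℤ) : ZMod NN) = (ks.map fun k => evl (4 : ZMod NN) (tw k l)).prod := by
  induction ks with
  | nil => simp [val4]
  | cons k ks ih =>
    rw [val4, ZMod.intCast_mod, Int.cast_mul, ih, ev4_spec, List.map_cons, List.prod_cons, mul_comm]

theorem absNorm_el (d : HD hl reps) (l : List (ℤ × ℕ)) (hx : ∀ σ ∈ Hs K d, σ • el K l = el K l)
    (m : ℕ) (hw : 2 * (wt l) ^ reps.length < NN) (hm : absv NN (val4 l reps).toNat = m)
    (hv : 0 ≤ val4 l reps ∧ val4 l reps < NN) :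
    Ideal.absNorm (Ideal.span {el K l}) = m ^ hl.length := by
  obtain ⟨n, hn⟩ := pn_int d _ hx
  have h1 := ev_pn (K := K) (4 : ZMod NN) Phi4 reps d.rcop l
  rw [hn, map_intCast, ← val4_spec] at h1
  have h2 := abs_pn_int reps d.rcop l n hn
  have h3 : n.natAbs = m := by
    rw [← hm]
    apply absv_spec
    · rw [h1, ← Int.cast_natCast, Int.toNat_of_nonneg hv.1]
    · omega
    · omega
  have h4 := pn_pow d _ hx
  rw [hn] at h4
  have h5 : Algebra.norm ℤ (el K l) = n ^ hl.length := by exact_mod_cast h4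
  rw [Ideal.absNorm_span_singleton, h5, Int.natAbs_pow, h3]

theorem d1 : HD [1] L48 := ⟨by decide +kernel, by decide +kernel, by decide +kernel, by decide +kernel, by decide +kernel,
    by decide +kernel, by decide +kernel, by decide +kernel, by decide +kernel, by decide +kernel⟩

theorem fix_d1 (x : 𝓞 K) : ∀ σ ∈ Hs K d1, σ • x = x := by
  rintro σ ⟨h, hh, rfl⟩
  rw [List.mem_singleton.mp hh, s_one, one_smul]

theorem residue1 (Q : Ideal (𝓞 K)) [hQ : Q.IsPrime] (h0 : Q ≠ ⊥) (m t : ℕ) (hmt : m * t = 180)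
    (hm : (m : 𝓞 K) ∉ Q) : Ideal.absNorm Q % m = 1 % m := by
  have hsurj : Function.Surjective (algebraMap (𝓞 (FF K d1)) (𝓞 K)) := fun x => by
    obtain ⟨y, hy⟩ := exists_of_fixed d1 x (fix_d1 x)
    exact ⟨y, hy⟩
  have hmap := Ideal.map_comap_of_surjective _ hsurj Q
  obtain ⟨h, hh, e⟩ := residue d1 (Q.comap (algebraMap (𝓞 (FF K d1)) (𝓞 K)))
    (by intro h; rw [h, Ideal.map_bot] at hmap; exact h0 hmap.symm) m t hmt
    (by rw [Ideal.mem_comap, map_natCast]; exact hm)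
  have := absNorm_map (K := K) d1 (Q.comap (algebraMap (𝓞 (FF K d1)) (𝓞 K)))
  rw [hmap, List.length_singleton, pow_one] at this
  rw [this, ← e, List.mem_singleton.mp hh]

theorem not_mem_of_coprime {R : Type*} [CommRing R] (Q : Ideal R) (hQ : Q ≠ ⊤) (p m : ℕ) (h : p.Coprime m)
    (hp : (p : R) ∈ Q) : (m : R) ∉ Q := by
  intro hm
  apply hQ
  rw [Ideal.eq_top_iff_one]
  have : IsCoprime (p : R) (m : R) := by
    have := (Nat.isCoprime_iff_coprime.mpr h).map (Int.castRingHom R)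
    simpa using this
  obtain ⟨a, b, e⟩ := this
  rw [← e]
  exact Q.add_mem (Q.mul_mem_left _ hp) (Q.mul_mem_left _ hm)

theorem conj_mem (Q : Ideal (𝓞 K)) [hQ : Q.IsPrime] (x : 𝓞 K) (p e : ℕ)
    (hx : Ideal.absNorm (Ideal.span {x}) = p ^ e) (hp : (p : 𝓞 K) ∈ Q) (he : e ≠ 0) : ∃ g : Gal(K/ℚ), g • x ∈ Q := by
  have h1 := norm_eq_prod x
  have h2 : ((Algebra.norm ℤ x : ℤ) : 𝓞 K) ∈ Q := by
    rw [Ideal.absNorm_span_singleton] at hx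
    have h3 : ((p ^ e : ℕ) : 𝓞 K) ∈ Q := by
      rw [Nat.cast_pow]; exact Ideal.pow_mem_of_mem Q hp e (Nat.pos_of_ne_zero he)
    rcases Int.natAbs_eq (Algebra.norm ℤ x) with h | h
    · rw [h, hx, Int.cast_natCast]; exact h3
    · rw [h, hx, Int.cast_neg, Int.cast_natCast]; exact Q.neg_mem h3
  rw [h1] at h2
  obtain ⟨g, -, hg⟩ := (hQ.prod_mem_iff).mp h2
  exact ⟨g, hg⟩

theorem absNorm_span_smul (g : Gal(K/ℚ)) (x : 𝓞 K) :
    Ideal.absNorm (Ideal.span {g • x}) = Ideal.absNorm (Ideal.span {x}) := by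
  rw [← absNorm_gsmul g (Ideal.span {x})]
  congr 1
  change _ = Ideal.map _ _
  rw [Ideal.map_span, Set.image_singleton]
  rfl

theorem norm_dvd (Q : Ideal (𝓞 K)) (x : 𝓞 K) (h : x ∈ Q) : Ideal.absNorm Q ∣ Ideal.absNorm (Ideal.span {x}) :=
  map_dvd _ (Ideal.dvd_iff_le.mpr ((Ideal.span_singleton_le_iff_mem Q).mpr h))

theorem small_prime (p e m t : ℕ) (x : 𝓞 K) (hp : p.Prime) (hx : Ideal.absNorm (Ideal.span {x}) = p ^ e)
    (he : e ≠ 0) (hmt : m * t = 180) (hm : 1 < m)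
    (hj : ∀ j ≤ e, j ≠ 0 → p ^ j % m = 1 → j = e) (hpm : p.Coprime m)
    (Q : Ideal (𝓞 K)) (hQ : Q.IsPrime) (h0 : Q ≠ ⊥) (h : (p : 𝓞 K) ∈ Q) : cl Q = 1 := by
  obtain ⟨g, hg⟩ := conj_mem Q x p e hx h he
  have h1 := norm_dvd Q _ hg
  rw [absNorm_span_smul, hx] at h1
  obtain ⟨j, hje, hjn⟩ := (Nat.dvd_prime_pow hp).mp h1
  have h2 := residue1 Q h0 m t hmt (not_mem_of_coprime Q hQ.ne_top p m hpm h)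
  rw [Nat.mod_eq_of_lt hm] at h2
  have hj0 : j ≠ 0 := by
    rintro rfl
    rw [pow_zero, Ideal.absNorm_eq_one_iff] at hjn
    exact hQ.ne_top hjn
  rw [hjn] at h2
  have := hj j hje hj0 h2
  subst this
  have hgx : g • x ≠ 0 := by
    intro h
    rw [← absNorm_span_smul g, h] at hx
    simp at hx
    exact (pow_ne_zero j hp.ne_zero hx.symm).elim
  have hs : Ideal.span {g • x} = Q :=
    eq_of_le_of_norm h0 ((Ideal.span_singleton_le_iff_mem Q).mpr hg) (by
      rw [absNorm_span_smul, hx, hjn])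
  exact (cl_eq_one h0).mpr ⟨_, hgx, hs.symm⟩

theorem cl_two (Q : Ideal (𝓞 K)) (hQ : Q.IsPrime) (h0 : Q ≠ ⊥) (h : ((2 : ℕ) : 𝓞 K) ∈ Q) : cl Q = 1 :=
  small_prime 2 12 45 4 (el K [(1, 0), (1, 3), (-1, 12)]) (by norm_num) (by
    rw [absNorm_el d1 _ (fix_d1 _) (2 ^ 12) (by decide +kernel) (by decide +kernel) (by decide +kernel)]; simp)
    (by norm_num) (by norm_num) (by norm_num) (by decide) (by decide) Q hQ h0 h

theorem cl_five (Q : Ideal (𝓞 K)) (hQ : Q.IsPrime) (h0 : Q ≠ ⊥) (h : ((5 : ℕ) : 𝓞 K) ∈ Q) : cl Q = 1 :=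
  small_prime 5 6 36 5 (el K [(1, 0), (1, 9), (-1, 27)]) (by norm_num) (by
    rw [absNorm_el d1 _ (fix_d1 _) (5 ^ 6) (by decide +kernel) (by decide +kernel) (by decide +kernel)]; simp)
    (by norm_num) (by norm_num) (by norm_num) (by decide) (by decide) Q hQ h0 h

end
end C180
end

section
open NumberField Polynomial
open scoped Pointwise nonZeroDivisors

namespace C180
section
variable {K : Type*} [Field K] [NumberField K] [hK : IsCyclotomicExtension {180} ℚ K]

theorem root_of_conj (v : 𝓞 K) (h : v * s K 179 • v = 1) : v ^ 180 = 1 := by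
  have h1 : ∀ φ : K →+* ℂ, ‖φ (v : K)‖ = 1 := by
    intro φ
    have e : φ (v : K) * starRingEnd ℂ (φ (v : K)) = 1 := by
      rw [conj_emb, ← coe_gsmul, ← map_mul]
      change φ (algebraMap (𝓞 K) K v * algebraMap (𝓞 K) K (s K 179 • v)) = 1
      rw [← map_mul, h, map_one, map_one]
    rw [Complex.mul_conj, Complex.normSq_eq_norm_sq] at e
    have e2 : ‖φ (v : K)‖ ^ 2 = 1 := by exact_mod_cast e
    nlinarith [norm_nonneg (φ (v : K))]
  obtain ⟨n, hn, hv⟩ := Embeddings.pow_eq_one_of_norm_eq_one K ℂ (RingOfIntegers.isIntegral_coe v) h1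
  have ho : 0 < orderOf (v : K) := orderOf_pos_iff.mpr (isOfFinOrder_iff_pow_eq_one.mpr ⟨n, hn, hv⟩)
  have hp := IsPrimitiveRoot.orderOf (v : K)
  have : NeZero (orderOf (v : K)) := ⟨ho.ne'⟩
  have h2 := NumberField.Units.dvd_torsionOrder_of_isPrimitiveRoot hp
  rw [IsCyclotomicExtension.Rat.torsionOrder_eq (n := 180) (K := K), if_pos (by decide)] at h2
  apply RingOfIntegers.coe_injective
  change algebraMap (𝓞 K) K (v ^ 180) = algebraMap (𝓞 K) K 1
  rw [map_pow, map_one]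
  exact orderOf_dvd_iff_pow_eq_one.mp h2

variable (K) in
/-- element of norm `3^24` -/
noncomputable def be : 𝓞 K := z K ^ 18 + z K ^ 162 + z K ^ 45 - z K ^ 63 - z K ^ 27

variable (K) in
/-- its conjugate -/
noncomputable def bc : 𝓞 K := z K ^ 18 + z K ^ 162 - z K ^ 45 + z K ^ 63 + z K ^ 27

theorem conj_z (n m : ℕ) (h : n * 179 % 180 = m % 180) : s K 179 • z K ^ n = z K ^ m := by
  rw [smul_pow', s_z (by decide), ← pow_mul, ← z_pow_mod, mul_comm 179, h, z_pow_mod]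

theorem conj_be : s K 179 • be K = bc K := by
  rw [be, bc, smul_sub, smul_sub, smul_add, smul_add, conj_z 18 162 rfl, conj_z 162 18 rfl, conj_z 45 135 rfl,
    conj_z 63 117 rfl, conj_z 27 153 rfl]
  linear_combination (z K ^ 45 - z K ^ 27 - z K ^ 63) * z90 (K := K)

theorem conj_bc : s K 179 • bc K = be K := by
  rw [← conj_be, conj_conj]

theorem be_bc : be K * bc K = 3 := by
  have h90 := z90 (K := K)
  have h36 := z36 (K := K)
  have h5 := phi5 (K := K)
  have h162 : z K ^ 162 = - z K ^ 72 := by linear_combination z K ^ 72 * h90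
  have t : (z K ^ 45 - z K ^ 63 - z K ^ 27) ^ 2 = z K ^ 18 + z K ^ 162 - 2 := by
    linear_combination (3 - z K ^ 18 + z K ^ 36 + z K ^ 54 - z K ^ 72) * h90 - h36
  rw [be, bc]
  linear_combination h5 - t

theorem be_norm : Ideal.absNorm (Ideal.span {be K}) = 3 ^ 24 := by
  have h1 : Ideal.absNorm (Ideal.span {be K} * Ideal.span {bc K}) = 3 ^ 48 := by
    rw [Ideal.span_singleton_mul_span_singleton, be_bc]
    have := finrank_int K 3
    rw [IsCyclotomicExtension.Rat.finrank 180 K] at this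
    exact_mod_cast this
  rw [map_mul, ← conj_be, absNorm_span_smul, ← sq] at h1
  have : (3 ^ 24) ^ 2 = 3 ^ 48 := by norm_num
  rw [← this] at h1
  exact Nat.pow_left_injective two_ne_zero h1

variable (K) in
/-- lambda -/
noncomputable def la : 𝓞 K := 1 - z K ^ 20

theorem la_norm : Ideal.absNorm (Ideal.span {la K}) = 3 ^ 8 := by
  have : la K = el K [(1, 0), (-1, 20)] := by simp [la, el]; ring
  rw [this, absNorm_el d1 _ (fix_d1 _) (3 ^ 8) (by decide +kernel) (by decide +kernel) (by decide +kernel)]; simp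

theorem la_pow : Ideal.span {la K} ^ 6 = Ideal.span {(3 : 𝓞 K)} := by
  symm
  rw [Ideal.span_singleton_pow]
  have h3 : (3 : 𝓞 K) ≠ 0 := by norm_num
  apply eq_of_le_of_norm
  · rw [← Ideal.span_singleton_pow]
    apply pow_ne_zero
    intro h
    have := la_norm (K := K)
    rw [h] at this
    simp at this
  · rw [Ideal.span_singleton_le_span_singleton]
    have e : (3 : 𝓞 K) = ((1 - z K ^ 20) * (1 - z K ^ 40)) * ((1 - z K ^ 80) * (1 - z K ^ 100)) *
        ((1 - z K ^ 140) * (1 - z K ^ 160)) := by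
      have h60 := z60 (K := K)
      have a : ∀ x : 𝓞 K, x ^ 6 + x ^ 3 + 1 = 0 → 3 = ((1 - x) * (1 - x ^ 2)) * ((1 - x ^ 4) * (1 - x ^ 5)) *
        ((1 - x ^ 7) * (1 - x ^ 8)) := by
        intro x hx
        have h9 : x ^ 9 = 1 := by linear_combination (x ^ 3 - 1) * hx
        have h8 : (1 - x) * (1 - x ^ 8) = 2 - x - x ^ 8 := by linear_combination h9
        have h7 : (1 - x ^ 2) * (1 - x ^ 7) = 2 - x ^ 2 - x ^ 7 := by linear_combination h9
        have h5 : (1 - x ^ 4) * (1 - x ^ 5) = 2 - x ^ 4 - x ^ 5 := by linear_combination h9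
        have hh : (2 - x - x ^ 8) * (2 - x ^ 2 - x ^ 7) * (2 - x ^ 4 - x ^ 5) = 3 := by
          linear_combination ((5) * x ^ 0 + (-4) * x ^ 1 + (-4) * x ^ 2 + (-3) * x ^ 3 + (2) * x ^ 5 + (2) * x ^ 6 + (1) * x ^ 7 + (-1) * x ^ 8 + (1) * x ^ 9 + (1) * x ^ 10 + (1) * x ^ 11 + (-1) * x ^ 13 + (-1) * x ^ 14) * hx
        linear_combination -hh - (2 - x ^ 2 - x ^ 7) * (2 - x ^ 4 - x ^ 5) * h8 -
          (1 - x) * (1 - x ^ 8) * (2 - x ^ 4 - x ^ 5) * h7 - (1 - x) * (1 - x ^ 8) * (1 - x ^ 2) * (1 - x ^ 7) * h5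
      have := a (z K ^ 20) (by linear_combination h60)
      simp only [← pow_mul] at this
      exact this
    rw [e, la]
    have : (1 - z K ^ 20) ^ 6 = ((1 - z K ^ 20) * (1 - z K ^ 20)) * ((1 - z K ^ 20) * (1 - z K ^ 20)) *
        ((1 - z K ^ 20) * (1 - z K ^ 20)) := by ring
    rw [this]
    exact mul_dvd_mul (mul_dvd_mul (mul_dvd_mul dvd_rfl (dvd_one_sub 20 2 40 rfl))
      (mul_dvd_mul (dvd_one_sub 20 4 80 rfl) (dvd_one_sub 20 5 100 rfl)))
      (mul_dvd_mul (dvd_one_sub 20 7 140 rfl) (dvd_one_sub 20 8 160 rfl))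
  · have := finrank_int K 3
    rw [IsCyclotomicExtension.Rat.finrank 180 K] at this
    rw [← Ideal.span_singleton_pow, map_pow, la_norm]
    exact_mod_cast this

theorem smul_span (g : Gal(K/ℚ)) (x : 𝓞 K) : g • Ideal.span {x} = Ideal.span {g • x} := by
  rw [Ideal.smul_closure, Set.smul_set_singleton]

theorem be_prime (Q : Ideal (𝓞 K)) (hQ : Q.IsPrime) (h : be K ∈ Q) :
    Q ≠ ⊥ ∧ Q * s K 179 • Q = Ideal.span {la K} ∧ Q ^ 6 = Ideal.span {be K} := by
  have hb0 : be K ≠ 0 := by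
    intro h
    have := be_bc (K := K)
    rw [h] at this
    norm_num at this
  have h0 : Q ≠ ⊥ := by
    rintro rfl
    exact hb0 h
  have h3 : (3 : 𝓞 K) ∈ Q := by rw [← be_bc]; exact Q.mul_mem_right _ h
  have h3n : ((3 : ℕ) : 𝓞 K) ∈ Q := by exact_mod_cast h3
  have hc : bc K ∉ Q := by
    intro hc
    have h1 := Q.add_mem h hc
    have h2 : be K + bc K = 2 * (z K ^ 18 + z K ^ 162) := by rw [be, bc]; ring
    rw [h2] at h1
    have h4 := Q.mul_mem_right (2 * (z K ^ 18 + z K ^ 162 - 1)) h1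
    have h5 : 2 * (z K ^ 18 + z K ^ 162) * (2 * (z K ^ 18 + z K ^ 162 - 1)) = ((4 : ℕ) : 𝓞 K) := by
      push_cast
      linear_combination 4 * phi5 (K := K)
    rw [h5] at h4
    exact not_mem_of_coprime Q hQ.ne_top 3 4 (by decide) h3n h4
  set Q' := s K 179 • Q with hQ'
  have hQp' : Q'.IsPrime := Ideal.IsPrime.smul _
  have h0' : Q' ≠ ⊥ := gsmul_ne_bot _ h0
  have hb' : be K ∉ Q' := by
    rw [hQ', ← conj_bc, Ideal.smul_mem_pointwise_smul_iff]
    exact hc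
  have h3' : (3 : 𝓞 K) ∈ Q' := by
    rw [← be_bc, mul_comm]
    refine Q'.mul_mem_right _ ?_
    rw [hQ', ← conj_be, Ideal.smul_mem_pointwise_smul_iff]
    exact h
  have hla : ∀ R : Ideal (𝓞 K), R.IsPrime → (3 : 𝓞 K) ∈ R → la K ∈ R := by
    intro R hR hR3
    have : la K ^ 6 ∈ R := by
      refine (Ideal.span_singleton_le_iff_mem R).mpr hR3 ?_
      rw [← la_pow, Ideal.span_singleton_pow]
      exact Ideal.mem_span_singleton_self _
    exact hR.mem_of_pow_mem _ this
  have hm : Q.IsMaximal := hQ.isMaximal h0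
  have hm' : Q'.IsMaximal := hQp'.isMaximal h0'
  have hne : Q ≠ Q' := fun e => hb' (e ▸ h)
  have hle : Ideal.span {la K} ≤ Q * Q' := by
    rw [Ideal.mul_eq_inf_of_isCoprime (Ideal.isCoprime_of_isMaximal hne), Ideal.span_singleton_le_iff_mem]
    exact ⟨hla Q hQ h3, hla Q' hQp' h3'⟩
  have hn' : Ideal.absNorm Q' = Ideal.absNorm Q := absNorm_gsmul _ _
  have hQ81 : Ideal.absNorm Q = 3 ^ 4 := by
    have h1 : Ideal.absNorm (Q * Q') ∣ Ideal.absNorm (Ideal.span {la K}) := map_dvd _ (Ideal.dvd_iff_le.mpr hle)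
    rw [la_norm, map_mul, hn'] at h1
    obtain ⟨j, hj, hjn⟩ := (Nat.dvd_prime_pow Nat.prime_three).mp ((dvd_mul_right _ _).trans h1)
    have h2 := residue1 Q h0 20 9 rfl (not_mem_of_coprime Q hQ.ne_top 3 20 (by decide) h3n)
    rw [hjn] at h2 h1 ⊢
    have hj0 : j ≠ 0 := by
      rintro rfl
      rw [pow_zero, Ideal.absNorm_eq_one_iff] at hjn
      exact hQ.ne_top hjn
    rw [← pow_add, Nat.pow_dvd_pow_iff_le_right (by norm_num)] at h1
    have : j ≤ 4 := by omega
    interval_cases j <;> simp_all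
  have e1 : Q * Q' = Ideal.span {la K} := by
    symm
    apply eq_of_le_of_norm (mul_ne_zero h0 h0') hle
    rw [la_norm, map_mul, hn', hQ81]; norm_num
  refine ⟨h0, e1, ?_⟩
  symm
  apply eq_of_le_of_norm (pow_ne_zero 6 h0)
  · rw [← Ideal.dvd_iff_le]
    have e2 : Q ^ 6 ∣ Ideal.span {be K} * Ideal.span {bc K} := by
      rw [Ideal.span_singleton_mul_span_singleton, be_bc, ← la_pow, ← e1, mul_pow]
      exact dvd_mul_right _ _
    refine IsCoprime.dvd_of_dvd_mul_right ?_ e2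
    apply IsCoprime.pow_left
    rw [Ideal.isCoprime_iff_sup_eq]
    by_contra hne
    have := hm.eq_of_le hne le_sup_left
    apply hc
    rw [this]
    exact Ideal.mem_sup_right (Ideal.mem_span_singleton_self _)
  · rw [be_norm, map_pow, hQ81]; norm_num

theorem exists_be_prime : ∃ Q : Ideal (𝓞 K), Q.IsPrime ∧ be K ∈ Q := by
  obtain ⟨Q, hQ, hle⟩ := Ideal.exists_le_maximal (Ideal.span {be K}) (by
    intro h
    have := be_norm (K := K)
    rw [h] at this
    simp at this)
  exact ⟨Q, hQ.isPrime, (Ideal.span_singleton_le_iff_mem Q).mp hle⟩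

theorem be_unique (Q Q' : Ideal (𝓞 K)) (hQ : Q.IsPrime) (h : be K ∈ Q) (hQ' : Q'.IsPrime) (h' : be K ∈ Q') :
    Q = Q' := by
  obtain ⟨h0, -, h6⟩ := be_prime Q hQ h
  refine (hQ.isMaximal h0).eq_of_le hQ'.ne_top fun x hx => ?_
  refine hQ'.mem_of_pow_mem 6 ((Ideal.span_singleton_le_iff_mem Q').mpr h' ?_)
  rw [← h6]
  exact Ideal.pow_mem_pow hx 6

variable (K) in
/-- the prime above 3 -/
noncomputable def Q3 : Ideal (𝓞 K) := exists_be_prime.choose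

theorem Q3_prime : (Q3 K).IsPrime := exists_be_prime.choose_spec.1
theorem Q3_mem : be K ∈ Q3 K := exists_be_prime.choose_spec.2

variable (K) in
/-- its class -/
noncomputable def cw : ClassGroup (𝓞 K) := cl (Q3 K)

theorem cw_three : cw K ^ 3 = 1 := by
  obtain ⟨h0, -, h6⟩ := be_prime _ Q3_prime (Q3_mem (K := K))
  have h1 : (cw K ^ 3) ^ 2 = 1 := by
    rw [← pow_mul, cw, ← cl_pow h0, h6, cl_span]
  have hodd : Odd (Nat.card (ClassGroup (𝓞 K))) := Nat.coprime_two_right.mp odd_card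
  exact eq_one_of_odd hodd pow_card_eq_one' h1

theorem cl_three (Q : Ideal (𝓞 K)) (hQ : Q.IsPrime) (h : ((3 : ℕ) : 𝓞 K) ∈ Q) :
    cl Q = cw K ∨ cl Q = (cw K)⁻¹ := by
  have h1 : be K * bc K ∈ Q := by rw [be_bc]; exact_mod_cast h
  rcases hQ.mem_or_mem h1 with h2 | h2
  · left; rw [be_unique Q _ hQ h2 Q3_prime Q3_mem]; rfl
  · right
    have h3 : be K ∈ s K 179 • Q := by
      rw [← conj_bc, Ideal.smul_mem_pointwise_smul_iff]; exact h2
    obtain ⟨h0, e, -⟩ := be_prime _ (Ideal.IsPrime.smul _) h3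
    rw [← mul_smul, s179_179, one_smul] at e
    have hQ0 : Q ≠ ⊥ := by
      rintro rfl
      exact h0 (Ideal.smul_bot _)
    have h4 : cl (s K 179 • Q) * cl Q = 1 := by rw [← cl_mul h0 hQ0, e, cl_span]
    rw [be_unique _ _ (Ideal.IsPrime.smul _) h3 Q3_prime Q3_mem] at h4
    exact eq_inv_of_mul_eq_one_right h4

theorem phi_541 : Phi (8 : ZMod 541) = 0 := by decide +kernel

instance : Fact (Nat.Prime 541) := ⟨by norm_num⟩

theorem cw_ne_one : cw K ≠ 1 := by
  intro hw
  obtain ⟨h0, -, h6⟩ := be_prime _ Q3_prime (Q3_mem (K := K))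
  obtain ⟨γ, hγ, e⟩ := (cl_eq_one h0).mp hw
  rw [e, Ideal.span_singleton_pow, Ideal.span_singleton_eq_span_singleton] at h6
  obtain ⟨u, hu⟩ := h6
  have hu' := congrArg (fun x => s K 179 • x) hu
  simp only [smul_mul', smul_pow', conj_be] at hu'
  -- v = u / ū
  obtain ⟨ui, hui⟩ := u.isUnit.exists_right_inv
  have hui' : s K 179 • (u : 𝓞 K) * s K 179 • ui = 1 := by rw [← smul_mul', hui, smul_one]
  have hv := root_of_conj ((u : 𝓞 K) * s K 179 • ui) (by
    rw [smul_mul', conj_conj]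
    linear_combination hui' + s K 179 • (u : 𝓞 K) * s K 179 • ui * hui)
  have key : be K * (s K 179 • γ) ^ 6 = ((u : 𝓞 K) * s K 179 • ui) * (bc K * γ ^ 6) := by
    rw [← hu, ← hu']
    linear_combination - γ ^ 6 * u * (s K 179 • γ) ^ 6 * hui'
  have key2 : be K ^ 180 * (s K 179 • γ) ^ 1080 = bc K ^ 180 * γ ^ 1080 := by
    have := congrArg (fun x => x ^ 180) key
    simp only [mul_pow, ← pow_mul] at this hv
    rw [hv, one_mul] at this
    exact this
  have h1 := congrArg (ev K (8 : ZMod 541) phi_541) key2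
  have hb : ev K (8 : ZMod 541) phi_541 (be K) ≠ 0 := by
    simp only [be, map_add, map_sub, map_pow, ev_z]; decide +kernel
  have hc : ev K (8 : ZMod 541) phi_541 (bc K) ≠ 0 := by
    simp only [bc, map_add, map_sub, map_pow, ev_z]; decide +kernel
  have g1 : ev K (8 : ZMod 541) phi_541 γ ≠ 0 := by
    intro h; apply hb; rw [← hu, map_mul, map_pow, h]; ring
  have g2 : ev K (8 : ZMod 541) phi_541 (s K 179 • γ) ≠ 0 := by
    intro h; apply hc; rw [← hu', map_mul, map_pow, h]; ring
  have f1 : ∀ x : ZMod 541, x ≠ 0 → x ^ 1080 = 1 := by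
    intro x hx
    have := ZMod.pow_card_sub_one_eq_one hx
    rw [show 1080 = (541 - 1) * 2 by norm_num, pow_mul, this, one_pow]
  rw [map_mul, map_mul, map_pow, map_pow, map_pow, map_pow, f1 _ g1, f1 _ g2, mul_one, mul_one] at h1
  simp only [be, bc, map_add, map_sub, map_pow, ev_z] at h1
  revert h1
  decide +kernel

end
end C180
end

section
open NumberField Polynomial
open scoped Pointwise nonZeroDivisors

namespace C180
section
variable {K : Type*} [Field K] [NumberField K] [hK : IsCyclotomicExtension {180} ℚ K]

instance : Fact (Nat.Prime 181) := ⟨by norm_num⟩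
instance : Fact (Nat.Prime 1801) := ⟨by norm_num⟩

/-- evaluation with reduced exponents -/
def evr (r k : ℕ) (l : List (ℤ × ℕ)) : ℤ := (l.map fun p => p.1 * ((r ^ (p.2 * k % 180) : ℕ) : ℤ)).sum

theorem evr_spec (p r k : ℕ) (h : (r : ZMod p) ^ 180 = 1) (l : List (ℤ × ℕ)) :
    ((evr r k l : ℤ) : ZMod p) = evl (r : ZMod p) (tw k l) := by
  have hr : ∀ e : ℕ, (r : ZMod p) ^ (e % 180) = (r : ZMod p) ^ e := by
    intro e
    conv_rhs => rw [← Nat.div_add_mod e 180, pow_add, pow_mul, h, one_pow, one_mul]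
  induction l with
  | nil => simp [evr, evl, tw]
  | cons q l ih =>
    simp only [evr, evl, tw, List.map_cons, List.sum_cons, Int.cast_add, Int.cast_mul] at ih ⊢
    rw [ih]
    congr 2
    rw [Int.cast_natCast, Nat.cast_pow]
    exact hr _

variable (K) in
/-- A prime above 181. -/
noncomputable def P1 : Ideal (𝓞 K) := RingHom.ker (ev K (2 : ZMod 181) phi_181)

theorem mem_P1 (x : 𝓞 K) : x ∈ P1 K ↔ ev K (2 : ZMod 181) phi_181 x = 0 := Iff.rfl

instance P1_prime : (P1 K).IsPrime := RingHom.ker_isPrime _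

theorem P1_181 : ((181 : ℕ) : 𝓞 K) ∈ P1 K := by
  rw [mem_P1, map_natCast, ZMod.natCast_self]

theorem P1_bot : P1 K ≠ ⊥ := by
  intro h
  have := P1_181 (K := K)
  rw [h, Ideal.mem_bot, Nat.cast_eq_zero] at this
  omega

theorem P1_norm : Ideal.absNorm (P1 K) = 181 := by
  have hs : Function.Surjective (ev K (2 : ZMod 181) phi_181) := ZMod.ringHom_surjective _
  rw [Ideal.absNorm_apply, Submodule.cardQuot_apply]
  exact (Nat.card_congr (RingHom.quotientKerEquivOfSurjective hs).toEquiv).trans (Nat.card_zmod 181)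

theorem P1_stab (g : Gal(K/ℚ)) (h : g • P1 K = P1 K) : g = 1 := by
  obtain ⟨k, hk, hc, rfl⟩ := gal_eq_s g
  have h1 : z K - 2 ∈ P1 K := by
    rw [mem_P1, map_sub, ev_z, map_ofNat, sub_self]
  have h2 := (Ideal.smul_mem_pointwise_smul_iff (a := s K k)).mpr h1
  rw [h, smul_sub, s_z hc, mem_P1, map_sub, map_pow, ev_z] at h2
  have h3 : s K k • (2 : 𝓞 K) = 2 := by
    have : (2 : 𝓞 K) = 1 + 1 := by norm_num
    rw [this, smul_add, smul_one]
  rw [h3] at h2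
  have h4 : ∀ k < 180, ((2 ^ k : ℕ) : ℤ) % 181 = 2 → k = 1 := by decide +kernel
  have h5 : k = 1 := by
    apply h4 k hk
    have h6 : (((2 ^ k : ℕ) : ℤ) : ZMod 181) = ((2 : ℤ) : ZMod 181) := by
      push_cast
      rw [map_ofNat] at h2
      linear_combination h2
    rw [ZMod.intCast_eq_intCast_iff'] at h6
    simpa using h6
  rw [h5, s_one]

theorem P1_inj (a b : ℕ) (ha : a.Coprime 180) (hb : b.Coprime 180) (ha' : a < 180) (hb' : b < 180)
    (h : s K a • P1 K = s K b • P1 K) : a = b := by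
  have h1 := P1_stab ((s K b)⁻¹ * s K a) (by rw [mul_smul, h, inv_smul_smul])
  rw [inv_mul_eq_one] at h1
  have := s_inj hb ha h1
  rw [Nat.mod_eq_of_lt ha', Nat.mod_eq_of_lt hb'] at this
  exact this.symm

theorem smul_mx (g : Gal(K/ℚ)) : (g • P1 K).IsMaximal :=
  (Ideal.IsPrime.smul g : (g • P1 K).IsPrime).isMaximal (gsmul_ne_bot g P1_bot)

theorem cop_prod {R : Type*} [CommSemiring R] (x : R) (l : List R) (h : ∀ y ∈ l, IsCoprime x y) :
    IsCoprime x l.prod := by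
  induction l with
  | nil => exact isCoprime_one_right
  | cons a l ih =>
    rw [List.prod_cons]
    exact (h a List.mem_cons_self).mul_right (ih fun y hy => h y (List.mem_cons_of_mem _ hy))

theorem dvd_of_all (I : Ideal (𝓞 K)) (as : List ℕ) (hn : as.Nodup) (hc : ∀ a ∈ as, a.Coprime 180 ∧ a < 180)
    (h : ∀ a ∈ as, I ≤ s K a • P1 K) : (as.map fun a => s K a • P1 K).prod ∣ I := by
  induction as with
  | nil => simp
  | cons a as ih =>
    rw [List.map_cons, List.prod_cons]
    have hn' := List.nodup_cons.mp hn
    refine IsCoprime.mul_dvd (cop_prod _ _ ?_) (Ideal.dvd_iff_le.mpr (h a List.mem_cons_self))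
      (ih hn'.2 (fun b hb => hc b (List.mem_cons_of_mem _ hb)) (fun b hb => h b (List.mem_cons_of_mem _ hb)))
    intro y hy
    obtain ⟨b, hb, rfl⟩ := List.mem_map.mp hy
    have m1 := smul_mx (s K a)
    have m2 := smul_mx (s K b)
    apply Ideal.isCoprime_of_isMaximal
    intro e
    obtain ⟨c1, c2⟩ := hc a List.mem_cons_self
    obtain ⟨c3, c4⟩ := hc b (List.mem_cons_of_mem _ hb)
    exact hn'.1 (P1_inj a b c1 c3 c2 c4 e ▸ hb)

theorem prod_norm (as : List ℕ) : Ideal.absNorm (as.map fun a => s K a • P1 K).prod = 181 ^ as.length := by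
  induction as with
  | nil => simp
  | cons a as ih => rw [List.map_cons, List.prod_cons, map_mul, ih, absNorm_gsmul, P1_norm, List.length_cons, pow_succ']

theorem two180 : ((2 : ℕ) : ZMod 181) ^ 180 = 1 := by decide +kernel

theorem span_eq (l : List (ℤ × ℕ)) (as : List ℕ) (hn : as.Nodup) (hc : ∀ a ∈ as, a.Coprime 180 ∧ a < 180)
    (hN : Ideal.absNorm (Ideal.span {el K l}) = 181 ^ as.length)
    (hv : ∀ a ∈ as, ∃ b ∈ L48, a * b % 180 = 1 ∧ evr 2 b l % 181 = 0) :
    Ideal.span {el K l} = (as.map fun a => s K a • P1 K).prod := by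
  apply eq_of_le_of_norm
  · intro h
    have := prod_norm (K := K) as
    rw [h, Ideal.absNorm_bot] at this
    exact absurd this.symm (by positivity)
  · rw [← Ideal.dvd_iff_le]
    refine dvd_of_all _ as hn hc fun a ha => ?_
    obtain ⟨b, hb, h1, h2⟩ := hv a ha
    have hbc : b.Coprime 180 := by
      have := (List.mem_filter.mp hb).2
      exact of_decide_eq_true this
    rw [Ideal.span_singleton_le_iff_mem]
    have h3 : s K a • s K b • el K l = el K l := by
      rw [← mul_smul, s_mul (hc a ha).1 hbc, s_congr (Nat.Coprime.mul_left (hc a ha).1 hbc) (b := 1) h1, s_one, one_smul]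
    rw [← h3, Ideal.smul_mem_pointwise_smul_iff, s_el hbc, mem_P1, ev_el]
    have h4 := evr_spec 181 2 b two180 l
    rw [Nat.cast_ofNat] at h4
    rw [← h4, ZMod.intCast_zmod_eq_zero_iff_dvd]
    exact Int.dvd_of_emod_eq_zero h2
  · rw [hN, prod_norm]

/-- list of automorphisms -/
def lA (i : ℕ) : List ℕ := PF60.hl.map fun h => h * 103 ^ i % 180

variable (K) in
/-- the ideals -/
noncomputable def A (i : ℕ) : Ideal (𝓞 K) := ((lA i).map fun a => s K a • P1 K).prod

theorem smul_list_prod (g : Gal(K/ℚ)) (l : List (Ideal (𝓞 K))) : g • l.prod = (l.map fun I => g • I).prod := by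
  induction l with
  | nil => simp only [List.prod_nil, List.map_nil, smul_one]
  | cons a l ih => rw [List.prod_cons, smul_mul', ih, List.map_cons, List.prod_cons]

theorem lA_cop (i : ℕ) : ∀ a ∈ lA i, a.Coprime 180 := by
  intro a ha
  obtain ⟨h, hh, rfl⟩ := List.mem_map.mp ha
  exact cop_mod (Nat.Coprime.mul_left (PF60_good.d.cop h hh) (Nat.Coprime.pow_left i (by decide)))

theorem smul_A (k i j : ℕ) (hk : k.Coprime 180) (h : ((lA i).map fun a => k * a % 180).Perm (lA j)) :
    s K k • A K i = A K j := by
  rw [A, smul_list_prod, List.map_map, A, ← (h.map fun a => s K a • P1 K).prod_eq, List.map_map]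
  congr 1
  refine List.map_congr_left fun a ha => ?_
  have hc := lA_cop i a ha
  rw [Function.comp_apply, Function.comp_apply, ← mul_smul, s_mul hk hc]
  rw [s_congr (Nat.Coprime.mul_left hk hc) (b := k * a % 180) (by simp)]

theorem lA_step (i : ℕ) : ((lA i).map fun a => 103 * a % 180) = lA (i + 1) := by
  rw [lA, lA, List.map_map]
  refine List.map_congr_left fun h _ => ?_
  rw [Function.comp_apply, pow_succ, Nat.mul_mod_mod]
  congr 1
  ring

theorem A_step (i : ℕ) : s K 103 • A K i = A K (i + 1) :=
  smul_A 103 i (i + 1) (by decide) (by rw [lA_step])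

theorem A_per (i : ℕ) : A K (i + 12) = A K i := by
  have : lA (i + 12) = lA i := by
    rw [lA, lA]
    refine List.map_congr_left fun h _ => ?_
    have h12 : 103 ^ 12 % 180 = 1 % 180 := by norm_num
    have : h * 103 ^ (i + 12) ≡ h * 103 ^ i * 1 [MOD 180] := by
      rw [pow_add, ← mul_assoc]
      exact Nat.ModEq.mul_left _ h12
    rw [mul_one] at this
    exact this
  rw [A, A, this]

theorem A_bot (i : ℕ) : A K i ≠ ⊥ := by
  intro h
  have := prod_norm (K := K) (lA i)
  rw [A] at h
  rw [h, Ideal.absNorm_bot] at this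
  exact absurd this.symm (by positivity)

/-- data -/
def l1 : List (ℤ × ℕ) := lin [-2, 1, 0, 0, 0, 2, 0, 0, 0, 0, 0, 0] PF60.basis
/-- data -/
def l2 : List (ℤ × ℕ) := lin [0, -2, 0, 0, 0, 0, 0, 0, 0, 0, 0, 1] PF60.basis
/-- data -/
def l3 : List (ℤ × ℕ) := lin [2, 2, -1, 1, 2, 1, 1, 1, 1, 0, 1, 0] PF60.basis

theorem fix60 (cs : List ℤ) : ∀ σ ∈ Hs K PF60_good.d, σ • el K (lin cs PF60.basis) = el K (lin cs PF60.basis) := by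
  rintro σ ⟨h, hh, rfl⟩
  exact el_lin_fixed _ _ h (PF60_good.d.cop h hh) (fun o ho => PF60_good.inv o ho h hh)

theorem span_l1 : Ideal.span {el K l1} = A K 0 * A K 6 := by
  rw [span_eq l1 (lA 0 ++ lA 6) (by decide +kernel) (by decide +kernel) ?_ (by decide +kernel), List.map_append,
    List.prod_append, A, A]
  rw [absNorm_el PF60_good.d l1 (fix60 _) (181 ^ 2) (by decide +kernel) (by decide +kernel) (by decide +kernel)]
  rw [← pow_mul]; rfl

theorem span_l2 : Ideal.span {el K l2} = A K 0 * A K 4 * A K 8 := by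
  rw [span_eq l2 (lA 0 ++ lA 4 ++ lA 8) (by decide +kernel) (by decide +kernel) ?_ (by decide +kernel), List.map_append,
    List.prod_append, List.map_append, List.prod_append, A, A, A]
  rw [absNorm_el PF60_good.d l2 (fix60 _) (181 ^ 3) (by decide +kernel) (by decide +kernel) (by decide +kernel)]
  rw [← pow_mul]; rfl

theorem span_l3 : Ideal.span {el K l3} = A K 0 * A K 7 * A K 9 * A K 11 := by
  rw [span_eq l3 (lA 0 ++ lA 7 ++ lA 9 ++ lA 11) (by decide +kernel) (by decide +kernel) ?_ (by decide +kernel),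
    List.map_append, List.prod_append, List.map_append, List.prod_append, List.map_append, List.prod_append, A, A, A, A]
  rw [absNorm_el PF60_good.d l3 (fix60 _) (181 ^ 4) (by decide +kernel) (by decide +kernel) (by decide +kernel)]
  rw [← pow_mul]; rfl

variable (K) in
/-- classes -/
noncomputable def Y (i : ℕ) : ClassGroup (𝓞 K) := cl (A K i)

theorem Y_r1 (i : ℕ) : Y K i * Y K (i + 6) = 1 := by
  have : ∃ x : 𝓞 K, A K i * A K (i + 6) = Ideal.span {x} := by
    induction i with
    | zero => exact ⟨_, span_l1.symm⟩
    | succ i ih =>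
      obtain ⟨x, hx⟩ := ih
      refine ⟨s K 103 • x, ?_⟩
      rw [← smul_span, ← hx, smul_mul', A_step, A_step]
  obtain ⟨x, hx⟩ := this
  rw [Y, Y, ← cl_mul (A_bot _) (A_bot _), hx, cl_span]

theorem Y_r2 (i : ℕ) : Y K i * Y K (i + 4) * Y K (i + 8) = 1 := by
  have : ∃ x : 𝓞 K, A K i * A K (i + 4) * A K (i + 8) = Ideal.span {x} := by
    induction i with
    | zero => exact ⟨_, span_l2.symm⟩
    | succ i ih =>
      obtain ⟨x, hx⟩ := ih
      refine ⟨s K 103 • x, ?_⟩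
      rw [← smul_span, ← hx, smul_mul', smul_mul', A_step, A_step, A_step]
  obtain ⟨x, hx⟩ := this
  rw [Y, Y, Y, ← cl_mul (A_bot _) (A_bot _), ← cl_mul (mul_ne_zero (A_bot _) (A_bot _)) (A_bot _), hx, cl_span]

theorem Y_r3 (i : ℕ) : Y K i * Y K (i + 7) * Y K (i + 9) * Y K (i + 11) = 1 := by
  have : ∃ x : 𝓞 K, A K i * A K (i + 7) * A K (i + 9) * A K (i + 11) = Ideal.span {x} := by
    induction i with
    | zero => exact ⟨_, span_l3.symm⟩
    | succ i ih =>
      obtain ⟨x, hx⟩ := ih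
      refine ⟨s K 103 • x, ?_⟩
      rw [← smul_span, ← hx, smul_mul', smul_mul', smul_mul', A_step, A_step, A_step, A_step]
  obtain ⟨x, hx⟩ := this
  rw [Y, Y, Y, Y, ← cl_mul (A_bot _) (A_bot _), ← cl_mul (mul_ne_zero (A_bot _) (A_bot _)) (A_bot _),
    ← cl_mul (mul_ne_zero (mul_ne_zero (A_bot _) (A_bot _)) (A_bot _)) (A_bot _), hx, cl_span]

end
end C180
end

section
open NumberField Polynomial
open scoped Pointwise nonZeroDivisors

namespace C180
section
variable {K : Type*} [Field K] [NumberField K] [hK : IsCyclotomicExtension {180} ℚ K]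

theorem under_181 (P : Ideal (𝓞 K)) [hP : P.IsPrime] (h : ((181 : ℕ) : 𝓞 K) ∈ P) :
    P.under ℤ = Ideal.span {(181 : ℤ)} := by
  have hm : (Ideal.span {(181 : ℤ)}).IsMaximal :=
    PrincipalIdealRing.isMaximal_of_irreducible (Int.prime_iff_natAbs_prime.mpr (by norm_num)).irreducible
  symm
  apply hm.eq_of_le (Ideal.IsPrime.ne_top inferInstance)
  rw [Ideal.span_singleton_le_iff_mem, Ideal.under_def, Ideal.mem_comap]
  simpa using h

theorem exists_P1 (P : Ideal (𝓞 K)) [hP : P.IsPrime] (h : ((181 : ℕ) : 𝓞 K) ∈ P) :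
    ∃ k, k < 180 ∧ k.Coprime 180 ∧ P = s K k • P1 K := by
  have : IsGalois ℚ K := IsCyclotomicExtension.isGalois {180} ℚ K
  have : Algebra.IsInvariant ℤ (𝓞 K) Gal(K/ℚ) := inferInstance
  obtain ⟨g, hg⟩ := Algebra.IsInvariant.exists_smul_of_under_eq ℤ (𝓞 K) Gal(K/ℚ) (P1 K) P
    (by rw [under_181 P h, under_181 (P1 K) P1_181])
  obtain ⟨k, h1, h2, rfl⟩ := gal_eq_s g
  exact ⟨k, h1, h2, hg⟩

theorem lA_cover : ∀ k < 180, k.Coprime 180 → ∃ i < 12, (PF60.hl.map fun a => a * k % 180).Perm (lA i) := by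
  decide +kernel

theorem h181_lem (Q : Ideal (𝓞 (FF K PF60_good.d))) (hQ : Q.IsPrime) (h0 : Q ≠ ⊥)
    (h : ((181 : ℕ) : 𝓞 (FF K PF60_good.d)) ∈ Q) :
    ∃ i, cl (Q.map (algebraMap _ (𝓞 K))) = Y K i := by
  obtain ⟨P, hP, hPQ⟩ := Ideal.exists_ideal_over_prime_of_isIntegral_of_isDomain
    (S := 𝓞 K) Q (by
      rw [(RingHom.injective_iff_ker_eq_bot _).mp
        (FaithfulSMul.algebraMap_injective (𝓞 (FF K PF60_good.d)) (𝓞 K))]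
      exact bot_le)
  have hP181 : ((181 : ℕ) : 𝓞 K) ∈ P := by
    rw [← hPQ, Ideal.mem_comap, map_natCast] at h
    exact h
  obtain ⟨k, hk, hc, rfl⟩ := exists_P1 P hP181
  have hb : s K k • P1 K ≠ ⊥ := gsmul_ne_bot _ P1_bot
  obtain ⟨J, hJ, e⟩ := norm_H PF60_good.d (s K k • P1 K) hb
  obtain ⟨i, -, hi⟩ := lA_cover k hk hc
  have e2 : J.map (algebraMap (𝓞 (FF K PF60_good.d)) (𝓞 K)) = A K i := by
    rw [e, A, ← (hi.map fun a => s K a • P1 K).prod_eq, List.map_map]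
    congr 1
    refine List.map_congr_left fun a ha => ?_
    have hca := PF60_good.d.cop a ha
    rw [Function.comp_apply, ← mul_smul, s_mul hca hc]
    rw [s_congr (Nat.Coprime.mul_left hca hc) (b := a * k % 180) (by simp)]
  have hJN : Ideal.absNorm J = 181 := by
    have h1 := absNorm_map PF60_good.d J
    rw [e2, A, prod_norm] at h1
    have h2 : (lA i).length = 4 := by rw [lA, List.length_map]; rfl
    have h3 : PF60.hl.length = 4 := rfl
    rw [h2, h3] at h1
    exact (Nat.pow_left_injective (n := 4) (by norm_num) h1).symm
  have hle : J ≤ Q := by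
    rw [← hPQ, ← Ideal.map_le_iff_le_comap, e]
    have h1 : PF60.hl = 1 :: [19, 71, 89] := rfl
    rw [h1, List.map_cons, List.prod_cons, s_one, one_smul]
    exact Ideal.dvd_iff_le.mp (dvd_mul_right _ _)
  obtain ⟨M, hM⟩ := Ideal.dvd_iff_le.mpr hle
  have hN := congrArg Ideal.absNorm hM
  rw [map_mul, hJN] at hN
  have hJQ : J = Q := by
    rcases (Nat.dvd_prime (by norm_num : Nat.Prime 181)).mp ⟨_, hN⟩ with h1 | h1
    · rw [Ideal.absNorm_eq_one_iff] at h1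
      exact absurd h1 hQ.ne_top
    · have h2 : Ideal.absNorm M = 1 := by rw [h1] at hN; omega
      rw [Ideal.absNorm_eq_one_iff] at h2
      rw [hM, h2, Ideal.mul_top]
  exact ⟨i, by rw [← hJQ, e2, Y]⟩

theorem y_rel {G : Type*} [AddCommGroup G] (y : ℕ → G) (r1 : ∀ i, y i + y (i + 6) = 0)
    (r2 : ∀ i, y i + y (i + 4) + y (i + 8) = 0)
    (r3 : ∀ i, y i + y (i + 7) + y (i + 9) + y (i + 11) = 0) (i : ℕ) :
    (5 : ℤ) • y i = 0 ∧ y (i + 2) = y i - (2 : ℤ) • y (i + 1) := by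
  have a (i : ℕ) : y i = (2 : ℤ) • y (i + 3) := by
    linear_combination (norm := module) r3 i - r1 (i + 1) - r1 (i + 3) - r1 (i + 5) + r2 (i + 1) - r1 (i + 3)
  have b (i : ℕ) : (5 : ℤ) • y i = 0 := by
    linear_combination (norm := module) a i + (2 : ℤ) • a (i + 3) + (4 : ℤ) • r1 i
  refine ⟨b i, ?_⟩
  linear_combination (norm := module) r1 (i + 2) - r2 i + (2 : ℤ) • a (i + 1) + b (i + 4)

theorem Y_rel (i : ℕ) : Y K i ^ 5 = 1 ∧ Y K (i + 2) * Y K (i + 1) ^ 2 = Y K i := by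
  have h := y_rel (G := Additive (ClassGroup (𝓞 K))) (fun i => Additive.ofMul (Y K i))
    (fun i => by rw [← ofMul_mul, Y_r1, ofMul_one])
    (fun i => by rw [← ofMul_mul, ← ofMul_mul, Y_r2, ofMul_one])
    (fun i => by rw [← ofMul_mul, ← ofMul_mul, ← ofMul_mul, Y_r3, ofMul_one]) i
  refine ⟨?_, ?_⟩
  · have := congrArg Additive.toMul h.1
    exact_mod_cast this
  · have h2 := h.2
    rw [eq_sub_iff_add_eq] at h2
    have := congrArg Additive.toMul h2
    exact_mod_cast this

theorem Y_mem (S : Subgroup (ClassGroup (𝓞 K))) (h0 : Y K 0 ∈ S) (h1 : Y K 1 ∈ S) (i : ℕ) : Y K i ∈ S := by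
  have : Y K i ∈ S ∧ Y K (i + 1) ∈ S := by
    induction i with
    | zero => exact ⟨h0, h1⟩
    | succ i ih =>
      refine ⟨ih.2, ?_⟩
      have := (Y_rel (K := K) i).2
      rw [← eq_mul_inv_iff_mul_eq] at this
      rw [show i + 1 + 1 = i + 2 from rfl, this]
      exact S.mul_mem ih.1 (S.inv_mem (S.pow_mem ih.2 2))
  exact this.1

theorem A_conj0 : s K 179 • A K 0 = A K 6 := smul_A 179 0 6 (by decide) (by decide +kernel)

variable (K) in
/-- the element eta, and its conjugate for `c = 179` -/
noncomputable def et (c : ℕ) : 𝓞 K := s K c • el K l3 * s K (c * 103 % 180) • el K l2 *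
  (s K (c * 127 % 180) • el K l3 * s K (c * 121 % 180) • el K l2) ^ 2

theorem sAperm (k i j : ℕ) (hk : k.Coprime 180) (h : ((lA i).map fun a => k * a % 180).isPerm (lA j) = true) :
    s K k • A K i = A K j := smul_A k i j hk (List.isPerm_iff.mp h)

theorem span_et : Ideal.span {et K 1} * A K 6 ^ 5 = Ideal.span {et K 179} * A K 0 ^ 5 := by
  simp only [et, ← Ideal.span_singleton_mul_span_singleton, ← Ideal.span_singleton_pow, ← smul_span,
    span_l2, span_l3, smul_mul']
  norm_num only
  rw [sAperm 1 0 0 (by decide) (by decide +kernel), sAperm 1 7 7 (by decide) (by decide +kernel),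
    sAperm 1 9 9 (by decide) (by decide +kernel), sAperm 1 11 11 (by decide) (by decide +kernel),
    sAperm 103 0 1 (by decide) (by decide +kernel), sAperm 103 4 5 (by decide) (by decide +kernel),
    sAperm 103 8 9 (by decide) (by decide +kernel),
    sAperm 127 0 3 (by decide) (by decide +kernel), sAperm 127 7 10 (by decide) (by decide +kernel),
    sAperm 127 9 0 (by decide) (by decide +kernel), sAperm 127 11 2 (by decide) (by decide +kernel),
    sAperm 121 0 4 (by decide) (by decide +kernel), sAperm 121 4 8 (by decide) (by decide +kernel),
    sAperm 121 8 0 (by decide) (by decide +kernel)]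
  rw [sAperm 179 0 6 (by decide) (by decide +kernel), sAperm 179 7 1 (by decide) (by decide +kernel),
    sAperm 179 9 3 (by decide) (by decide +kernel), sAperm 179 11 5 (by decide) (by decide +kernel),
    sAperm 77 0 7 (by decide) (by decide +kernel), sAperm 77 4 11 (by decide) (by decide +kernel),
    sAperm 77 8 3 (by decide) (by decide +kernel),
    sAperm 53 0 9 (by decide) (by decide +kernel), sAperm 53 7 4 (by decide) (by decide +kernel),
    sAperm 53 9 6 (by decide) (by decide +kernel), sAperm 53 11 8 (by decide) (by decide +kernel),
    sAperm 59 0 10 (by decide) (by decide +kernel), sAperm 59 4 2 (by decide) (by decide +kernel),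
    sAperm 59 8 6 (by decide) (by decide +kernel)]
  ring

theorem phi_1801 : Phi ((722 : ℕ) : ZMod 1801) = 0 := by decide +kernel
theorem p722 : ((722 : ℕ) : ZMod 1801) ^ 180 = 1 := by decide +kernel

theorem ev_s (k : ℕ) (hk : k.Coprime 180) (l : List (ℤ × ℕ)) :
    ev K ((722 : ℕ) : ZMod 1801) phi_1801 (s K k • el K l) = ((evr 722 k l : ℤ) : ZMod 1801) := by
  rw [s_el hk, ev_el, evr_spec _ _ _ p722]

theorem ev_et (c : ℕ) (hc : c.Coprime 180) : ev K ((722 : ℕ) : ZMod 1801) phi_1801 (et K c) =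
    ((evr 722 c l3 * evr 722 (c * 103 % 180) l2 * (evr 722 (c * 127 % 180) l3 * evr 722 (c * 121 % 180) l2) ^ 2 : ℤ) :
      ZMod 1801) := by
  simp only [et, map_mul, map_pow]
  rw [ev_s _ hc, ev_s _ (cop_mod (hc.mul_left (by decide))), ev_s _ (cop_mod (hc.mul_left (by decide))),
    ev_s _ (cop_mod (hc.mul_left (by decide)))]
  push_cast
  rfl

theorem conj_et : s K 179 • et K 1 = et K 179 := by
  have h (k : ℕ) (hk : k.Coprime 180) : s K 179 * s K k = s K (179 * k % 180) := by
    rw [s_mul (by decide) hk, s_congr (Nat.Coprime.mul_left (by decide) hk) (b := 179 * k % 180) (by simp)]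
  simp only [et, smul_mul', smul_pow', ← mul_smul]
  rw [h _ (by decide), h _ (by decide), h _ (by decide), h _ (by decide)]

theorem f1801 (x : ZMod 1801) (hx : x ≠ 0) : x ^ 1800 = 1 := ZMod.pow_card_sub_one_eq_one hx

theorem Y0_ne_one : Y K 0 ≠ 1 := by
  intro hw
  obtain ⟨γ, hγ, e⟩ := (cl_eq_one (A_bot 0)).mp hw
  have e6 : A K 6 = Ideal.span {s K 179 • γ} := by rw [← A_conj0, e, smul_span]
  have h6 := span_et (K := K)
  rw [e, e6, Ideal.span_singleton_pow, Ideal.span_singleton_pow, Ideal.span_singleton_mul_span_singleton,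
    Ideal.span_singleton_mul_span_singleton, Ideal.span_singleton_eq_span_singleton] at h6
  obtain ⟨u, hu⟩ := h6
  have hu' := congrArg (fun x => s K 179 • x) hu
  simp only [smul_mul', smul_pow', conj_conj] at hu'
  have ce := conj_et (K := K)
  have ce' : s K 179 • et K 179 = et K 1 := by rw [← ce, conj_conj]
  rw [ce, ce'] at hu'
  have ne : ∀ c, c.Coprime 180 → ((evr 722 c l3 * evr 722 (c * 103 % 180) l2 * (evr 722 (c * 127 % 180) l3 * evr 722 (c * 121 % 180) l2) ^ 2 : ℤ) :
      ZMod 1801) ≠ 0 → ev K ((722 : ℕ) : ZMod 1801) phi_1801 (et K c) ≠ 0 := by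
    intro c hc h
    rwa [ev_et c hc]
  have n1 := ne 1 (by decide) (by decide +kernel)
  have n2 := ne 179 (by decide) (by decide +kernel)
  have m1 : et K 1 ≠ 0 := by
    intro h; rw [h, map_zero] at n1; exact n1 rfl
  have m2 : s K 179 • γ ≠ 0 := by
    intro h
    apply hγ
    rw [← conj_conj γ, h, smul_zero]
  have huu : (u : 𝓞 K) * s K 179 • (u : 𝓞 K) = 1 := by
    have h0 : et K 1 * (s K 179 • γ) ^ 5 ≠ 0 := mul_ne_zero m1 (pow_ne_zero _ m2)
    apply mul_left_cancel₀ h0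
    rw [mul_one, ← mul_assoc, hu]
    exact hu'
  have hv := root_of_conj _ huu
  have key : et K 1 ^ 360 * (s K 179 • γ) ^ 1800 = et K 179 ^ 360 * γ ^ 1800 := by
    have h1 := congrArg (fun x => x ^ 360) hu
    have h2 : (u : 𝓞 K) ^ 360 = 1 := by rw [show 360 = 180 * 2 from rfl, pow_mul, hv, one_pow]
    simp only [mul_pow, ← pow_mul, h2, mul_one] at h1
    exact h1
  have d1 : γ ∣ et K 1 := by
    rw [← Ideal.span_singleton_le_span_singleton, ← e]
    have h1 : Ideal.span {et K 1} = Ideal.span {el K l3} * Ideal.span {s K 103 • el K l2 *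
      (s K 127 • el K l3 * s K 121 • el K l2) ^ 2} := by
      rw [Ideal.span_singleton_mul_span_singleton, et, s_one, one_smul, mul_assoc]
    rw [h1, span_l3]
    refine Ideal.dvd_iff_le.mp ?_
    simp only [mul_assoc]
    exact dvd_mul_right _ _
  have d2 : s K 179 • γ ∣ et K 179 := by
    obtain ⟨t, ht⟩ := d1
    exact ⟨s K 179 • t, by rw [← ce, ht, smul_mul']⟩
  have g1 : ev K ((722 : ℕ) : ZMod 1801) phi_1801 γ ≠ 0 := by
    intro h
    obtain ⟨t, ht⟩ := d1
    rw [ht, map_mul, h, zero_mul] at n1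
    exact n1 rfl
  have g2 : ev K ((722 : ℕ) : ZMod 1801) phi_1801 (s K 179 • γ) ≠ 0 := by
    intro h
    obtain ⟨t, ht⟩ := d2
    rw [ht, map_mul, h, zero_mul] at n2
    exact n2 rfl
  have h1 := congrArg (ev K ((722 : ℕ) : ZMod 1801) phi_1801) key
  rw [map_mul, map_mul, map_pow, map_pow, map_pow, map_pow, f1801 _ g1, f1801 _ g2, mul_one, mul_one,
    ev_et 1 (by decide), ev_et 179 (by decide)] at h1
  revert h1
  decide +kernel

theorem shift_rel (b d i : ℕ) (h : Y K i ^ b * Y K (i + 1) ^ d = 1) : Y K (i + 1) ^ b * Y K (i + 2) ^ d = 1 := by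
  have hb (j : ℕ) : A K j ^ b * A K (j + 1) ^ d ≠ ⊥ := mul_ne_zero (pow_ne_zero _ (A_bot _)) (pow_ne_zero _ (A_bot _))
  have hc (j : ℕ) : Y K j ^ b * Y K (j + 1) ^ d = cl (A K j ^ b * A K (j + 1) ^ d) := by
    rw [cl_mul (pow_ne_zero _ (A_bot _)) (pow_ne_zero _ (A_bot _)), cl_pow (A_bot _), cl_pow (A_bot _), Y, Y]
  rw [hc, cl_eq_one (hb i)] at h
  obtain ⟨x, -, hx⟩ := h
  rw [hc, show A K (i + 1) ^ b * A K (i + 1 + 1) ^ d = Ideal.span {s K 103 • x} by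
    rw [← smul_span, ← hx, smul_mul', smul_pow', smul_pow', A_step, A_step], cl_span]

theorem Y_indep (b d : ℕ) (hb : b < 5) (hd : d < 5) (h : Y K 0 ^ b * Y K 1 ^ d = 1) : b = 0 ∧ d = 0 := by
  have h1 := shift_rel b d 0 h
  obtain ⟨r5, r2⟩ := Y_rel (K := K) 0
  have s5 := (Y_rel (K := K) 1).1
  simp only [zero_add] at h1 r2
  -- `Y2 = Y0 * Y1 ^ 3`
  have e2 : Y K 2 = Y K 0 * Y K 1 ^ 3 := by
    rw [← r2, mul_assoc, ← pow_add, s5, mul_one]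
  rw [e2] at h1
  -- the second relation
  have h2 : Y K 0 ^ d * Y K 1 ^ (b + 3 * d) = 1 := by
    rw [← h1, mul_pow, ← pow_mul, pow_add]
    simp only [mul_comm, mul_left_comm]
  have h3 : Y K 0 ^ (b * (b + 3 * d) + 4 * (d * d)) = 1 := by
    have x1 : (Y K 0 ^ b * Y K 1 ^ d) ^ (b + 3 * d) * (Y K 0 ^ d * Y K 1 ^ (b + 3 * d)) ^ (4 * d) = 1 := by
      rw [h, h2, one_pow, one_pow, mul_one]
    have x2 : Y K 1 ^ (5 * (d * (b + 3 * d))) = 1 := by rw [pow_mul, s5, one_pow]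
    rw [← x1, mul_pow, mul_pow, ← pow_mul, ← pow_mul, ← pow_mul, ← pow_mul, mul_mul_mul_comm, ← pow_add, ← pow_add,
      show d * (b + 3 * d) + (b + 3 * d) * (4 * d) = 5 * (d * (b + 3 * d)) by ring, x2, mul_one]
    congr 1
    ring
  have : Fact (Nat.Prime 5) := ⟨by norm_num⟩
  have ho : orderOf (Y K 0) = 5 := orderOf_eq_prime r5 Y0_ne_one
  have h4 := orderOf_dvd_of_pow_eq_one h3
  rw [ho] at h4
  clear * - h4 hb hd
  interval_cases b <;> interval_cases d <;> omega
end
end C180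
end

section
open NumberField Polynomial
open scoped Pointwise nonZeroDivisors

namespace C180
section
variable {K : Type*} [Field K] [NumberField K] [hK : IsCyclotomicExtension {180} ℚ K]

/-- powers of an element of given exponent -/
noncomputable def zh {G : Type*} [CommGroup G] (n : ℕ) (g : G) (h : g ^ n = 1) : Multiplicative (ZMod n) →* G :=
  AddMonoidHom.toMultiplicativeLeft (ZMod.lift n ⟨(zmultiplesHom (Additive G)) (Additive.ofMul g), by
    simp only [zmultiplesHom_apply, natCast_zsmul]
    rw [← ofMul_pow, h, ofMul_one]⟩)

theorem zh_apply {G : Type*} [CommGroup G] (n : ℕ) (g : G) (h : g ^ n = 1) (a : ℕ) :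
    zh n g h (Multiplicative.ofAdd (a : ZMod n)) = g ^ a := by
  have : ((a : ℤ) : ZMod n) = (a : ZMod n) := Int.cast_natCast a
  rw [zh, ← this]
  refine (congrArg Additive.toMul (ZMod.lift_coe n _ (a : ℤ))).trans ?_
  rw [zmultiplesHom_apply, natCast_zsmul, ← ofMul_pow, toMul_ofMul]

theorem abstract_iso {G : Type*} [CommGroup G] (w y v : G) (hw : w ^ 3 = 1) (hy : y ^ 5 = 1) (hv : v ^ 5 = 1)
    (hw1 : w ≠ 1) (hi : ∀ b d : ℕ, b < 5 → d < 5 → y ^ b * v ^ d = 1 → b = 0 ∧ d = 0)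
    (htop : ∀ S : Subgroup G, w ∈ S → y ∈ S → v ∈ S → S = ⊤) :
    Nonempty (G ≃* Multiplicative (ZMod 3) × Multiplicative (ZMod 5) × Multiplicative (ZMod 5)) := by
  let f : Multiplicative (ZMod 3) × Multiplicative (ZMod 5) × Multiplicative (ZMod 5) →* G :=
    (zh 3 w hw).coprod ((zh 5 y hy).coprod (zh 5 v hv))
  have hf (a b c : ℕ) : f (Multiplicative.ofAdd (a : ZMod 3), Multiplicative.ofAdd (b : ZMod 5),
      Multiplicative.ofAdd (c : ZMod 5)) = w ^ a * (y ^ b * v ^ c) := by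
    simp only [f, MonoidHom.coprod_apply, zh_apply]
  have hsurj : Function.Surjective f := by
    rw [← MonoidHom.range_eq_top]
    apply htop
    · exact ⟨_, by rw [hf 1 0 0]; simp⟩
    · exact ⟨_, by rw [hf 0 1 0]; simp⟩
    · exact ⟨_, by rw [hf 0 0 1]; simp⟩
  have hinj : Function.Injective f := by
    rw [injective_iff_map_eq_one]
    rintro ⟨a, b, c⟩ h
    obtain ⟨a, rfl⟩ := Multiplicative.ofAdd.surjective a
    obtain ⟨b, rfl⟩ := Multiplicative.ofAdd.surjective b
    obtain ⟨c, rfl⟩ := Multiplicative.ofAdd.surjective c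
    rw [← ZMod.natCast_zmod_val a, ← ZMod.natCast_zmod_val b, ← ZMod.natCast_zmod_val c, hf] at h
    have ha := ZMod.val_lt a
    have hb := ZMod.val_lt b
    have hc := ZMod.val_lt c
    rw [← ZMod.natCast_zmod_val a, ← ZMod.natCast_zmod_val b, ← ZMod.natCast_zmod_val c]
    generalize a.val = a at *
    generalize b.val = b at *
    generalize c.val = c at *
    have e5 : (y ^ b * v ^ c) ^ 5 = 1 := by
      rw [mul_pow, ← pow_mul, ← pow_mul, mul_comm b, mul_comm c, pow_mul, pow_mul, hy, hv, one_pow, one_pow, one_mul]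
    have e3 : (w ^ a) ^ 3 = 1 := by rw [← pow_mul, mul_comm, pow_mul, hw, one_pow]
    have e1 : w ^ a = 1 := by
      have h1 : (w ^ a) ^ 5 = 1 := by
        have := congrArg (fun x => x ^ 5) h
        simpa only [mul_pow (w ^ a), e5, mul_one, one_pow] using this
      have h2 : (w ^ a) ^ 6 = 1 := by rw [show 6 = 3 * 2 from rfl, pow_mul, e3, one_pow]
      rw [pow_succ, h1, one_mul] at h2
      exact h2
    rw [e1, one_mul] at h
    obtain ⟨rfl, rfl⟩ := hi b c hb hc h
    have : Fact (Nat.Prime 3) := ⟨by norm_num⟩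
    have ho : orderOf w = 3 := orderOf_eq_prime hw hw1
    have h4 := orderOf_dvd_of_pow_eq_one e1
    rw [ho] at h4
    have : a = 0 := Nat.eq_zero_of_dvd_of_lt h4 ha
    subst this
    simp only [Nat.cast_zero]
    rfl
  exact ⟨(MulEquiv.ofBijective f ⟨hinj, hsurj⟩).symm⟩

theorem final_iso : Nonempty (ClassGroup (𝓞 K) ≃*
    Multiplicative (ZMod 3) × Multiplicative (ZMod 5) × Multiplicative (ZMod 5)) := by
  refine abstract_iso (cw K) (Y K 0) (Y K 1) cw_three (Y_rel 0).1 (Y_rel 1).1 cw_ne_one Y_indep ?_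
  intro S hw h0 h1
  apply top_of_mem S odd_card
  · intro Q hQ hb h
    have e : ((30 : ℕ) : 𝓞 K) = ((2 : ℕ) : 𝓞 K) * (((3 : ℕ) : 𝓞 K) * ((5 : ℕ) : 𝓞 K)) := by norm_num
    rw [e] at h
    rcases hQ.mem_or_mem h with h | h
    · rw [cl_two Q hQ hb h]; exact S.one_mem
    rcases hQ.mem_or_mem h with h | h
    · rcases cl_three Q hQ h with h | h
      · rw [h]; exact hw
      · rw [h]; exact S.inv_mem hw
    · rw [cl_five Q hQ hb h]; exact S.one_mem
  · intro Q hQ hb h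
    obtain ⟨i, hi⟩ := h181_lem Q hQ hb h
    rw [hi]
    exact Y_mem S h0 h1 i

theorem final_card : classNumber K = 75 := by
  obtain ⟨e⟩ := final_iso (K := K)
  rw [classNumber, ← Nat.card_eq_fintype_card, Nat.card_congr e.toEquiv, Nat.card_prod, Nat.card_prod]
  have h3 : Nat.card (Multiplicative (ZMod 3)) = 3 := Nat.card_zmod 3
  have h5 : Nat.card (Multiplicative (ZMod 5)) = 5 := Nat.card_zmod 5
  rw [h3, h5]
end
end C180
end

theorem classGroup_cyclotomic_180
    (K : Type*) [Field K] [NumberField K]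
    [IsCyclotomicExtension {180} ℚ K] :
    Nonempty (ClassGroup (𝓞 K) ≃*
        Multiplicative (ZMod 3) × Multiplicative (ZMod 5) × Multiplicative (ZMod 5)) ∧
      NumberField.classNumber K = 75 :=
  ⟨C180.final_iso, C180.final_card⟩
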